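/- arXiv:1401.2124 — 2 statements merged into one kernel-verified Lean document; each statement's English description precedes it below -/
import Mathlib

section
/- Let P = vc^k(Δ^{n_1} × Δ^{n_2}) be a generalized truncation polytope with n_1 ≥ n_2 > 1 and k ≥ 0, of dimension d = n_1 + n_2 and with m = n_1 + n_2 + 2 + k facets. Then for 1 ≤ i ≤ k+1 the bigraded Betti numbers of P over a field k of characteristic zero are: (a) if n_1 = n_2 = n then β^{-i,2(i+n)}(P) = 2·C(k, i−1); (b) if n_1 > n_2 then β^{-i,2(i+n_1)}(P) = β^{-i,2(i+n_2)}(P) = C(k, i−1); (c) β^{-i,2(i+1)}(P) = β^{-(k+2−i),2(k+1−i+n_1+n_2)}(P) = i·C(k+2, i+1) − C(k, i−1); (d) β^{0,0}(P) = β^{-(m−d),2m}(P) = 1. All other bigraded Betti numbers are zero. (Here C(b,c) denotes the binomial coefficient, with C(b,c) = 0 if b < c or if b or c is negative.) -/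
open Finset Module

/-- An abstract simplicial complex on the vertex type `V`: a collection of
nonempty finite subsets of `V` (the *faces*), closed under passing to
nonempty subsets. -/
structure SimComplex (V : Type*) where
  faces : Set (Finset V)
  not_empty_mem : ∅ ∉ faces
  down_closed : ∀ ⦃s t : Finset V⦄, s ∈ faces → t ⊆ s → t.Nonempty → t ∈ faces

namespace SimComplex

variable {V : Type*}

/-- The `n`-dimensional faces of `K` (faces with `n + 1` vertices). -/
def Face (K : SimComplex V) (n : ℕ) : Type _ :=
  {s : Finset V // s ∈ K.faces ∧ s.card = n + 1}

/-- The space of simplicial `n`-chains of `K` with coefficients in `𝕜`. -/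
abbrev chains (K : SimComplex V) (𝕜 : Type*) [Field 𝕜] (n : ℕ) : Type _ :=
  K.Face n →₀ 𝕜

variable (𝕜 : Type*) [Field 𝕜] [LinearOrder V]

/-- The boundary of a single `(n+1)`-dimensional face, as an alternating sum of its
codimension-one subfaces (signs determined by the linear order on the vertices). -/
noncomputable def faceBoundary (K : SimComplex V) (n : ℕ) (s : K.Face (n + 1)) :
    K.chains 𝕜 n :=
  ∑ a ∈ s.1.attach, ((-1 : 𝕜) ^ (s.1.filter (fun b => b < a.1)).card) •
    Finsupp.single
      ⟨s.1.erase a.1,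
        K.down_closed s.2.1 (Finset.erase_subset _ _)
          (Finset.card_pos.mp (by rw [Finset.card_erase_of_mem a.2, s.2.2]; omega)),
        by rw [Finset.card_erase_of_mem a.2, s.2.2]; omega⟩ (1 : 𝕜)

/-- The simplicial boundary operator `∂ : C_{n+1}(K) → C_n(K)`. -/
noncomputable def boundary (K : SimComplex V) (n : ℕ) :
    K.chains 𝕜 (n + 1) →ₗ[𝕜] K.chains 𝕜 n :=
  Finsupp.lsum 𝕜 fun s => LinearMap.toSpanSingleton 𝕜 _ (K.faceBoundary 𝕜 n s)

/-- The augmentation `C_0(K) → 𝕜` sending every vertex to `1`. -/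
noncomputable def augmentation (K : SimComplex V) : K.chains 𝕜 0 →ₗ[𝕜] 𝕜 :=
  Finsupp.lsum 𝕜 fun _ => LinearMap.id

/-- The reduced cycles in degree `n`. -/
noncomputable def cycles (K : SimComplex V) : (n : ℕ) → Submodule 𝕜 (K.chains 𝕜 n)
  | 0 => LinearMap.ker (K.augmentation 𝕜)
  | (n + 1) => LinearMap.ker (K.boundary 𝕜 n)

/-- The dimension of the reduced simplicial homology `H̃_n(K; 𝕜)` in degree `n ≥ 0`
(over the field `𝕜`, this also equals the dimension of reduced cohomology). -/
noncomputable def hdimNat (K : SimComplex V) (n : ℕ) : ℕ :=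
  finrank 𝕜 ↥(K.cycles 𝕜 n) -
    finrank 𝕜 ↥(LinearMap.range (K.boundary 𝕜 n) ⊓ K.cycles 𝕜 n)

/-- The dimension of reduced simplicial (co)homology `H̃_i(K; 𝕜)` for `i : ℤ`;
in degree `-1` it is `1` precisely for the empty complex. -/
noncomputable def hdim (K : SimComplex V) (i : ℤ) : ℕ :=
  letI := Classical.dec (K.faces = ∅)
  if i = -1 then (if K.faces = ∅ then 1 else 0)
  else if 0 ≤ i then K.hdimNat 𝕜 i.toNat else 0

/-- The full subcomplex of `K` on a vertex subset `J`. -/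
def restrict (K : SimComplex V) (J : Finset V) : SimComplex V where
  faces := {s | s ∈ K.faces ∧ s ⊆ J}
  not_empty_mem := fun h => K.not_empty_mem h.1
  down_closed := fun _ _ hs hts ht => ⟨K.down_closed hs.1 hts ht, hts.trans hs.2⟩

/-- The bigraded Betti numbers `β^{-i,2j}(𝕜[K]) = dim 𝕜Tor^{-i,2j}_{𝕜[v₁,…,v_m]}(𝕜[K],𝕜)`
of the Stanley–Reisner ring of `K`, expressed through Hochster's formula:
`β^{-i,2j}(K) = ∑_{J ⊆ [m], |J| = j} dim H̃^{j-i-1}(K_J; 𝕜)`. -/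
noncomputable def bbetti (K : SimComplex V) [Fintype V] (i j : ℕ) : ℕ :=
  ∑ J ∈ Finset.powersetCard j (Finset.univ : Finset V),
    (K.restrict J).hdim 𝕜 ((j : ℤ) - i - 1)

/-- Bigraded Betti numbers with integer (possibly out-of-range) indices:
`Tor^{-i,2j}` vanishes unless `i, j ≥ 0`. -/
noncomputable def bbettiZ (K : SimComplex V) [Fintype V] (i j : ℤ) : ℕ :=
  if 0 ≤ i ∧ 0 ≤ j then K.bbetti 𝕜 i.toNat j.toNat else 0

/-- `F` is a facet (maximal face) of `K`. -/
def IsFacet (K : SimComplex V) (F : Finset V) : Prop :=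
  F ∈ K.faces ∧ ∀ s ∈ K.faces, F ⊆ s → s = F

end SimComplex
namespace SimComplex

/-- The boundary complex `∂Δ^{n 0} * ⋯ * ∂Δ^{n (r-1)}` of the simplicial polytope dual to
the product of simplices `Δ^{n 0} × ⋯ × Δ^{n (r-1)}`: a subset is a face iff it is nonempty
and misses at least one vertex from every join factor. -/
def prodSimplicesDual (r : ℕ) (n : Fin r → ℕ) :
    SimComplex (Σ p : Fin r, Fin (n p + 1)) where
  faces := {s | s.Nonempty ∧
    ∀ p : Fin r, ∃ q : Fin (n p + 1), (⟨p, q⟩ : Σ p : Fin r, Fin (n p + 1)) ∉ s}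
  not_empty_mem := fun h => Finset.not_nonempty_empty h.1
  down_closed := fun _ _ hs hts ht =>
    ⟨ht, fun p => (hs.2 p).imp fun _ hq hmem => hq (hts hmem)⟩

/-- The stellar subdivision of the simplicial complex `K` at the face `F`, with a new
apex vertex `none`: faces of `K` not containing `F` survive, and cones (with apex `none`)
over proper subsets of `F` are added.  When `F` is a facet of `K`, this is the complex
obtained by replacing the facet `F` with the cone over its boundary, i.e. the operation
dual to cutting a vertex of a simple polytope. -/
def stellar (K : SimComplex V) (F : Finset V) : SimComplex (Option V) where
  faces := {s | s.Nonempty ∧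
    ((none ∉ s ∧ Finset.eraseNone s ∈ K.faces ∧ ¬ F ⊆ Finset.eraseNone s) ∨
     (none ∈ s ∧ Finset.eraseNone s ⊂ F ∧
        (Finset.eraseNone s ∈ K.faces ∨ Finset.eraseNone s = ∅)))}
  not_empty_mem := fun h => Finset.not_nonempty_empty h.1
  down_closed := by
    rintro s t ⟨hsne, hs⟩ hts htne
    refine ⟨htne, ?_⟩
    have hsub : Finset.eraseNone t ⊆ Finset.eraseNone s := by
      intro a ha
      rw [Finset.mem_eraseNone] at ha ⊢
      exact hts ha
    rcases hs with ⟨hn, hf, hF⟩ | ⟨hn, hF, hf⟩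
    · left
      have hnt : none ∉ t := fun h => hn (hts h)
      have htne' : (Finset.eraseNone t).Nonempty := by
        obtain ⟨x, hx⟩ := htne
        match x with
        | none => exact absurd hx hnt
        | some a => exact ⟨a, Finset.mem_eraseNone.mpr hx⟩
      exact ⟨hnt, K.down_closed hf hsub htne',
        fun h => hF (h.trans hsub)⟩
    · have hKs : (Finset.eraseNone t).Nonempty → Finset.eraseNone t ∈ K.faces := by
        intro htne'
        have hsne' : (Finset.eraseNone s).Nonempty := htne'.mono hsub
        rcases hf with hf | hf
        · exact K.down_closed hf hsub htne'
        · rw [hf] at hsub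
          exact absurd (Finset.subset_empty.mp hsub) htne'.ne_empty
      by_cases hnt : none ∈ t
      · right
        refine ⟨hnt, lt_of_le_of_lt hsub hF, ?_⟩
        rcases Finset.eq_empty_or_nonempty (Finset.eraseNone t) with h | h
        · exact Or.inr h
        · exact Or.inl (hKs h)
      · left
        have htne' : (Finset.eraseNone t).Nonempty := by
          obtain ⟨x, hx⟩ := htne
          match x with
          | none => exact absurd hx hnt
          | some a => exact ⟨a, Finset.mem_eraseNone.mpr hx⟩
        refine ⟨hnt, hKs htne', fun h => ?_⟩
        exact (lt_of_le_of_lt (h.trans hsub) hF).ne rfl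

/-- An isomorphism of simplicial complexes: a bijection of vertex types carrying
faces exactly to faces. -/
def Iso {W : Type*} (K : SimComplex V) (L : SimComplex W) : Prop :=
  ∃ e : V ≃ W, ∀ s : Finset V, s ∈ K.faces ↔ s.map e.toEmbedding ∈ L.faces

end SimComplex

open SimComplex in
/-- `K` is (isomorphic to) the boundary complex `K_P` of a generalized truncation polytope
`P = vc^k(Δ^{n 0} × ⋯ × Δ^{n (r-1)})` of type `(k; n)`, i.e. it is obtained from
`∂Δ^{n 0} * ⋯ * ∂Δ^{n (r-1)}` by `k` successive stellar subdivisions of facets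
(the operation dual to cutting a vertex of a simple polytope). -/
def IsGenTruncCx (r : ℕ) (n : Fin r → ℕ) : ℕ → (V : Type) → SimComplex V → Prop
  | 0, _, K => Iso (prodSimplicesDual r n) K
  | (k + 1), _, K => ∃ (W : Type) (L : SimComplex W) (F : Finset W),
      IsGenTruncCx r n k W L ∧ L.IsFacet F ∧ Iso (stellar L F) K

set_option linter.unusedSectionVars false

namespace GTB

section lin

variable {V : Type} [Fintype V] [LinearOrder V] {𝕜 : Type} [Field 𝕜]

/-- sign of `a` relative to `s` -/
def sg (𝕜 : Type) [Field 𝕜] (a : V) (s : Finset V) : 𝕜 := (-1) ^ (s.filter (fun b => b < a)).card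

lemma sg_ne (a : V) (s : Finset V) : sg 𝕜 a s ≠ 0 := by
  unfold sg; exact pow_ne_zero _ (by simp)

lemma sg_insert {a b : V} {s : Finset V} (ha : a ∉ s) :
    sg 𝕜 b (insert a s) = sg 𝕜 b s * (if a < b then -1 else 1) := by
  unfold sg
  rw [Finset.filter_insert]
  split_ifs with h
  · rw [Finset.card_insert_of_notMem (by simp [ha]), pow_succ]
  · simp

/-- total boundary -/
noncomputable def D (𝕜 : Type) [Field 𝕜] (V : Type) [Fintype V] [LinearOrder V] :
    (Finset V → 𝕜) →ₗ[𝕜] (Finset V → 𝕜) where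
  toFun c := fun s => ∑ a, if a ∈ s then 0 else sg 𝕜 a s * c (insert a s)
  map_add' x y := by
    funext s
    simp only [Pi.add_apply]
    rw [← Finset.sum_add_distrib]
    refine Finset.sum_congr rfl fun a _ => ?_
    split_ifs <;> ring
  map_smul' r x := by
    funext s
    simp only [Pi.smul_apply, smul_eq_mul, RingHom.id_apply]
    rw [Finset.mul_sum]
    refine Finset.sum_congr rfl fun a _ => ?_
    split_ifs <;> ring

lemma D_apply (c : Finset V → 𝕜) (s : Finset V) :
    D 𝕜 V c s = ∑ a, if a ∈ s then 0 else sg 𝕜 a s * c (insert a s) := rfl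

lemma D_D [CharZero 𝕜] (c : Finset V → 𝕜) : D 𝕜 V (D 𝕜 V c) = 0 := by
  funext s
  set f : V → V → 𝕜 := fun a b => if a ∈ s then 0 else if b ∈ insert a s then 0 else
    sg 𝕜 a s * (sg 𝕜 b (insert a s) * c (insert b (insert a s))) with hf
  have h1 : D 𝕜 V (D 𝕜 V c) s = ∑ a, ∑ b, f a b := by
    rw [D_apply]
    refine Finset.sum_congr rfl fun a _ => ?_
    by_cases ha : a ∈ s
    · simp [hf, ha]
    · simp only [hf, ha, if_false, D_apply, Finset.mul_sum]
      refine Finset.sum_congr rfl fun b _ => ?_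
      split_ifs <;> simp
  have h2 : ∀ a b, f a b = - f b a := by
    intro a b
    simp only [hf]
    by_cases hab : a = b
    · subst hab; simp
    by_cases ha : a ∈ s
    · simp [ha]
    by_cases hb : b ∈ s
    · simp [hb]
    have hba : b ≠ a := fun h => hab h.symm
    rw [if_neg ha, if_neg hb, if_neg (by simp [hba, hb]), if_neg (by simp [hab, ha]),
      sg_insert ha, sg_insert hb, Finset.insert_comm]
    rcases lt_or_gt_of_ne hab with h | h
    · rw [if_pos h, if_neg (not_lt.2 h.le)]; ring
    · rw [if_neg (not_lt.2 h.le), if_pos h]; ring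
  have h3 : D 𝕜 V (D 𝕜 V c) s = - D 𝕜 V (D 𝕜 V c) s := by
    conv_lhs => rw [h1, Finset.sum_comm]
    rw [h1, ← Finset.sum_neg_distrib]
    refine Finset.sum_congr rfl fun a _ => ?_
    rw [← Finset.sum_neg_distrib]
    exact Finset.sum_congr rfl fun b _ => h2 b a
  simpa using self_eq_neg.1 h3

/-- chains supported on `X` of cardinality `p` -/
def Cc (𝕜 : Type) [Field 𝕜] (X : Finset (Finset V)) (p : ℕ) : Submodule 𝕜 (Finset V → 𝕜) where
  carrier := {c | ∀ s, c s ≠ 0 → s ∈ X ∧ s.card = p}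
  add_mem' := by
    intro a b ha hb s hs
    by_cases h : a s = 0
    · exact hb s (by simpa [h] using hs)
    · exact ha s h
  zero_mem' := by intro s hs; simp at hs
  smul_mem' := by
    intro r a ha s hs
    exact ha s (by intro h; simp [h] at hs)

lemma mem_Cc {X : Finset (Finset V)} {p : ℕ} {c : Finset V → 𝕜} :
    c ∈ Cc 𝕜 X p ↔ ∀ s, c s ≠ 0 → s ∈ X ∧ s.card = p := Iff.rfl

/-- the chain of a face -/
def e (𝕜 : Type) [Field 𝕜] (s : Finset V) : Finset V → 𝕜 := Pi.single s 1

lemma e_apply (s t : Finset V) : e 𝕜 s t = if t = s then 1 else 0 := by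
  unfold e; rw [Pi.single_apply]

lemma lc_inj {ι : Type} (f : ι → Finset V) (hf : Function.Injective f) :
    Function.Injective (Finsupp.linearCombination 𝕜 (fun i => e 𝕜 (f i))) := by
  have := ((Pi.basisFun 𝕜 (Finset V)).linearIndependent).comp f hf
  have h2 : (⇑(Pi.basisFun 𝕜 (Finset V)) ∘ f) = fun i => e 𝕜 (f i) := by
    funext i; simp [e]
  rw [h2] at this
  exact this

lemma lc_range {ι : Type} (f : ι → Finset V) (X : Finset (Finset V)) (p : ℕ)
    (hX : ∀ s, (s ∈ X ∧ s.card = p) ↔ ∃ i, f i = s) :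
    LinearMap.range (Finsupp.linearCombination 𝕜 (fun i => e 𝕜 (f i))) = Cc 𝕜 X p := by
  rw [Finsupp.range_linearCombination]
  apply le_antisymm
  · rw [Submodule.span_le]
    rintro _ ⟨i, rfl⟩ s hs
    change e 𝕜 (f i) s ≠ 0 at hs
    rw [e_apply] at hs
    by_cases h : s = f i
    · exact (hX s).2 ⟨i, h.symm⟩
    · simp [h] at hs
  · intro c hc
    have : c = ∑ s, c s • e 𝕜 s := by
      funext t
      simp [Finset.sum_apply, e_apply]
    rw [this]
    refine Submodule.sum_mem _ fun s _ => ?_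
    by_cases h : c s = 0
    · simp [h]
    · obtain ⟨i, hi⟩ := (hX s).1 (hc s h)
      exact Submodule.smul_mem _ _ (Submodule.subset_span ⟨i, by simp [hi]⟩)

lemma finrank_Cc (X : Finset (Finset V)) (p : ℕ) :
    finrank 𝕜 (Cc 𝕜 X p) = (X.filter (fun s => s.card = p)).card := by
  rw [← lc_range (fun s : {s // s ∈ X.filter (fun s => s.card = p)} => s.1) X p
    (fun s => by simp), LinearMap.finrank_range_of_inj (lc_inj _ Subtype.val_injective),
    Module.finrank_finsupp_self, Fintype.card_coe]

/-- rank of boundary -/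
noncomputable def rk (𝕜 : Type) [Field 𝕜] (p : ℕ) (X : Finset (Finset V)) : ℕ :=
  finrank 𝕜 ((Cc 𝕜 X p).map (D 𝕜 V))

/-- homology dimension (degree indexed by cardinality) -/
noncomputable def h (𝕜 : Type) [Field 𝕜] (p : ℕ) (X : Finset (Finset V)) : ℤ :=
  (X.filter (fun s => s.card = p)).card - rk 𝕜 p X - rk 𝕜 (p + 1) X

/-- down-closed -/
def DC (X : Finset (Finset V)) : Prop := ∀ s ∈ X, ∀ t ⊆ s, t ∈ X

lemma D_mem {X : Finset (Finset V)} (hX : DC X) {p : ℕ} {c : Finset V → 𝕜}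
    (hc : c ∈ Cc 𝕜 X (p + 1)) : D 𝕜 V c ∈ Cc 𝕜 X p := by
  intro s hs
  rw [D_apply] at hs
  obtain ⟨a, -, ha⟩ := Finset.exists_ne_zero_of_sum_ne_zero hs
  by_cases has : a ∈ s
  · simp [has] at ha
  · rw [if_neg has] at ha
    have := hc _ (right_ne_zero_of_mul ha)
    refine ⟨hX _ this.1 _ (Finset.subset_insert _ _), ?_⟩
    have h2 := this.2
    rw [Finset.card_insert_of_notMem has] at h2
    omega

lemma rk_add_ker (p : ℕ) (X : Finset (Finset V)) :
    rk 𝕜 p X + finrank 𝕜 (LinearMap.ker ((D 𝕜 V).domRestrict (Cc 𝕜 X p)))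
     = (X.filter (fun s => s.card = p)).card := by
  rw [← finrank_Cc (𝕜 := 𝕜), ← LinearMap.finrank_range_add_finrank_ker ((D 𝕜 V).domRestrict (Cc 𝕜 X p)),
    LinearMap.range_domRestrict]
  rfl

lemma h_eq_zero_iff_aux [CharZero 𝕜] {X : Finset (Finset V)} (hX : DC X) (p : ℕ) :
    (Cc 𝕜 X (p+1)).map (D 𝕜 V) ≤ (LinearMap.ker ((D 𝕜 V).domRestrict (Cc 𝕜 X p))).map
      (Cc 𝕜 X p).subtype := by
  rintro _ ⟨c, hc, rfl⟩
  exact ⟨⟨D 𝕜 V c, D_mem hX hc⟩, by simp [D_D], rfl⟩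

lemma finrank_ker_map (p : ℕ) (X : Finset (Finset V)) :
    finrank 𝕜 ((LinearMap.ker ((D 𝕜 V).domRestrict (Cc 𝕜 X p))).map
      (Cc 𝕜 X p).subtype) = finrank 𝕜 (LinearMap.ker ((D 𝕜 V).domRestrict (Cc 𝕜 X p))) :=
  Submodule.finrank_map_subtype_eq _ _

lemma h_nonneg [CharZero 𝕜] {X : Finset (Finset V)} (hX : DC X) (p : ℕ) : 0 ≤ h 𝕜 p X := by
  have h1 := rk_add_ker (𝕜 := 𝕜) p X
  have h2 := Submodule.finrank_mono (h_eq_zero_iff_aux (𝕜 := 𝕜) hX p)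
  rw [finrank_ker_map] at h2
  unfold h
  have : rk 𝕜 (p+1) X = finrank 𝕜 ((Cc 𝕜 X (p+1)).map (D 𝕜 V)) := rfl
  omega

/-- if homology vanishes, every cycle is a boundary -/
lemma exists_of_h_zero [CharZero 𝕜] {X : Finset (Finset V)} (hX : DC X) {p : ℕ}
    (h0 : h 𝕜 p X = 0) {c : Finset V → 𝕜} (hc : c ∈ Cc 𝕜 X p) (hD : D 𝕜 V c = 0) :
    ∃ b ∈ Cc 𝕜 X (p+1), D 𝕜 V b = c := by
  have h1 := rk_add_ker (𝕜 := 𝕜) p X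
  have h2 := h_eq_zero_iff_aux (𝕜 := 𝕜) hX p
  have h3 := finrank_ker_map (𝕜 := 𝕜) p X
  have : rk 𝕜 (p+1) X = finrank 𝕜 ((Cc 𝕜 X (p+1)).map (D 𝕜 V)) := rfl
  unfold h at h0
  have h4 := Submodule.eq_of_le_of_finrank_eq h2 (by omega)
  have : c ∈ (LinearMap.ker ((D 𝕜 V).domRestrict (Cc 𝕜 X p))).map (Cc 𝕜 X p).subtype :=
    ⟨⟨c, hc⟩, by simpa using hD, rfl⟩
  rw [← h4] at this
  exact this

/-- `F` is in the support of a cycle -/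
def Cyc (𝕜 : Type) [Field 𝕜] (X : Finset (Finset V)) (F : Finset V) : Prop :=
  ∃ c ∈ Cc 𝕜 X F.card, D 𝕜 V c = 0 ∧ c F ≠ 0

lemma Cc_congr {X Y : Finset (Finset V)} {p : ℕ} (h : ∀ s, s.card = p → (s ∈ X ↔ s ∈ Y)) :
    Cc 𝕜 X p = Cc 𝕜 Y p := by
  ext c
  simp only [mem_Cc]
  constructor
  · intro hc s hs
    have := hc s hs
    exact ⟨(h s this.2).1 this.1, this.2⟩
  · intro hc s hs
    have := hc s hs
    exact ⟨(h s this.2).2 this.1, this.2⟩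

lemma rk_erase_ne {X : Finset (Finset V)} {F : Finset V} {p : ℕ} (hp : p ≠ F.card) :
    rk 𝕜 p (X.erase F) = rk 𝕜 p X := by
  unfold rk
  rw [Cc_congr (Y := X)]
  intro s hs
  simp only [Finset.mem_erase, and_iff_right_iff_imp]
  rintro - rfl
  exact hp hs.symm

lemma Cc_sup {X : Finset (Finset V)} {F : Finset V} (hF : F ∈ X) :
    Cc 𝕜 X F.card = Cc 𝕜 (X.erase F) F.card ⊔ Submodule.span 𝕜 {e 𝕜 F} := by
  apply le_antisymm
  · intro c hc
    rw [Submodule.mem_sup]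
    refine ⟨c - c F • e 𝕜 F, ?_, c F • e 𝕜 F, Submodule.smul_mem _ _ (Submodule.mem_span_singleton_self _), by simp⟩
    intro s hs
    have hsF : s ≠ F := by
      rintro rfl
      simp [e_apply] at hs
    have := hc s (by simpa [e_apply, hsF] using hs)
    exact ⟨Finset.mem_erase.2 ⟨hsF, this.1⟩, this.2⟩
  · rw [sup_le_iff]
    constructor
    · intro c hc s hs
      exact ⟨Finset.mem_of_mem_erase (hc s hs).1, (hc s hs).2⟩
    · rw [Submodule.span_le]
      rintro _ rfl s hs
      rw [e_apply] at hs
      by_cases hh : s = F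
      · subst hh; exact ⟨hF, rfl⟩
      · simp [hh] at hs

lemma cyc_iff {X : Finset (Finset V)} {F : Finset V} (hF : F ∈ X) :
    Cyc 𝕜 X F ↔ D 𝕜 V (e 𝕜 F) ∈ (Cc 𝕜 (X.erase F) F.card).map (D 𝕜 V) := by
  constructor
  · rintro ⟨c, hc, hD, hcF⟩
    refine ⟨e 𝕜 F - (c F)⁻¹ • c, ?_, by simp [hD]⟩
    intro s hs
    have hsF : s ≠ F := by
      rintro rfl
      simp [e_apply, hcF] at hs
    have := hc s (by intro h0; simp [e_apply, hsF, h0] at hs)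
    exact ⟨Finset.mem_erase.2 ⟨hsF, this.1⟩, this.2⟩
  · rintro ⟨b, hb, hbD⟩
    refine ⟨e 𝕜 F - b, ?_, by simp [hbD], ?_⟩
    · rw [Cc_sup hF]
      exact Submodule.sub_mem _ (Submodule.mem_sup_right (Submodule.mem_span_singleton_self _))
        (Submodule.mem_sup_left hb)
    · have : b F = 0 := by
        by_contra h0
        have := (hb F h0).1
        simp at this
      simp [this, e_apply]

lemma rk_erase_cyc {X : Finset (Finset V)} {F : Finset V} (hF : F ∈ X) (hc : Cyc 𝕜 X F) :
    rk 𝕜 F.card X = rk 𝕜 F.card (X.erase F) := by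
  unfold rk
  rw [Cc_sup hF, Submodule.map_sup, Submodule.map_span, Set.image_singleton, sup_eq_left.2]
  rw [Submodule.span_le]
  rintro _ rfl
  exact (cyc_iff hF).1 hc

lemma rk_erase_not_cyc {X : Finset (Finset V)} {F : Finset V} (hF : F ∈ X) (hc : ¬ Cyc 𝕜 X F) :
    rk 𝕜 F.card X = rk 𝕜 F.card (X.erase F) + 1 := by
  unfold rk
  rw [Cc_sup hF, Submodule.map_sup, Submodule.map_span, Set.image_singleton]
  rw [cyc_iff hF] at hc
  set A := (Cc 𝕜 (X.erase F) F.card).map (D 𝕜 V)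
  have h1 := Submodule.finrank_sup_add_finrank_inf_eq A (Submodule.span 𝕜 {D 𝕜 V (e 𝕜 F)})
  have h0 : D 𝕜 V (e 𝕜 F) ≠ 0 := by
    intro h0; rw [h0] at hc; exact hc (Submodule.zero_mem _)
  rw [finrank_span_singleton h0] at h1
  have h2 : A ⊓ Submodule.span 𝕜 {D 𝕜 V (e 𝕜 F)} = ⊥ := by
    rw [Submodule.eq_bot_iff]
    rintro x ⟨hx1, hx2⟩
    obtain ⟨r, rfl⟩ := Submodule.mem_span_singleton.1 hx2
    by_cases hr : r = 0
    · simp [hr]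
    · exact absurd ((Submodule.smul_mem_iff _ hr).1 hx1) hc
  rw [h2, finrank_bot] at h1
  omega

lemma card_erase {X : Finset (Finset V)} {F : Finset V} (hF : F ∈ X) (p : ℕ) :
    ((X.filter (fun s => s.card = p)).card : ℤ) =
      ((X.erase F).filter (fun s => s.card = p)).card + if p = F.card then 1 else 0 := by
  conv_lhs => rw [← Finset.insert_erase hF, Finset.filter_insert]
  by_cases hp : p = F.card
  · rw [if_pos hp.symm, if_pos hp, Finset.card_insert_of_notMem (by simp)]
    simp
  · rw [if_neg (fun h => hp h.symm), if_neg hp]; simp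

lemma h_erase_cyc {X : Finset (Finset V)} {F : Finset V} (hF : F ∈ X) (hc : Cyc 𝕜 X F) (p : ℕ) :
    h 𝕜 p (X.erase F) = h 𝕜 p X - if p = F.card then 1 else 0 := by
  have key : ∀ q, rk 𝕜 q X = rk 𝕜 q (X.erase F) := by
    intro q
    by_cases hq : q = F.card
    · subst hq; exact rk_erase_cyc hF hc
    · exact (rk_erase_ne hq).symm
  unfold h
  rw [key, key, card_erase hF p]
  ring

lemma h_erase_not_cyc {X : Finset (Finset V)} {F : Finset V} (hF : F ∈ X) (hc : ¬ Cyc 𝕜 X F)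
    (p : ℕ) : h 𝕜 p (X.erase F) = h 𝕜 p X + if p + 1 = F.card then 1 else 0 := by
  have key : ∀ q, rk 𝕜 q X = rk 𝕜 q (X.erase F) + if q = F.card then 1 else 0 := by
    intro q
    by_cases hq : q = F.card
    · subst hq; simpa using rk_erase_not_cyc hF hc
    · simpa [hq] using (rk_erase_ne hq).symm
  unfold h
  rw [key p, key (p+1), card_erase hF p]
  push_cast
  split_ifs <;> ring

/-- elementary collapse -/
lemma h_collapse [CharZero 𝕜] {Y : Finset (Finset V)} {s : Finset V} {a : V} (ha : a ∉ s)
    (hY : DC Y) (ht : insert a s ∈ Y) (hmax : ∀ u ∈ Y, s ⊆ u → u = s ∨ u = insert a s) (p : ℕ) :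
    h 𝕜 p ((Y.erase (insert a s)).erase s) = h 𝕜 p Y := by
  have hne : s ≠ insert a s := fun hh => ha (hh ▸ Finset.mem_insert_self a s)
  have hs : s ∈ Y := hY _ ht _ (Finset.subset_insert _ _)
  have hcard : (insert a s).card = s.card + 1 := Finset.card_insert_of_notMem ha
  have h1 : ¬ Cyc 𝕜 Y (insert a s) := by
    rintro ⟨c, hc, hD, hcF⟩
    have := congrFun hD s
    rw [D_apply, Finset.sum_eq_single a] at this
    · rw [if_neg ha] at this
      exact mul_ne_zero (sg_ne _ _) hcF this
    · intro b _ hb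
      by_cases hbs : b ∈ s
      · simp [hbs]
      · rw [if_neg hbs]
        have : c (insert b s) = 0 := by
          by_contra h0
          rcases hmax _ (hc _ h0).1 (Finset.subset_insert _ _) with h2 | h2
          · exact hbs (h2 ▸ Finset.mem_insert_self b s)
          · have : b ∈ insert a s := h2 ▸ Finset.mem_insert_self b s
            rcases Finset.mem_insert.1 this with h3 | h3
            · exact hb h3
            · exact hbs h3
        simp [this]
    · simp
  have hs' : s ∈ Y.erase (insert a s) := Finset.mem_erase.2 ⟨hne, hs⟩
  have h2 : Cyc 𝕜 (Y.erase (insert a s)) s := by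
    refine ⟨D 𝕜 V (e 𝕜 (insert a s)), ?_, D_D _, ?_⟩
    · have : D 𝕜 V (e 𝕜 (insert a s)) ∈ Cc 𝕜 Y s.card := by
        apply D_mem hY
        intro t ht'
        rw [e_apply] at ht'
        by_cases hh : t = insert a s
        · rw [hh]; exact ⟨ht, hcard⟩
        · simp [hh] at ht'
      intro t ht'
      have h3 := this t ht'
      refine ⟨Finset.mem_erase.2 ⟨?_, h3.1⟩, h3.2⟩
      rintro rfl
      omega
    · rw [D_apply, Finset.sum_eq_single a]
      · rw [if_neg ha]; simp [e_apply, sg_ne]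
      · intro b _ hb
        by_cases hbs : b ∈ s
        · simp [hbs]
        · rw [if_neg hbs, e_apply, if_neg, mul_zero]
          intro h2
          have : b ∈ insert a s := h2 ▸ Finset.mem_insert_self b s
          rcases Finset.mem_insert.1 this with h3 | h3
          · exact hb h3
          · exact hbs h3
      · simp
  rw [h_erase_cyc hs' h2, h_erase_not_cyc ht h1, hcard]
  by_cases hp : p = s.card <;> simp [hp]

/-- matching lemma -/
lemma h_pair [CharZero 𝕜] (a : V) (X : Finset (Finset V)) (hX : DC X) (p : ℕ) :
    ∀ (n : ℕ) (Y : Finset (Finset V)), (Y \ X).card = n → X ⊆ Y → DC Y →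
    (∀ s ∈ Y, s ∉ X → (insert a s ∈ Y ∧ insert a s ∉ X) ∧ (s.erase a ∈ Y ∧ s.erase a ∉ X)) →
    h 𝕜 p Y = h 𝕜 p X := by
  intro n
  induction n using Nat.strong_induction_on with
  | _ n ih =>
  intro Y hn hXY hY htog
  by_cases hemp : (Y \ X) = ∅
  · rw [Finset.Subset.antisymm (Finset.sdiff_eq_empty_iff_subset.1 hemp) hXY]
  obtain ⟨t, ht, htmax⟩ := Finset.exists_max_image (Y \ X) Finset.card
    (Finset.nonempty_iff_ne_empty.2 hemp)
  have htY := (Finset.mem_sdiff.1 ht).1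
  have htX := (Finset.mem_sdiff.1 ht).2
  have hat : a ∈ t := by
    by_contra hat
    have := htmax (insert a t) (Finset.mem_sdiff.2 (htog t htY htX).1)
    rw [Finset.card_insert_of_notMem hat] at this
    omega
  set s := t.erase a with hs
  have has : a ∉ s := by simp [hs]
  have hins : insert a s = t := Finset.insert_erase hat
  have hsX : s ∉ X := (htog t htY htX).2.2
  have hsY : s ∈ Y := (htog t htY htX).2.1
  have hmax : ∀ u ∈ Y, s ⊆ u → u = s ∨ u = t := by
    intro u hu hsu
    have huX : u ∉ X := fun hh => hsX (hX _ hh _ hsu)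
    have h1 := htmax (insert a u) (Finset.mem_sdiff.2 (htog u hu huX).1)
    have h2 : t ⊆ insert a u := by rw [← hins]; exact Finset.insert_subset_insert _ hsu
    have h3 : t = insert a u := Finset.eq_of_subset_of_card_le h2 h1
    by_cases hau : a ∈ u
    · right; rw [h3, Finset.insert_eq_of_mem hau]
    · left; rw [hs, h3, Finset.erase_insert hau]
  have hc := h_collapse (𝕜 := 𝕜) has hY (by rwa [hins]) (by rwa [hins]) p
  rw [hins] at hc
  rw [← hc]
  have hmem : ∀ u, u ∈ (Y.erase t).erase s ↔ u ≠ s ∧ u ≠ t ∧ u ∈ Y := by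
    intro u; simp
  refine ih ((((Y.erase t).erase s) \ X).card) ?_ _ rfl ?_ ?_ ?_
  · rw [← hn]
    apply Finset.card_lt_card
    refine ⟨fun u hu => ?_, fun hsub => ?_⟩
    · rw [Finset.mem_sdiff, hmem] at hu
      exact Finset.mem_sdiff.2 ⟨hu.1.2.2, hu.2⟩
    · have := hsub ht
      rw [Finset.mem_sdiff, hmem] at this
      exact this.1.2.1 rfl
  · intro u hu
    rw [hmem]
    exact ⟨fun hh => hsX (hh ▸ hu), fun hh => htX (hh ▸ hu), hXY hu⟩
  · intro u hu w hw
    rw [hmem] at hu ⊢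
    refine ⟨?_, ?_, hY _ hu.2.2 _ hw⟩
    · rintro rfl
      rcases hmax u hu.2.2 hw with hh | hh
      · exact hu.1 hh
      · exact hu.2.1 hh
    · rintro rfl
      rcases hmax u hu.2.2 ((Finset.erase_subset _ _).trans hw) with hh | hh
      · exact hu.1 hh
      · exact hu.2.1 hh
  · intro u hu huX
    rw [hmem] at hu
    have h1 := htog u hu.2.2 huX
    simp only [hmem]
    refine ⟨⟨⟨?_, ?_, h1.1.1⟩, h1.1.2⟩, ⟨⟨?_, ?_, h1.2.1⟩, h1.2.2⟩⟩
    · intro hh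
      exact has (hh ▸ Finset.mem_insert_self a u)
    · intro hh
      rcases hmax u hu.2.2 (by rw [hs, ← hh]; exact Finset.erase_insert_subset _ _) with h2 | h2
      · exact hu.1 h2
      · exact hu.2.1 h2
    · intro hh
      rcases hmax u hu.2.2 (by rw [← hh]; exact Finset.erase_subset _ _) with h2 | h2
      · exact hu.1 h2
      · exact hu.2.1 h2
    · intro hh
      exact Finset.notMem_erase a u (hh ▸ hat)

lemma h_empty (p : ℕ) : h 𝕜 p (∅ : Finset (Finset V)) = 0 := by
  have : ∀ q, rk 𝕜 q (∅ : Finset (Finset V)) = 0 := by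
    intro q
    have : Cc 𝕜 (∅ : Finset (Finset V)) q = ⊥ := by
      rw [Submodule.eq_bot_iff]
      intro c hc
      funext s
      by_contra h0
      simpa using (hc s h0).1
    unfold rk
    rw [this, Submodule.map_bot, finrank_bot]
  unfold h
  simp [this]

lemma h_cone [CharZero 𝕜] (a : V) (Y : Finset (Finset V)) (hY : DC Y)
    (hc : ∀ s ∈ Y, insert a s ∈ Y) (p : ℕ) : h 𝕜 p Y = 0 := by
  rw [h_pair a ∅ (fun s hs => by simp at hs) p _ Y rfl (by simp) hY, h_empty]
  intro s hs _
  exact ⟨⟨hc s hs, by simp⟩, hY _ hs _ (Finset.erase_subset _ _), by simp⟩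

end lin

section link

variable {V : Type} [Fintype V] [LinearOrder V] {𝕜 : Type} [Field 𝕜]

/-- inclusion of chains -/
noncomputable def io (𝕜 : Type) [Field 𝕜] (K : SimComplex V) (n : ℕ) :
    K.chains 𝕜 n →ₗ[𝕜] (Finset V → 𝕜) :=
  Finsupp.linearCombination 𝕜 (fun s : K.Face n => e 𝕜 s.1)

lemma io_inj (K : SimComplex V) (n : ℕ) : Function.Injective (io 𝕜 K n) :=
  lc_inj (fun s : K.Face n => s.1) Subtype.val_injective

lemma io_single (K : SimComplex V) (n : ℕ) (s : K.Face n) (r : 𝕜) :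
    io 𝕜 K n (Finsupp.single s r) = r • e 𝕜 s.1 := by
  unfold io
  rw [Finsupp.linearCombination_single]

lemma io_range (K : SimComplex V) (n : ℕ) (X : Finset (Finset V))
    (hX : ∀ s, s ∈ X ↔ s = ∅ ∨ s ∈ K.faces) :
    LinearMap.range (io 𝕜 K n) = Cc 𝕜 X (n + 1) := by
  apply lc_range
  intro s
  rw [hX]
  constructor
  · rintro ⟨h1 | h1, h2⟩
    · simp [h1] at h2
    · exact ⟨⟨s, h1, h2⟩, rfl⟩
  · rintro ⟨i, rfl⟩
    exact ⟨Or.inr i.2.1, i.2.2⟩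

lemma D_e (t : Finset V) :
    D 𝕜 V (e 𝕜 t) = ∑ a ∈ t, ((-1 : 𝕜) ^ (t.filter (fun b => b < a)).card) • e 𝕜 (t.erase a) := by
  funext s
  rw [D_apply, Finset.sum_apply]
  rw [← Finset.sum_subset (Finset.subset_univ t)]
  · refine Finset.sum_congr rfl fun a ha => ?_
    rw [Pi.smul_apply, e_apply, e_apply, smul_eq_mul]
    by_cases has : a ∈ s
    · rw [if_pos has, if_neg, mul_zero]
      rintro rfl
      simp at has
    · rw [if_neg has]
      by_cases hst : insert a s = t
      · have : s = t.erase a := by rw [← hst, Finset.erase_insert has]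
        rw [if_pos hst, if_pos this]
        unfold sg
        rw [← hst, Finset.filter_insert, if_neg (lt_irrefl a)]
      · rw [if_neg hst, if_neg]
        · simp
        · rintro rfl
          exact hst (Finset.insert_erase ha)
  · intro a _ ha
    by_cases has : a ∈ s
    · simp [has]
    · rw [if_neg has, e_apply, if_neg, mul_zero]
      rintro rfl
      simp at ha

lemma io_boundary (K : SimComplex V) (n : ℕ) (c : K.chains 𝕜 (n + 1)) :
    io 𝕜 K n (K.boundary 𝕜 n c) = D 𝕜 V (io 𝕜 K (n + 1) c) := by
  have : (io 𝕜 K n).comp (K.boundary 𝕜 n) = (D 𝕜 V).comp (io 𝕜 K (n + 1)) := by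
    apply Finsupp.lhom_ext
    intro s r
    rw [LinearMap.comp_apply, LinearMap.comp_apply, io_single, map_smul, D_e]
    unfold SimComplex.boundary
    rw [Finsupp.lsum_single, LinearMap.toSpanSingleton_apply, map_smul]
    congr 1
    unfold SimComplex.faceBoundary
    rw [map_sum, ← Finset.sum_attach s.1]
    refine Finset.sum_congr rfl fun a _ => ?_
    rw [map_smul]
    congr 1
    exact (io_single K n _ 1).trans (one_smul _ _)
  exact LinearMap.congr_fun this c

lemma io_aug (K : SimComplex V) (c : K.chains 𝕜 0) :
    (K.augmentation 𝕜 c) • e 𝕜 (∅ : Finset V) = D 𝕜 V (io 𝕜 K 0 c) := by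
  have : (LinearMap.toSpanSingleton 𝕜 _ (e 𝕜 (∅ : Finset V))).comp (K.augmentation 𝕜)
      = (D 𝕜 V).comp (io 𝕜 K 0) := by
    apply Finsupp.lhom_ext
    intro s r
    obtain ⟨a, ha⟩ := Finset.card_eq_one.1 s.2.2
    rw [LinearMap.comp_apply, LinearMap.comp_apply, io_single, map_smul, ha, D_e]
    unfold SimComplex.augmentation
    rw [Finsupp.lsum_single, LinearMap.toSpanSingleton_apply]
    simp [Finset.filter_singleton]
  exact LinearMap.congr_fun this c

lemma finrank_range_boundary (K : SimComplex V) (n : ℕ) (X : Finset (Finset V))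
    (hX : ∀ s, s ∈ X ↔ s = ∅ ∨ s ∈ K.faces) :
    finrank 𝕜 (LinearMap.range (K.boundary 𝕜 n)) = rk 𝕜 (n + 2) X := by
  unfold rk
  rw [← io_range K (n + 1) X hX, ← LinearMap.range_comp]
  have : (D 𝕜 V).comp (io 𝕜 K (n + 1)) = (io 𝕜 K n).comp (K.boundary 𝕜 n) :=
    LinearMap.ext fun c => (io_boundary K n c).symm
  rw [this, LinearMap.range_comp]
  exact (LinearEquiv.finrank_eq (Submodule.equivMapOfInjective _ (io_inj K n) _))

lemma finrank_range_aug (K : SimComplex V) (X : Finset (Finset V))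
    (hX : ∀ s, s ∈ X ↔ s = ∅ ∨ s ∈ K.faces) :
    finrank 𝕜 (LinearMap.range (K.augmentation 𝕜)) = rk 𝕜 1 X := by
  unfold rk
  have h1 := io_range (𝕜 := 𝕜) K 0 X hX
  rw [zero_add] at h1
  rw [← h1, ← LinearMap.range_comp]
  have : (D 𝕜 V).comp (io 𝕜 K 0) =
      (LinearMap.toSpanSingleton 𝕜 _ (e 𝕜 (∅ : Finset V))).comp (K.augmentation 𝕜) :=
    LinearMap.ext fun c => (io_aug K c).symm
  rw [this, LinearMap.range_comp]
  have hinj : Function.Injective (LinearMap.toSpanSingleton 𝕜 _ (e 𝕜 (∅ : Finset V))) := by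
    intro x y hxy
    have := congrFun hxy ∅
    simpa [e_apply] using this
  exact (LinearEquiv.finrank_eq (Submodule.equivMapOfInjective _ hinj _))

lemma finite_chains (K : SimComplex V) (n : ℕ) : FiniteDimensional 𝕜 (K.chains 𝕜 n) :=
  FiniteDimensional.of_injective (io 𝕜 K n) (io_inj K n)

lemma finrank_cycles (K : SimComplex V) (n : ℕ) (X : Finset (Finset V))
    (hX : ∀ s, s ∈ X ↔ s = ∅ ∨ s ∈ K.faces) :
    rk 𝕜 (n + 1) X + finrank 𝕜 (K.cycles 𝕜 n) = (X.filter (fun s => s.card = n + 1)).card := by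
  have hfd := finite_chains (𝕜 := 𝕜) K n
  rw [← finrank_Cc (𝕜 := 𝕜), ← io_range K n X hX, LinearMap.finrank_range_of_inj (io_inj K n)]
  cases n with
  | zero =>
    rw [← LinearMap.finrank_range_add_finrank_ker (K.augmentation 𝕜), finrank_range_aug K X hX]
    rfl
  | succ n =>
    rw [← LinearMap.finrank_range_add_finrank_ker (K.boundary 𝕜 n), finrank_range_boundary K n X hX]
    rfl

lemma range_le_cycles [CharZero 𝕜] (K : SimComplex V) (n : ℕ) :
    LinearMap.range (K.boundary 𝕜 n) ≤ K.cycles 𝕜 n := by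
  rintro _ ⟨c, rfl⟩
  cases n with
  | zero =>
    change K.augmentation 𝕜 _ = 0
    have := io_aug K (K.boundary 𝕜 0 c)
    rw [io_boundary, D_D] at this
    simpa [e_apply] using congrFun this ∅
  | succ n =>
    change K.boundary 𝕜 n _ = 0
    apply io_inj K n
    rw [io_boundary, io_boundary, D_D, map_zero]

lemma hdim_eq [CharZero 𝕜] (K : SimComplex V) (X : Finset (Finset V))
    (hX : ∀ s, s ∈ X ↔ s = ∅ ∨ s ∈ K.faces) (p : ℕ) :
    ((K.hdim 𝕜 ((p : ℤ) - 1) : ℕ) : ℤ) = h 𝕜 p X := by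
  have hDC : DC X := by
    intro s hs t hts
    rw [hX] at hs ⊢
    by_cases ht : t = ∅
    · exact Or.inl ht
    right
    have htn := Finset.nonempty_iff_ne_empty.2 ht
    rcases hs with rfl | hs
    · exact absurd (Finset.subset_empty.1 hts) ht
    · exact K.down_closed hs hts htn
  cases p with
  | succ n =>
    have h1 : ((n + 1 : ℕ) : ℤ) - 1 = n := by push_cast; ring
    rw [h1]
    unfold SimComplex.hdim
    rw [if_neg (by omega), if_pos (by omega), Int.toNat_natCast]
    unfold SimComplex.hdimNat
    rw [inf_eq_left.2 (range_le_cycles K n)]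
    have hfd := finite_chains (𝕜 := 𝕜) K n
    have h2 := Submodule.finrank_mono (range_le_cycles (𝕜 := 𝕜) K n)
    have h3 := finrank_cycles (𝕜 := 𝕜) K n X hX
    rw [finrank_range_boundary K n X hX] at h2 ⊢
    unfold h
    rw [← h3]
    push_cast [h2]
    ring
  | zero =>
    have h1 : ((0 : ℕ) : ℤ) - 1 = -1 := by norm_num
    rw [h1]
    unfold SimComplex.hdim
    rw [if_pos rfl]
    have h0 : (∅ : Finset V) ∈ X := (hX ∅).2 (Or.inl rfl)
    split_ifs with hK
    · have hXe : X = {∅} := by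
        ext s; rw [hX, hK]; simp
      have hc : Cyc 𝕜 X ∅ := by
        refine ⟨e 𝕜 ∅, ?_, ?_, by simp [e_apply]⟩
        · intro s hs
          rw [e_apply] at hs
          by_cases hs' : s = ∅
          · subst hs'; exact ⟨h0, rfl⟩
          · simp [hs'] at hs
        · rw [D_e]; simp
      have := h_erase_cyc h0 hc 0
      have h2 : X.erase ∅ = ∅ := by rw [hXe]; simp
      rw [h2, h_empty] at this
      simp at this
      push_cast
      linarith
    · obtain ⟨s, hs⟩ := Set.nonempty_iff_ne_empty.2 hK
      have hsn : s.Nonempty := Finset.nonempty_iff_ne_empty.2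
        (fun hh => K.not_empty_mem (hh ▸ hs))
      obtain ⟨a, ha⟩ := hsn
      have haX : {a} ∈ X := (hX _).2 (Or.inr (K.down_closed hs (by simpa using ha) (by simp)))
      have hnn := h_nonneg (𝕜 := 𝕜) hDC 0
      have hle : 1 ≤ rk 𝕜 1 X := by
        unfold rk
        rw [Nat.one_le_iff_ne_zero, Ne, Submodule.finrank_eq_zero]
        intro hb
        have : D 𝕜 V (e 𝕜 {a}) ∈ (Cc 𝕜 X 1).map (D 𝕜 V) := by
          refine ⟨_, ?_, rfl⟩
          intro s hs
          rw [e_apply] at hs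
          by_cases hs' : s = {a}
          · subst hs'; exact ⟨haX, by simp⟩
          · simp [hs'] at hs
        rw [hb, Submodule.mem_bot, D_e] at this
        have := congrFun this ∅
        simp [e_apply, Finset.filter_singleton] at this
      have hcard : (X.filter (fun s => s.card = 0)).card ≤ 1 := by
        apply Finset.card_le_one.2
        intro x hx y hy
        simp at hx hy
        rw [hx.2, hy.2]
      unfold h at hnn ⊢
      simp only [zero_add] at *
      push_cast
      omega

end link

section comb

variable {V : Type} [Fintype V] [LinearOrder V] {𝕜 : Type} [Field 𝕜]

/-- restriction -/
def rs (X : Finset (Finset V)) (J : Finset V) : Finset (Finset V) := X.filter (fun s => s ⊆ J)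

lemma mem_rs {X : Finset (Finset V)} {J s : Finset V} : s ∈ rs X J ↔ s ∈ X ∧ s ⊆ J := by
  simp [rs]

lemma DC_rs {X : Finset (Finset V)} (hX : DC X) (J : Finset V) : DC (rs X J) := by
  intro s hs t ht
  rw [mem_rs] at *
  exact ⟨hX _ hs.1 _ ht, ht.trans hs.2⟩

lemma h_single (p : ℕ) : h 𝕜 p ({∅} : Finset (Finset V)) = if p = 0 then 1 else 0 := by
  have h0 : (∅ : Finset V) ∈ ({∅} : Finset (Finset V)) := by simp
  have hc : Cyc 𝕜 ({∅} : Finset (Finset V)) ∅ := by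
    refine ⟨e 𝕜 ∅, ?_, ?_, by simp [e_apply]⟩
    · intro s hs
      rw [e_apply] at hs
      by_cases hs' : s = ∅
      · subst hs'; exact ⟨h0, rfl⟩
      · simp [hs'] at hs
    · rw [D_e]; simp
  have := h_erase_cyc h0 hc p
  have h2 : ({∅} : Finset (Finset V)).erase ∅ = ∅ := by simp
  rw [h2, h_empty] at this
  rw [Finset.card_empty] at this
  by_cases hp : p = 0
  · rw [if_pos hp] at this ⊢; linarith
  · rw [if_neg hp] at this ⊢; linarith

/-- truncated complex -/
def st (X : Finset (Finset V)) (F : Finset V) (v : V) : Finset (Finset V) :=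
  X.erase F ∪ F.ssubsets.image (insert v)

lemma mem_st {X : Finset (Finset V)} {F : Finset V} {v : V} {s : Finset V} :
    s ∈ st X F v ↔ (s ≠ F ∧ s ∈ X) ∨ ∃ u, u ⊂ F ∧ insert v u = s := by
  simp [st]

lemma D_apply_single {c : Finset V → 𝕜} {s : Finset V} {a : V} (ha : a ∉ s)
    (hb : ∀ b, b ∉ s → b ≠ a → c (insert b s) = 0) : D 𝕜 V c s = sg 𝕜 a s * c (insert a s) := by
  rw [D_apply, Finset.sum_eq_single a]
  · rw [if_neg ha]
  · intro b _ hba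
    by_cases hbs : b ∈ s
    · simp [hbs]
    · rw [if_neg hbs, hb b hbs hba, mul_zero]
  · simp

lemma D_ne {c : Finset V → 𝕜} {s : Finset V} (hs : D 𝕜 V c s ≠ 0) :
    ∃ a, a ∉ s ∧ c (insert a s) ≠ 0 := by
  rw [D_apply] at hs
  obtain ⟨a, -, ha⟩ := Finset.exists_ne_zero_of_sum_ne_zero hs
  by_cases has : a ∈ s
  · simp [has] at ha
  · rw [if_neg has] at ha
    exact ⟨a, has, right_ne_zero_of_mul ha⟩

lemma De_ne_iff {t s : Finset V} : D 𝕜 V (e 𝕜 t) s ≠ 0 ↔ ∃ a, a ∉ s ∧ insert a s = t := by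
  constructor
  · intro hs
    obtain ⟨a, ha, hh⟩ := D_ne hs
    refine ⟨a, ha, ?_⟩
    by_contra h0
    simp [e_apply, h0] at hh
  · rintro ⟨a, ha, rfl⟩
    rw [D_apply_single ha]
    · simp [e_apply, sg_ne]
    · intro b hb hba
      rw [e_apply, if_neg]
      intro h2
      have : b ∈ insert a s := h2 ▸ Finset.mem_insert_self b s
      rcases Finset.mem_insert.1 this with h3 | h3
      · exact hba h3
      · exact hb h3

lemma e_mem {X : Finset (Finset V)} {t : Finset V} (ht : t ∈ X) : e 𝕜 t ∈ Cc 𝕜 X t.card := by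
  intro s hs
  rw [e_apply] at hs
  by_cases hh : s = t
  · subst hh; exact ⟨ht, rfl⟩
  · simp [hh] at hs

section step
variable {X : Finset (Finset V)} {M F : Finset V} {v : V}

lemma rs_st_not (hv : v ∉ M) {J : Finset V} (hJ : J ⊆ M) (hFJ : ¬ F ⊆ J) :
    rs (st X F v) J = rs X J := by
  ext s
  rw [mem_rs, mem_rs, mem_st]
  constructor
  · rintro ⟨⟨h1, h2⟩ | ⟨u, hu, rfl⟩, h3⟩
    · exact ⟨h2, h3⟩
    · exact absurd (hJ (h3 (Finset.mem_insert_self v u))) hv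
  · rintro ⟨h1, h2⟩
    exact ⟨Or.inl ⟨fun hh => hFJ (hh ▸ h2), h1⟩, h2⟩

lemma rs_st_sub (hv : v ∉ M) {J : Finset V} (hJ : J ⊆ M) :
    rs (st X F v) J = (rs X J).erase F := by
  ext s
  rw [Finset.mem_erase, mem_rs, mem_rs, mem_st]
  constructor
  · rintro ⟨⟨h1, h2⟩ | ⟨u, hu, rfl⟩, h3⟩
    · exact ⟨h1, h2, h3⟩
    · exact absurd (hJ (h3 (Finset.mem_insert_self v u))) hv
  · rintro ⟨h0, h1, h2⟩
    exact ⟨Or.inl ⟨h0, h1⟩, h2⟩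

lemma DC_st (hX : DC X) (hF : F ∈ X) (hmax : ∀ s ∈ X, F ⊆ s → s = F) :
    DC (st X F v) := by
  intro s hs t ht
  rw [mem_st] at hs ⊢
  rcases hs with ⟨h1, h2⟩ | ⟨u, hu, rfl⟩
  · left
    refine ⟨?_, hX _ h2 _ ht⟩
    rintro rfl
    exact h1 (hmax s h2 ht)
  · by_cases hvt : v ∈ t
    · right
      refine ⟨t.erase v, ?_, Finset.insert_erase hvt⟩
      refine lt_of_le_of_lt ?_ hu
      intro x hx
      have h3 := ht (Finset.mem_of_mem_erase hx)
      exact (Finset.mem_insert.1 h3).resolve_left (Finset.ne_of_mem_erase hx)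
    · left
      have htu : t ⊆ u := (Finset.subset_insert_iff_of_notMem hvt).1 ht
      refine ⟨?_, hX _ hF _ (htu.trans hu.1)⟩
      rintro rfl
      exact (lt_of_lt_of_le hu htu).ne rfl

lemma h_st_disj [CharZero 𝕜] (h0 : ∅ ∈ X) (hM : ∀ s ∈ X, s ⊆ M)
    (hvert : ∀ a ∈ M, {a} ∈ X) (hv : v ∉ M) (hF : F ∈ X) (hFne : F.Nonempty)
    {J : Finset V} (hJ : J ⊆ M) (hd : Disjoint J F) (p : ℕ) :
    h 𝕜 p (rs (st X F v) (insert v J)) = h 𝕜 p (rs X J) +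
      ((if J ≠ ∅ ∧ p = 1 then 1 else 0) - (if J = ∅ ∧ p = 0 then 1 else 0)) := by
  set Y := rs (st X F v) (insert v J) with hY
  have hmem : ∀ s, s ∈ Y ↔ s = {v} ∨ s ∈ rs X J := by
    intro s
    rw [hY, mem_rs, mem_rs, mem_st]
    constructor
    · rintro ⟨⟨h1, h2⟩ | ⟨u, hu, rfl⟩, h3⟩
      · right
        exact ⟨h2, (Finset.subset_insert_iff_of_notMem (fun hh => hv (hM _ h2 hh))).1 h3⟩
      · left
        have : u = ∅ := by
          rw [Finset.eq_empty_iff_forall_notMem]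
          intro x hx
          have hxF := hu.1 hx
          rcases Finset.mem_insert.1 (h3 (Finset.mem_insert_of_mem hx)) with hh | hh
          · exact hv (hh ▸ hM _ hF hxF)
          · exact Finset.disjoint_left.1 hd hh hxF
        rw [this]; rfl
    · rintro (rfl | ⟨h1, h2⟩)
      · refine ⟨Or.inr ⟨∅, Finset.empty_ssubset.2 hFne, rfl⟩, by simp⟩
      · refine ⟨Or.inl ⟨?_, h1⟩, h2.trans (Finset.subset_insert _ _)⟩
        rintro rfl
        obtain ⟨x, hx⟩ := hFne
        exact Finset.disjoint_left.1 hd (h2 hx) hx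
  have hvY : {v} ∈ Y := (hmem _).2 (Or.inl rfl)
  have hvX : {v} ∉ rs X J := fun hh => hv (hJ ((mem_rs.1 hh).2 (by simp)))
  have hYe : Y.erase {v} = rs X J := by
    ext s
    rw [Finset.mem_erase, hmem]
    constructor
    · rintro ⟨h1, h2⟩; exact h2.resolve_left h1
    · intro h1; exact ⟨fun hh => hvX (hh ▸ h1), Or.inr h1⟩
  by_cases hJe : J = ∅
  · subst hJe
    have hrs : rs X ∅ = {∅} := by
      ext s
      rw [mem_rs, Finset.subset_empty, Finset.mem_singleton]
      exact ⟨fun hh => hh.2, fun hh => ⟨hh ▸ h0, hh⟩⟩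
    have hmem2 : ∀ s, s ∈ Y ↔ s = {v} ∨ s = ∅ := by
      intro s; rw [hmem, hrs, Finset.mem_singleton]
    have hYDC : DC Y := by
      intro s hs t ht
      rw [hmem2] at hs ⊢
      rcases hs with rfl | rfl
      · exact (Finset.subset_singleton_iff.1 ht).symm
      · exact Or.inr (Finset.subset_empty.1 ht)
    rw [h_cone v Y hYDC, hrs, h_single]
    · simp
    · intro s hs
      rw [hmem2] at hs ⊢
      rcases hs with rfl | rfl <;> simp
  · obtain ⟨a, ha⟩ := Finset.nonempty_iff_ne_empty.2 hJe
    have hav : a ≠ v := fun hh => hv (hh ▸ hJ ha)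
    have haY : {a} ∈ Y := (hmem _).2 (Or.inr (mem_rs.2 ⟨hvert a (hJ ha), by simpa using ha⟩))
    have hc : Cyc 𝕜 Y {v} := by
      refine ⟨e 𝕜 {v} - e 𝕜 {a}, ?_, ?_, ?_⟩
      · exact Submodule.sub_mem _ (e_mem hvY) (by simpa using e_mem (𝕜 := 𝕜) haY)
      · rw [map_sub, D_e, D_e]
        simp [Finset.filter_singleton]
      · simp [e_apply, hav.symm]
    have := h_erase_cyc hvY hc p
    rw [hYe] at this
    rw [this]
    simp [hJe]

lemma h_st_meet [CharZero 𝕜] (hX : DC X) (hM : ∀ s ∈ X, s ⊆ M)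
    (hv : v ∉ M) (hF : F ∈ X) (hmax : ∀ s ∈ X, F ⊆ s → s = F)
    {J : Finset V} (hJ : J ⊆ M) (hd : ¬ Disjoint J F) (p : ℕ) :
    h 𝕜 p (rs (st X F v) (insert v J)) = h 𝕜 p (rs X J) := by
  obtain ⟨a, haJ, haF⟩ := Finset.not_disjoint_iff.1 hd
  have hav : a ≠ v := fun hh => hv (hh ▸ hJ haJ)
  have hvF : v ∉ F := fun hh => hv (hM _ hF hh)
  set Z := rs X J ∪ (F ∩ J).powerset.image (insert v) with hZ
  have hmem : ∀ s, s ∈ Z ↔ s ∈ rs X J ∨ ∃ u, u ⊆ F ∧ u ⊆ J ∧ insert v u = s := by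
    intro s
    simp only [hZ, Finset.mem_union, Finset.mem_image, Finset.mem_powerset,
      Finset.subset_inter_iff, and_assoc]
  have hvX : ∀ s ∈ rs X J, v ∉ s := fun s hs hh => hv (hJ ((mem_rs.1 hs).2 hh))
  have hZDC : DC Z := by
    intro s hs t ht
    rw [hmem] at hs ⊢
    rcases hs with hs | ⟨u, hu1, hu2, rfl⟩
    · exact Or.inl (DC_rs hX J _ hs _ ht)
    · by_cases hvt : v ∈ t
      · right
        have : t.erase v ⊆ u := by
          intro x hx
          have h3 := ht (Finset.mem_of_mem_erase hx)
          exact (Finset.mem_insert.1 h3).resolve_left (Finset.ne_of_mem_erase hx)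
        exact ⟨t.erase v, this.trans hu1, this.trans hu2, Finset.insert_erase hvt⟩
      · left
        have htu : t ⊆ u := (Finset.subset_insert_iff_of_notMem hvt).1 ht
        exact mem_rs.2 ⟨hX _ hF _ (htu.trans hu1), htu.trans hu2⟩
  have h1 : h 𝕜 p Z = h 𝕜 p (rs X J) := by
    refine h_pair a (rs X J) (DC_rs hX J) p _ Z rfl (fun s hs => (hmem s).2 (Or.inl hs)) hZDC ?_
    intro s hs hsX
    rw [hmem] at hs
    rcases hs with hs | ⟨u, hu1, hu2, rfl⟩
    · exact absurd hs hsX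
    refine ⟨⟨(hmem _).2 (Or.inr ⟨insert a u, ?_, ?_, Finset.insert_comm _ _ _⟩), ?_⟩,
      (hmem _).2 (Or.inr ⟨u.erase a, ?_, ?_, ?_⟩), ?_⟩
    · exact Finset.insert_subset haF hu1
    · exact Finset.insert_subset haJ hu2
    · intro hh; exact hvX _ hh (by simp)
    · exact (Finset.erase_subset _ _).trans hu1
    · exact (Finset.erase_subset _ _).trans hu2
    · rw [Finset.erase_insert_of_ne hav.symm]
    · intro hh; exact hvX _ hh (by simp [hav.symm])
  rw [← h1]
  have hmemY : ∀ s, s ∈ rs (st X F v) (insert v J) ↔ s ≠ F ∧ s ≠ insert v F ∧ s ∈ Z := by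
    intro s
    rw [mem_rs, mem_st, hmem, mem_rs]
    constructor
    · rintro ⟨⟨h1, h2⟩ | ⟨u, hu, rfl⟩, h3⟩
      · refine ⟨h1, ?_, Or.inl ⟨h2, (Finset.subset_insert_iff_of_notMem (fun hh => hv (hM _ h2 hh))).1 h3⟩⟩
        rintro rfl
        exact hv (hM _ h2 (by simp))
      · have hvu : v ∉ u := fun hh => hvF (hu.1 hh)
        refine ⟨?_, ?_, Or.inr ⟨u, hu.1, ?_, rfl⟩⟩
        · rintro rfl
          exact hvF (by simp)
        · intro hh
          have : u = F := by
            rw [← Finset.erase_insert hvu, hh, Finset.erase_insert hvF]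
          exact hu.ne this
        · exact (Finset.insert_subset_insert_iff hvu).1 h3
    · rintro ⟨h1, h2, ⟨h3, h4⟩ | ⟨u, hu1, hu2, rfl⟩⟩
      · exact ⟨Or.inl ⟨h1, h3⟩, h4.trans (Finset.subset_insert _ _)⟩
      · exact ⟨Or.inr ⟨u, lt_of_le_of_ne hu1 (fun hh => h2 (by rw [hh])), rfl⟩,
          Finset.insert_subset_insert _ hu2⟩
  by_cases hFJ : F ⊆ J
  · have hc := h_collapse (𝕜 := 𝕜) hvF hZDC ((hmem _).2 (Or.inr ⟨F, Finset.Subset.refl _, hFJ, rfl⟩))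
      (fun u hu hFu => ?_) p
    · rw [← hc]
      congr 1
      ext s
      rw [hmemY, Finset.mem_erase, Finset.mem_erase]
    · rw [hmem] at hu
      rcases hu with hu | ⟨w, hw1, hw2, rfl⟩
      · exact Or.inl (hmax u (mem_rs.1 hu).1 hFu)
      · right
        have : F ⊆ w := (Finset.subset_insert_iff_of_notMem hvF).1 hFu
        rw [Finset.Subset.antisymm hw1 this]
  · congr 1
    ext s
    rw [hmemY]
    refine ⟨fun hh => hh.2.2, fun hh => ⟨?_, ?_, hh⟩⟩
    · rintro rfl
      rw [hmem] at hh
      rcases hh with hh | ⟨w, hw1, hw2, hw3⟩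
      · exact hFJ (mem_rs.1 hh).2
      · exact hvF (hw3 ▸ Finset.mem_insert_self v w)
    · rintro rfl
      rw [hmem] at hh
      rcases hh with hh | ⟨w, hw1, hw2, hw3⟩
      · exact hvX _ hh (by simp)
      · have : w = F := by
          rw [← Finset.erase_insert (fun hh => hvF (hw1 hh)), hw3, Finset.erase_insert hvF]
        exact hFJ (this ▸ hw2)

end step
end comb

section main

variable {V : Type} [Fintype V] [LinearOrder V] {𝕜 : Type} [Field 𝕜]

/-- binomial with integer lower index -/
def chZ (n : ℕ) (i : ℤ) : ℤ := if 0 ≤ i then (n.choose i.toNat : ℤ) else 0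

/-- linear strand coefficients -/
def cc : ℕ → ℤ → ℤ
  | 0, _ => 0
  | (k + 1), i => cc k i + cc k (i - 1) + if 1 ≤ i then chZ (k + 2) i else 0

/-- the closed formula -/
def Fm (n₁ n₂ k p j : ℕ) : ℤ :=
  (if p = 0 ∧ j = 0 then 1 else 0) + (if p = n₁ + n₂ ∧ j = n₁ + n₂ + k + 2 then 1 else 0)
  + (if p = n₁ then chZ k ((j : ℤ) - p - 1) else 0)
  + (if p = n₂ then chZ k ((j : ℤ) - p - 1) else 0)
  + (if p = 1 then cc k ((j : ℤ) - 1) else 0)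
  + (if p + 1 = n₁ + n₂ then cc k ((n₁ + n₂ + k + 2 : ℤ) - 1 - j) else 0)

lemma chZ_succ (k : ℕ) (i : ℤ) : chZ (k + 1) i = chZ k i + chZ k (i - 1) := by
  unfold chZ
  rcases lt_trichotomy i 0 with h | h | h
  · rw [if_neg (by omega), if_neg (by omega), if_neg (by omega)]; rfl
  · subst h; simp
  · obtain ⟨n, rfl⟩ : ∃ n : ℕ, i = n + 1 := ⟨(i - 1).toNat, by omega⟩
    rw [if_pos (by omega), if_pos (by omega), if_pos (by omega)]
    have h1 : ((n : ℤ) + 1).toNat = n + 1 := by omega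
    have h2 : ((n : ℤ) + 1 - 1).toNat = n := by omega
    rw [h1, h2, Nat.choose_succ_succ]
    push_cast; ring

lemma chZ_neg {k : ℕ} {i : ℤ} (h : i < 0) : chZ k i = 0 := by
  unfold chZ; rw [if_neg (by omega)]

lemma chZ_big {k : ℕ} {i : ℤ} (h : (k : ℤ) < i) : chZ k i = 0 := by
  unfold chZ; rw [if_pos (by omega), Nat.choose_eq_zero_of_lt (by omega)]; rfl

lemma chZ_nat {k : ℕ} (i : ℕ) : chZ k i = k.choose i := by simp [chZ]

lemma cc_neg (k : ℕ) : ∀ i : ℤ, i ≤ 0 → cc k i = 0 := by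
  induction k with
  | zero => intro i _; rfl
  | succ k ih =>
    intro i hi
    rw [cc, ih i hi, ih (i - 1) (by omega), if_neg (by omega)]; rfl

lemma cc_big (k : ℕ) : ∀ i : ℤ, (k : ℤ) + 2 ≤ i → cc k i = 0 := by
  induction k with
  | zero => intro i _; rfl
  | succ k ih =>
    intro i hi
    push_cast at hi
    rw [cc, ih i (by omega), ih (i - 1) (by omega), chZ_big (by push_cast; omega)]; simp

lemma cc_closed (k : ℕ) : ∀ i : ℕ,
    cc k (i + 1) = (i + 1) * (k + 2).choose (i + 2) - k.choose i := by
  induction k with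
  | zero =>
    intro i
    rcases i with _ | i
    · simp [cc]
    · rw [Nat.choose_eq_zero_of_lt (by omega), Nat.choose_eq_zero_of_lt (by omega)]; simp [cc]
  | succ k ih =>
    intro i
    have h0 : chZ (k + 2) ((i : ℤ) + 1) = (k + 2).choose (i + 1) := by
      have := chZ_nat (k := k + 2) (i + 1); push_cast at this; exact this
    rw [cc, if_pos (by omega), h0, ih i]
    rcases i with _ | i
    · rw [cc_neg _ _ (by simp)]
      have : (k + 1 + 2).choose (0 + 2) = (k + 2).choose 1 + (k + 2).choose 2 :=
        Nat.choose_succ_succ _ _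
      rw [this]; push_cast; simp; ring
    · have h3 : (((i + 1 : ℕ) : ℤ) + 1 - 1) = (i : ℤ) + 1 := by push_cast; ring
      rw [h3, ih i]
      have e1 : (k + 1 + 2).choose (i + 1 + 2) = (k + 2).choose (i + 2) + (k + 2).choose (i + 1 + 2) :=
        Nat.choose_succ_succ _ _
      have e2 : (k + 1).choose (i + 1) = k.choose i + k.choose (i + 1) :=
        Nat.choose_succ_succ _ _
      rw [e1, e2]
      push_cast
      ring

lemma Fm_zero {n₁ n₂ k p : ℕ} (h1 : 2 ≤ n₁) (h2 : 2 ≤ n₂) :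
    Fm n₁ n₂ k p 0 = if p = 0 then 1 else 0 := by
  unfold Fm
  rw [chZ_neg (by push_cast; omega), cc_neg _ _ (by simp), cc_big _ _ (by push_cast; omega)]
  simp

lemma Fm_step (n₁ n₂ k p j : ℕ) :
    Fm n₁ n₂ (k + 1) p (j + 1) = Fm n₁ n₂ k p (j + 1) + Fm n₁ n₂ k p j
     + ((if p + 1 = n₁ + n₂ ∧ 1 ≤ ((n₁ + n₂ + k + 2 : ℤ) - (j + 1 : ℕ)) then
          chZ (k + 2) ((n₁ + n₂ + k + 2 : ℤ) - (j + 1 : ℕ)) else 0)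
        - (if p = n₁ + n₂ ∧ j + 1 = n₁ + n₂ + k + 2 then 1 else 0))
     + ((if p = 1 ∧ 1 ≤ j then chZ (k + 2) j else 0) - (if p = 0 ∧ j = 0 then 1 else 0)) := by
  have e1 : (if p = n₁ then chZ (k + 1) (((j + 1 : ℕ) : ℤ) - p - 1) else 0) =
      (if p = n₁ then chZ k (((j + 1 : ℕ) : ℤ) - p - 1) else 0) +
      (if p = n₁ then chZ k ((j : ℤ) - p - 1) else 0) := by
    split_ifs
    · rw [chZ_succ]; congr 2; push_cast; ring
    · simp
  have e2 : (if p = n₂ then chZ (k + 1) (((j + 1 : ℕ) : ℤ) - p - 1) else 0) =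
      (if p = n₂ then chZ k (((j + 1 : ℕ) : ℤ) - p - 1) else 0) +
      (if p = n₂ then chZ k ((j : ℤ) - p - 1) else 0) := by
    split_ifs
    · rw [chZ_succ]; congr 2; push_cast; ring
    · simp
  have e3 : (if p = 1 then cc (k + 1) (((j + 1 : ℕ) : ℤ) - 1) else 0) =
      (if p = 1 then cc k (((j + 1 : ℕ) : ℤ) - 1) else 0) +
      (if p = 1 then cc k ((j : ℤ) - 1) else 0) +
      (if p = 1 ∧ 1 ≤ j then chZ (k + 2) j else 0) := by
    by_cases hp : p = 1
    · have : ((j + 1 : ℕ) : ℤ) - 1 = j := by push_cast; ring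
      rw [this]
      simp [hp, cc]
    · simp [hp]
  have e4 : (if p + 1 = n₁ + n₂ then cc (k + 1) ((n₁ + n₂ + (k + 1 : ℕ) + 2 : ℤ) - 1 - (j + 1 : ℕ)) else 0) =
      (if p + 1 = n₁ + n₂ then cc k ((n₁ + n₂ + k + 2 : ℤ) - 1 - (j + 1 : ℕ)) else 0) +
      (if p + 1 = n₁ + n₂ then cc k ((n₁ + n₂ + k + 2 : ℤ) - 1 - j) else 0) +
      (if p + 1 = n₁ + n₂ ∧ 1 ≤ ((n₁ + n₂ + k + 2 : ℤ) - (j + 1 : ℕ)) then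
          chZ (k + 2) ((n₁ + n₂ + k + 2 : ℤ) - (j + 1 : ℕ)) else 0) := by
    by_cases hp : p + 1 = n₁ + n₂
    · have h1 : (n₁ + n₂ + (k + 1 : ℕ) + 2 : ℤ) - 1 - (j + 1 : ℕ)
        = (n₁ + n₂ + k + 2 : ℤ) - (j + 1 : ℕ) := by push_cast; ring
      have h2 : (n₁ + n₂ + k + 2 : ℤ) - 1 - (j + 1 : ℕ)
        = (n₁ + n₂ + k + 2 : ℤ) - (j + 1 : ℕ) - 1 := by ring
      have h3 : (n₁ + n₂ + k + 2 : ℤ) - 1 - j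
        = (n₁ + n₂ + k + 2 : ℤ) - (j + 1 : ℕ) := by push_cast; ring
      rw [h1, h2, h3]
      simp only [hp, true_and, if_true, cc]
      ring
    · simp [hp]
  unfold Fm
  rw [e1, e2, e3, e4]
  have e5 : (if p = n₁ + n₂ ∧ j + 1 = n₁ + n₂ + (k + 1) + 2 then (1 : ℤ) else 0) =
    if p = n₁ + n₂ ∧ j = n₁ + n₂ + k + 2 then 1 else 0 := by
    congr 1; apply propext; omega
  rw [e5]
  have e6 : (if p = 0 ∧ j + 1 = 0 then (1 : ℤ) else 0) = 0 := by simp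
  rw [e6]
  ring

/-- inductive invariant -/
structure Inv (𝕜 : Type) [Field 𝕜] (n₁ n₂ k : ℕ) (M : Finset V) (X : Finset (Finset V)) : Prop where
  dc : DC X
  emp : ∅ ∈ X
  sub : ∀ s ∈ X, s ⊆ M
  vert : ∀ a ∈ M, {a} ∈ X
  cardM : M.card = n₁ + n₂ + k + 2
  pure : ∀ s ∈ X, ∃ t ∈ X, s ⊆ t ∧ t.card = n₁ + n₂
  cyc : ∃ z ∈ Cc 𝕜 X (n₁ + n₂), D 𝕜 V z = 0 ∧ ∀ s ∈ X, s.card = n₁ + n₂ → z s ≠ 0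
  bet : ∀ p j, ∑ J ∈ Finset.powersetCard j M, h 𝕜 p (rs X J) = Fm n₁ n₂ k p j

lemma cnt_disj {M F : Finset V} (hF : F ⊆ M) (j : ℕ) :
    ((Finset.powersetCard j M).filter (fun J => Disjoint J F)).card = (M.card - F.card).choose j := by
  rw [← Finset.card_sdiff_of_subset hF, ← Finset.card_powersetCard]
  congr 1
  ext J
  simp only [Finset.mem_filter, Finset.mem_powersetCard, Finset.subset_sdiff]
  tauto

lemma cnt_sub {M F : Finset V} (hF : F ⊆ M) (j : ℕ) :
    (((Finset.powersetCard j M).filter (fun J => F ⊆ J)).card : ℤ) =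
      chZ (M.card - F.card) ((M.card : ℤ) - j) := by
  unfold chZ
  split_ifs with hj
  · have : ((M.card : ℤ) - j).toNat = M.card - j := by omega
    rw [this, ← Finset.card_sdiff_of_subset hF, ← Finset.card_powersetCard]
    congr 1
    refine Finset.card_bij' (fun J _ => M \ J) (fun J _ => M \ J) ?_ ?_ ?_ ?_
    · intro J hJ
      simp only [Finset.mem_filter, Finset.mem_powersetCard] at hJ ⊢
      refine ⟨Finset.sdiff_subset_sdiff (Finset.Subset.refl _) hJ.2, ?_⟩
      rw [Finset.card_sdiff_of_subset hJ.1.1, hJ.1.2]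
    · intro J hJ
      simp only [Finset.mem_filter, Finset.mem_powersetCard] at hJ ⊢
      have hJM : J ⊆ M := hJ.1.trans Finset.sdiff_subset
      refine ⟨⟨Finset.sdiff_subset, ?_⟩, ?_⟩
      · rw [Finset.card_sdiff_of_subset hJM, hJ.2]; omega
      · rw [Finset.subset_sdiff]
        exact ⟨hF, (Finset.subset_sdiff.1 hJ.1).2.symm⟩
    · intro J hJ
      simp only [Finset.mem_filter, Finset.mem_powersetCard] at hJ
      exact Finset.sdiff_sdiff_eq_self hJ.1.1
    · intro J hJ
      simp only [Finset.mem_powersetCard] at hJ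
      exact Finset.sdiff_sdiff_eq_self (hJ.1.trans Finset.sdiff_subset)
  · rw [Finset.powersetCard_eq_empty.2 (by omega)]; simp

lemma Fm_top {n₁ n₂ k j : ℕ} (h1 : 2 ≤ n₁) (h2 : 2 ≤ n₂) (hj : j ≠ n₁ + n₂ + k + 2) :
    Fm n₁ n₂ k (n₁ + n₂) j = 0 := by
  unfold Fm
  rw [if_neg (by omega), if_neg (by omega), if_neg (by omega), if_neg (by omega), if_neg (by omega),
    if_neg (by omega)]
  simp

lemma h_st_in [CharZero 𝕜] {n₁ n₂ k : ℕ} (h1 : 2 ≤ n₁) (h2 : 2 ≤ n₂) {M F : Finset V}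
    {X : Finset (Finset V)} {v : V} (I : Inv 𝕜 n₁ n₂ k M X) (hv : v ∉ M) (hF : F ∈ X)
    (hmax : ∀ s ∈ X, F ⊆ s → s = F) (hFc : F.card = n₁ + n₂) {J : Finset V} (hJ : J ⊆ M) (p : ℕ) :
    h 𝕜 p (rs (st X F v) J) = h 𝕜 p (rs X J) + if F ⊆ J then
      ((if p + 1 = n₁ + n₂ ∧ J.card ≠ M.card then 1 else 0)
        - (if p = n₁ + n₂ ∧ J.card = M.card then 1 else 0)) else 0 := by
  by_cases hFJ : F ⊆ J
  · rw [rs_st_sub hv hJ, if_pos hFJ]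
    have hFr : F ∈ rs X J := mem_rs.2 ⟨hF, hFJ⟩
    by_cases hJM : J.card = M.card
    · have hJM' : J = M := Finset.eq_of_subset_of_card_le hJ hJM.ge
      have : rs X J = X := by
        ext s; rw [mem_rs, hJM']; exact ⟨fun hh => hh.1, fun hh => ⟨hh, I.sub s hh⟩⟩
      obtain ⟨z, hz, hzD, hzn⟩ := I.cyc
      rw [h_erase_cyc hFr]
      · simp [hJM, hFc, sub_eq_add_neg]
      · rw [this]
        exact ⟨z, hFc ▸ hz, hzD, hzn F hF hFc⟩
    · rw [h_erase_not_cyc hFr]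
      · simp [hJM, hFc]
      · rintro ⟨c, hc, hD, hcF⟩
        rw [hFc] at hc
        have hs := I.bet (n₁ + n₂) J.card
        rw [Fm_top h1 h2 (I.cardM ▸ hJM)] at hs
        have hz := (Finset.sum_eq_zero_iff_of_nonneg
          (fun J' _ => h_nonneg (DC_rs I.dc J') (n₁ + n₂))).1 hs J
          (Finset.mem_powersetCard.2 ⟨hJ, rfl⟩)
        obtain ⟨b, hb, hbc⟩ := exists_of_h_zero (DC_rs I.dc J) hz hc hD
        rw [← hbc] at hcF
        obtain ⟨a, ha, hab⟩ := D_ne hcF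
        have := hmax _ (mem_rs.1 (hb _ hab).1).1 (Finset.subset_insert _ _)
        exact ha (this ▸ Finset.mem_insert_self a F)
  · rw [rs_st_not hv hJ hFJ, if_neg hFJ, add_zero]

lemma bet_step [CharZero 𝕜] {n₁ n₂ k : ℕ} (h1 : 2 ≤ n₁) (h2 : 2 ≤ n₂) {M F : Finset V}
    {X : Finset (Finset V)} {v : V} (I : Inv 𝕜 n₁ n₂ k M X) (hv : v ∉ M) (hF : F ∈ X)
    (hmax : ∀ s ∈ X, F ⊆ s → s = F) (hFc : F.card = n₁ + n₂) (p j : ℕ) :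
    ∑ J ∈ Finset.powersetCard j (insert v M), h 𝕜 p (rs (st X F v) J) = Fm n₁ n₂ (k + 1) p j := by
  have hFne : F.Nonempty := Finset.card_pos.1 (by omega)
  have hFM := I.sub F hF
  have hmd : M.card - F.card = k + 2 := by rw [I.cardM, hFc]; omega
  cases j with
  | zero =>
    have h3 := I.bet p 0
    rw [Finset.powersetCard_zero, Finset.sum_singleton] at h3 ⊢
    rw [rs_st_not hv (by simp) (by simpa using hFne.ne_empty)]
    have : rs X ∅ = {∅} := by
      ext s
      rw [mem_rs, Finset.subset_empty, Finset.mem_singleton]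
      exact ⟨fun hh => hh.2, fun hh => ⟨hh ▸ I.emp, hh⟩⟩
    rw [this, h_single]
    exact (Fm_zero h1 h2).symm
  | succ j =>
    rw [Finset.powersetCard_succ_insert hv, Finset.sum_union, Finset.sum_image, Fm_step]
    · have s1 : ∑ J ∈ Finset.powersetCard (j + 1) M, h 𝕜 p (rs (st X F v) J) =
          Fm n₁ n₂ k p (j + 1) + ((if p + 1 = n₁ + n₂ ∧ 1 ≤ ((n₁ + n₂ + k + 2 : ℤ) - (j + 1 : ℕ)) then
          chZ (k + 2) ((n₁ + n₂ + k + 2 : ℤ) - (j + 1 : ℕ)) else 0)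
        - (if p = n₁ + n₂ ∧ j + 1 = n₁ + n₂ + k + 2 then 1 else 0)) := by
        rw [← I.bet p (j + 1)]
        have : ∀ J ∈ Finset.powersetCard (j + 1) M, h 𝕜 p (rs (st X F v) J) = h 𝕜 p (rs X J) +
            if F ⊆ J then ((if p + 1 = n₁ + n₂ ∧ j + 1 ≠ M.card then 1 else 0)
        - (if p = n₁ + n₂ ∧ j + 1 = M.card then 1 else 0)) else 0 := by
          intro J hJ
          rw [Finset.mem_powersetCard] at hJ
          rw [h_st_in h1 h2 I hv hF hmax hFc hJ.1, hJ.2]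
        rw [Finset.sum_congr rfl this, Finset.sum_add_distrib, ← Finset.sum_filter,
          Finset.sum_const, nsmul_eq_mul, cnt_sub hFM, hmd, I.cardM]
        congr 1
        push_cast
        rcases lt_trichotomy (j + 1) (n₁ + n₂ + k + 2) with hj | hj | hj
        · have q1 : j + 1 ≠ n₁ + n₂ + k + 2 := by omega
          have q2 : (1 : ℤ) ≤ n₁ + n₂ + k + 2 - (j + 1) := by omega
          have q3 : j ≠ n₁ + n₂ + k + 1 := by omega
          simp [q3, q2]
        · have q2 : (n₁ + n₂ + k + 2 - (j + 1) : ℤ) = 0 := by omega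
          rw [q2]
          simp [hj, chZ]
        · have q1 : j + 1 ≠ n₁ + n₂ + k + 2 := by omega
          have q2 : ¬ (1 : ℤ) ≤ n₁ + n₂ + k + 2 - (j + 1) := by omega
          have q3 : ¬ (0 : ℤ) ≤ n₁ + n₂ + k + 2 - (j + 1) := by omega
          have q4 : j ≠ n₁ + n₂ + k + 1 := by omega
          simp only [q2, chZ, if_neg q3]
          simp [q4]
      have s2 : ∑ J ∈ Finset.powersetCard j M, h 𝕜 p (rs (st X F v) (insert v J)) =
          Fm n₁ n₂ k p j + ((if p = 1 ∧ 1 ≤ j then chZ (k + 2) j else 0)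
            - (if p = 0 ∧ j = 0 then 1 else 0)) := by
        rw [← I.bet p j]
        have : ∀ J ∈ Finset.powersetCard j M, h 𝕜 p (rs (st X F v) (insert v J)) = h 𝕜 p (rs X J) +
            if Disjoint J F then ((if j ≠ 0 ∧ p = 1 then 1 else 0) - (if j = 0 ∧ p = 0 then 1 else 0))
            else 0 := by
          intro J hJ
          rw [Finset.mem_powersetCard] at hJ
          by_cases hd : Disjoint J F
          · rw [h_st_disj I.emp I.sub I.vert hv hF hFne hJ.1 hd, if_pos hd]
            have : J = ∅ ↔ j = 0 := by rw [← hJ.2, Finset.card_eq_zero]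
            simp only [ne_eq, this]
          · rw [h_st_meet I.dc I.sub hv hF hmax hJ.1 hd, if_neg hd, add_zero]
        rw [Finset.sum_congr rfl this, Finset.sum_add_distrib, ← Finset.sum_filter,
          Finset.sum_const, nsmul_eq_mul, cnt_disj hFM, hmd]
        congr 1
        have : chZ (k + 2) j = (k + 2).choose j := by simp [chZ]
        rw [this]
        by_cases hj : j = 0
        · simp [hj]
        · have q : 1 ≤ j := by omega
          simp [hj, q]
      rw [s1, s2]
      ring
    · intro x hx y hy hxy
      have hx' : v ∉ x := fun hh => hv ((Finset.mem_powersetCard.1 hx).1 hh)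
      have hy' : v ∉ y := fun hh => hv ((Finset.mem_powersetCard.1 hy).1 hh)
      rw [← Finset.erase_insert hx', hxy, Finset.erase_insert hy']
    · rw [Finset.disjoint_left]
      intro x hx hx'
      obtain ⟨y, hy, rfl⟩ := Finset.mem_image.1 hx'
      exact hv ((Finset.mem_powersetCard.1 hx).1 (by simp))

lemma inv_step [CharZero 𝕜] {n₁ n₂ k : ℕ} (h1 : 2 ≤ n₁) (h2 : 2 ≤ n₂) {M F : Finset V}
    {X : Finset (Finset V)} {v : V} (I : Inv 𝕜 n₁ n₂ k M X) (hv : v ∉ M) (hF : F ∈ X)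
    (hmax : ∀ s ∈ X, F ⊆ s → s = F) : Inv 𝕜 n₁ n₂ (k + 1) (insert v M) (st X F v) := by
  have hFc : F.card = n₁ + n₂ := by
    obtain ⟨t, ht, hFt, htc⟩ := I.pure F hF
    rw [← htc, hmax t ht hFt]
  have hFM := I.sub F hF
  have hvF : v ∉ F := fun hh => hv (hFM hh)
  have hFne : F.Nonempty := Finset.card_pos.1 (by omega)
  have hpure : ∀ u, u ⊂ F → ∃ t ∈ st X F v, insert v u ⊆ t ∧ t.card = n₁ + n₂ := by
    intro u hu
    obtain ⟨a, haF, hau⟩ := Finset.exists_of_ssubset hu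
    refine ⟨insert v (F.erase a), mem_st.2 (Or.inr ⟨_, Finset.erase_ssubset haF, rfl⟩), ?_, ?_⟩
    · apply Finset.insert_subset_insert
      intro x hx
      exact Finset.mem_erase.2 ⟨fun hh => hau (hh ▸ hx), hu.1 hx⟩
    · rw [Finset.card_insert_of_notMem (fun hh => hvF (Finset.mem_of_mem_erase hh)),
        Finset.card_erase_of_mem haF, hFc]
      omega
  refine ⟨DC_st I.dc hF hmax, ?_, ?_, ?_, ?_, ?_, ?_, bet_step h1 h2 I hv hF hmax hFc⟩
  · exact mem_st.2 (Or.inl ⟨hFne.ne_empty.symm, I.emp⟩)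
  · intro s hs
    rcases mem_st.1 hs with ⟨-, hs⟩ | ⟨u, hu, rfl⟩
    · exact (I.sub s hs).trans (Finset.subset_insert _ _)
    · exact Finset.insert_subset_insert _ (hu.1.trans hFM)
  · intro a ha
    rw [mem_st]
    rcases Finset.mem_insert.1 ha with rfl | ha
    · exact Or.inr ⟨∅, Finset.empty_ssubset.2 hFne, rfl⟩
    · refine Or.inl ⟨?_, I.vert a ha⟩
      intro hh
      rw [← hh, Finset.card_singleton] at hFc
      omega
  · rw [Finset.card_insert_of_notMem hv, I.cardM]; omega
  · intro s hs
    rcases mem_st.1 hs with ⟨hsF, hs⟩ | ⟨u, hu, rfl⟩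
    · obtain ⟨t, ht, hst, htc⟩ := I.pure s hs
      by_cases htF : t = F
      · obtain ⟨t', ht', h3, h4⟩ := hpure s (lt_of_le_of_ne (htF ▸ hst) hsF)
        exact ⟨t', ht', (Finset.subset_insert _ _).trans h3, h4⟩
      · exact ⟨t, mem_st.2 (Or.inl ⟨htF, ht⟩), hst, htc⟩
    · exact hpure u hu
  · obtain ⟨z, hz, hzD, hzn⟩ := I.cyc
    set w := D 𝕜 V (e 𝕜 (insert v F)) with hw
    have hwF : w F ≠ 0 := De_ne_iff.2 ⟨v, hvF, rfl⟩
    have hzF := hzn F hF hFc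
    have hr : z F / w F ≠ 0 := div_ne_zero hzF hwF
    refine ⟨z - (z F / w F) • w, ?_, by rw [map_sub, map_smul, hzD, hw, D_D]; simp, ?_⟩
    · intro s hs
      have hsF : s ≠ F := by
        rintro rfl
        apply hs
        simp [hwF]
      by_cases hzs : z s = 0
      · have hws : w s ≠ 0 := by
          intro h0; apply hs; simp [hzs, h0]
        obtain ⟨a, ha, has⟩ := De_ne_iff.1 hws
        have hc : s.card = n₁ + n₂ := by
          have := congrArg Finset.card has
          rw [Finset.card_insert_of_notMem ha, Finset.card_insert_of_notMem hvF] at this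
          omega
        refine ⟨mem_st.2 (Or.inr ?_), hc⟩
        have hav : a ≠ v := by
          rintro rfl
          apply hsF
          rw [← Finset.erase_insert ha, has, Finset.erase_insert hvF]
        have haF : a ∈ F := (Finset.mem_insert.1 (has ▸ Finset.mem_insert_self a s)).resolve_left hav
        refine ⟨F.erase a, Finset.erase_ssubset haF, ?_⟩
        rw [← Finset.erase_insert ha, has, Finset.erase_insert_of_ne hav.symm]
      · exact ⟨mem_st.2 (Or.inl ⟨hsF, (hz s hzs).1⟩), (hz s hzs).2⟩
    · intro s hs hsc
      rcases mem_st.1 hs with ⟨hsF, hs⟩ | ⟨u, hu, rfl⟩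
      · have hws : w s = 0 := by
          by_contra h0
          obtain ⟨a, ha, has⟩ := De_ne_iff.1 h0
          have hvs : v ∉ s := fun hh => hv (I.sub s hs hh)
          have hav : v = a := (Finset.mem_insert.1
            (has.symm ▸ Finset.mem_insert_self v F : v ∈ insert a s)).resolve_right hvs
          subst hav
          apply hsF
          rw [← Finset.erase_insert ha, has, Finset.erase_insert hvF]
        simpa [hws] using hzn s hs hsc
      · have hvu : v ∉ u := fun hh => hvF (hu.1 hh)
        have hz0 : z (insert v u) = 0 := by
          by_contra h0
          exact hv (I.sub _ (hz _ h0).1 (by simp))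
        obtain ⟨a, haF, hau⟩ := Finset.exists_of_ssubset hu
        have hav : a ≠ v := fun hh => hvF (hh ▸ haF)
        have huF : insert a u = F := by
          apply Finset.eq_of_subset_of_card_le (Finset.insert_subset haF hu.1)
          rw [Finset.card_insert_of_notMem hvu] at hsc
          rw [Finset.card_insert_of_notMem hau, hsc, hFc]
        have hws : w (insert v u) ≠ 0 := by
          refine De_ne_iff.2 ⟨a, by simp [hav, hau], ?_⟩
          rw [Finset.insert_comm, huF]
        simpa [hz0] using And.intro (And.intro hzF hwF) hws

/-- base complex -/
def bs (A B : Finset V) : Finset (Finset V) :=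
  (A ∪ B).powerset.filter (fun s => ¬ A ⊆ s ∧ ¬ B ⊆ s)

lemma mem_bs {A B s : Finset V} : s ∈ bs A B ↔ s ⊆ A ∪ B ∧ ¬ A ⊆ s ∧ ¬ B ⊆ s := by
  simp only [bs, Finset.mem_filter, Finset.mem_powerset]

lemma DC_bs (A B : Finset V) : DC (bs A B) := by
  intro s hs t ht
  rw [mem_bs] at *
  exact ⟨ht.trans hs.1, fun hh => hs.2.1 (hh.trans ht), fun hh => hs.2.2 (hh.trans ht)⟩

lemma bs_comm (A B : Finset V) : bs A B = bs B A := by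
  ext s; rw [mem_bs, mem_bs, Finset.union_comm]; tauto

lemma h_cone_erase [CharZero 𝕜] (a : V) (Y : Finset (Finset V)) (hY : DC Y)
    (hc : ∀ s ∈ Y, insert a s ∈ Y) {F : Finset V} (hF : F ∈ Y) (hY' : DC (Y.erase F)) (p : ℕ) :
    h 𝕜 p (Y.erase F) = if p + 1 = F.card then 1 else 0 := by
  have h0 := fun q => h_cone (𝕜 := 𝕜) a Y hY hc q
  by_cases hcy : Cyc 𝕜 Y F
  · have h1 := h_erase_cyc hF hcy F.card
    have h2 := h_nonneg (𝕜 := 𝕜) hY' F.card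
    rw [h1, h0] at h2
    simp at h2
  · rw [h_erase_not_cyc hF hcy, h0, zero_add]

lemma h_bs_one [CharZero 𝕜] {A B J : Finset V} (hA : A.Nonempty) (hJ : J ⊆ A ∪ B) (hAJ : A ⊆ J)
    (hBJ : ¬ B ⊆ J) (p : ℕ) :
    h 𝕜 p (rs (bs A B) J) = if J = A ∧ p + 1 = A.card then 1 else 0 := by
  have hmem : ∀ s, s ∈ rs (bs A B) J ↔ s ⊆ J ∧ ¬ A ⊆ s := by
    intro s
    rw [mem_rs, mem_bs]
    exact ⟨fun hh => ⟨hh.2, hh.1.2.1⟩, fun hh => ⟨⟨hh.1.trans hJ, hh.2, fun h3 => hBJ (h3.trans hh.1)⟩, hh.1⟩⟩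
  by_cases hJA : J = A
  · obtain ⟨a, ha⟩ := hA
    have : rs (bs A B) J = J.powerset.erase A := by
      ext s
      rw [hmem, Finset.mem_erase, Finset.mem_powerset, hJA]
      constructor
      · rintro ⟨h1, h2⟩
        exact ⟨fun hh => h2 (hh ▸ Finset.Subset.refl _), h1⟩
      · rintro ⟨h1, h2⟩
        exact ⟨h2, fun hh => h1 (Finset.Subset.antisymm h2 hh)⟩
    rw [this, h_cone_erase a]
    · simp [hJA]
    · intro s hs t ht
      rw [Finset.mem_powerset] at *
      exact ht.trans hs
    · intro s hs
      rw [Finset.mem_powerset] at *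
      exact Finset.insert_subset (hAJ ha) hs
    · rw [Finset.mem_powerset]; exact hAJ
    · rw [← this]; exact DC_rs (DC_bs A B) J
  · rw [if_neg (fun hh => hJA hh.1)]
    obtain ⟨b, hb, hbA⟩ := Finset.exists_of_ssubset (lt_of_le_of_ne hAJ (fun hh => hJA hh.symm))
    apply h_cone b _ (DC_rs (DC_bs A B) J)
    intro s hs
    rw [hmem] at *
    exact ⟨Finset.insert_subset hb hs.1, fun hh => hs.2 ((Finset.subset_insert_iff_of_notMem hbA).1 hh)⟩

lemma h_bs_none [CharZero 𝕜] {A B J : Finset V} (hJ : J ⊆ A ∪ B) (hAJ : ¬ A ⊆ J)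
    (hBJ : ¬ B ⊆ J) (p : ℕ) :
    h 𝕜 p (rs (bs A B) J) = if J = ∅ ∧ p = 0 then 1 else 0 := by
  have hmem : ∀ s, s ∈ rs (bs A B) J ↔ s ⊆ J := by
    intro s
    rw [mem_rs, mem_bs]
    exact ⟨fun hh => hh.2, fun hh => ⟨⟨hh.trans hJ, fun h3 => hAJ (h3.trans hh),
      fun h3 => hBJ (h3.trans hh)⟩, hh⟩⟩
  by_cases hJe : J = ∅
  · have : rs (bs A B) J = {∅} := by
      ext s; rw [hmem, hJe, Finset.subset_empty, Finset.mem_singleton]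
    rw [this, h_single]; simp [hJe]
  · obtain ⟨a, ha⟩ := Finset.nonempty_iff_ne_empty.2 hJe
    rw [if_neg (fun hh => hJe hh.1)]
    apply h_cone a _ (DC_rs (DC_bs A B) J)
    intro s hs
    rw [hmem] at *
    exact Finset.insert_subset ha hs

lemma h_bs_all [CharZero 𝕜] {A B : Finset V} (hA : A.Nonempty) (hB : B.Nonempty)
    (hd : Disjoint A B) (p : ℕ) :
    h 𝕜 p (bs A B) = if p + 2 = (A ∪ B).card then 1 else 0 := by
  obtain ⟨a, ha⟩ := hA
  obtain ⟨b, hb⟩ := hB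
  have haB : a ∉ B := Finset.disjoint_left.1 hd ha
  have hbA : b ∉ A := Finset.disjoint_right.1 hd hb
  set Y := (A ∪ B).powerset.filter (fun s => ¬ A ⊆ s) with hYd
  have hmem : ∀ s, s ∈ Y ↔ s ⊆ A ∪ B ∧ ¬ A ⊆ s := by intro s; simp only [hYd, Finset.mem_filter, Finset.mem_powerset]
  have hY : DC Y := by
    intro s hs t ht
    rw [hmem] at *
    exact ⟨ht.trans hs.1, fun hh => hs.2 (hh.trans ht)⟩
  set F := (A ∪ B).erase a with hFd
  have haU : a ∈ A ∪ B := Finset.mem_union_left _ ha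
  have hF : F ∈ Y := by
    rw [hmem]
    exact ⟨Finset.erase_subset _ _, fun hh => by simpa [hFd] using hh ha⟩
  have hBF : B ⊆ F := by
    intro x hx
    exact Finset.mem_erase.2 ⟨fun hh => haB (hh ▸ hx), Finset.mem_union_right _ hx⟩
  have hmax : ∀ u ∈ Y, F ⊆ u → u = F := by
    intro u hu hFu
    rw [hmem] at hu
    have hau : a ∉ u := by
      intro hau
      apply hu.2
      intro x hx
      by_cases hxa : x = a
      · exact hxa ▸ hau
      · exact hFu (Finset.mem_erase.2 ⟨hxa, Finset.mem_union_left _ hx⟩)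
    apply Finset.Subset.antisymm _ hFu
    intro x hx
    exact Finset.mem_erase.2 ⟨fun hh => hau (hh ▸ hx), hu.1 hx⟩
  have hY' : DC (Y.erase F) := by
    intro s hs t ht
    rw [Finset.mem_erase] at *
    refine ⟨?_, hY _ hs.2 _ ht⟩
    intro hh
    exact hs.1 (hmax s hs.2 (hh ▸ ht))
  have hFc : F.card + 1 = (A ∪ B).card := Finset.card_erase_add_one haU
  have h1 := h_cone_erase (𝕜 := 𝕜) b Y hY (fun s hs => by
    rw [hmem] at *
    exact ⟨Finset.insert_subset (Finset.mem_union_right _ hb) hs.1,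
      fun hh => hs.2 ((Finset.subset_insert_iff_of_notMem hbA).1 hh)⟩) hF hY' p
  have h2 : h 𝕜 p (Y.erase F) = h 𝕜 p (bs A B) := by
    refine h_pair a (bs A B) (DC_bs A B) p _ _ rfl ?_ hY' ?_
    · intro s hs
      rw [mem_bs] at hs
      rw [Finset.mem_erase, hmem]
      exact ⟨fun hh => hs.2.2 (hh ▸ hBF), hs.1, hs.2.1⟩
    · intro s hs hsn
      rw [Finset.mem_erase] at hs
      have hsY := (hmem s).1 hs.2
      have hBs : B ⊆ s := by
        by_contra hh
        exact hsn (mem_bs.2 ⟨hsY.1, hsY.2, hh⟩)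
      refine ⟨⟨Finset.mem_erase.2 ⟨?_, (hmem _).2 ⟨Finset.insert_subset haU hsY.1, ?_⟩⟩, ?_⟩,
        hY' _ (Finset.mem_erase.2 hs) _ (Finset.erase_subset _ _), ?_⟩
      · intro hh
        have : a ∈ F := hh ▸ Finset.mem_insert_self a s
        simp [hFd] at this
      · intro hh
        apply hs.1
        symm
        refine (hmax s hs.2 ?_).symm
        intro x hx
        rw [hFd, Finset.mem_erase, Finset.mem_union] at hx
        rcases hx.2 with h3 | h3
        · exact (Finset.mem_insert.1 (hh h3)).resolve_left hx.1
        · exact hBs h3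
      · intro hh
        exact (mem_bs.1 hh).2.2 (hBs.trans (Finset.subset_insert _ _))
      · intro hh
        apply (mem_bs.1 hh).2.2
        intro x hx
        exact Finset.mem_erase.2 ⟨fun h3 => haB (h3 ▸ hx), hBs hx⟩
  rw [← h2, h1]
  congr 1
  apply propext; omega

lemma inv_base [CharZero 𝕜] {n₁ n₂ : ℕ} (h1 : 2 ≤ n₁) (h2 : 2 ≤ n₂) {A B : Finset V}
    (hA : A.card = n₁ + 1) (hB : B.card = n₂ + 1) (hd : Disjoint A B) :
    Inv 𝕜 n₁ n₂ 0 (A ∪ B) (bs A B) := by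
  have hAn : A.Nonempty := Finset.card_pos.1 (by omega)
  have hBn : B.Nonempty := Finset.card_pos.1 (by omega)
  have hU : (A ∪ B).card = n₁ + n₂ + 2 := by
    rw [Finset.card_union_of_disjoint hd]; omega
  refine ⟨DC_bs A B, ?_, fun s hs => (mem_bs.1 hs).1, ?_, by rw [hU], ?_, ?_, ?_⟩
  · rw [mem_bs]
    simp [hAn.ne_empty, hBn.ne_empty]
  · intro a ha
    rw [mem_bs]
    refine ⟨by simpa using ha, fun hh => ?_, fun hh => ?_⟩
    · have := Finset.card_le_card hh
      simp at this; omega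
    · have := Finset.card_le_card hh
      simp at this; omega
  · intro s hs
    rw [mem_bs] at hs
    obtain ⟨x, hxA, hxs⟩ := Finset.not_subset.1 hs.2.1
    obtain ⟨y, hyB, hys⟩ := Finset.not_subset.1 hs.2.2
    have hxy : y ≠ x := fun hh => Finset.disjoint_left.1 hd hxA (hh ▸ hyB)
    refine ⟨((A ∪ B).erase x).erase y, mem_bs.2 ⟨?_, ?_, ?_⟩, ?_, ?_⟩
    · exact (Finset.erase_subset _ _).trans (Finset.erase_subset _ _)
    · intro hh; simpa using hh hxA
    · intro hh; simpa using hh hyB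
    · intro w hw
      refine Finset.mem_erase.2 ⟨fun hh => hys (hh ▸ hw), Finset.mem_erase.2 ⟨fun hh => hxs (hh ▸ hw), hs.1 hw⟩⟩
    · rw [Finset.card_erase_of_mem, Finset.card_erase_of_mem (Finset.mem_union_left _ hxA), hU]
      · omega
      · exact Finset.mem_erase.2 ⟨hxy, Finset.mem_union_right _ hyB⟩
  · set w := D 𝕜 V (e 𝕜 (A ∪ B)) with hw
    set c : Finset V → 𝕜 := fun t => if B ⊆ t then w t else 0 with hc
    have hPDC : DC (A ∪ B).powerset := by
      intro s hs t ht
      rw [Finset.mem_powerset] at *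
      exact ht.trans hs
    have hwC : w ∈ Cc 𝕜 (A ∪ B).powerset (n₁ + n₂ + 1) := by
      apply D_mem hPDC
      have := e_mem (𝕜 := 𝕜) (Finset.mem_powerset.2 (Finset.Subset.refl (A ∪ B)))
      rw [hU] at this
      exact this
    have hcC : c ∈ Cc 𝕜 (A ∪ B).powerset (n₁ + n₂ + 1) := by
      intro s hs
      apply hwC
      intro h0
      apply hs
      simp [hc, h0]
    refine ⟨D 𝕜 V c, ?_, D_D c, ?_⟩
    · intro s hs
      have h3 := D_mem hPDC hcC s hs
      refine ⟨mem_bs.2 ⟨Finset.mem_powerset.1 h3.1, ?_, ?_⟩, h3.2⟩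
      · intro hAs
        obtain ⟨a, ha, hca⟩ := D_ne hs
        have h4 := hcC _ hca
        have hBs : B ⊆ insert a s := by
          by_contra hh
          exact hca (by simp [hc, hh])
        have := Finset.card_le_card (Finset.union_subset (hAs.trans (Finset.subset_insert a s)) hBs)
        omega
      · intro hBs
        apply hs
        have : D 𝕜 V c s = D 𝕜 V w s := by
          rw [D_apply, D_apply]
          refine Finset.sum_congr rfl fun a _ => ?_
          have : c (insert a s) = w (insert a s) := by
            simp only [hc]; rw [if_pos (hBs.trans (Finset.subset_insert _ _))]
          rw [this]
        rw [this, hw, D_D]; rfl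
    · intro s hs hsc
      rw [mem_bs] at hs
      obtain ⟨x, hxA, hxs⟩ := Finset.not_subset.1 hs.2.1
      obtain ⟨y, hyB, hys⟩ := Finset.not_subset.1 hs.2.2
      have hxy : y ≠ x := fun hh => Finset.disjoint_left.1 hd hxA (hh ▸ hyB)
      have hxys : x ∉ insert y s := by simp [hxy.symm, hxs]
      have hfull : insert x (insert y s) = A ∪ B := by
        apply Finset.eq_of_subset_of_card_le
        · exact Finset.insert_subset (Finset.mem_union_left _ hxA)
            (Finset.insert_subset (Finset.mem_union_right _ hyB) hs.1)
        · rw [Finset.card_insert_of_notMem hxys, Finset.card_insert_of_notMem hys, hsc, hU]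
      have hBy : B ⊆ insert y s := by
        intro b hb
        have : b ∈ insert x (insert y s) := hfull ▸ Finset.mem_union_right _ hb
        refine (Finset.mem_insert.1 this).resolve_left ?_
        rintro rfl
        exact Finset.disjoint_left.1 hd hxA hb
      rw [D_apply_single hys]
      · refine mul_ne_zero (sg_ne _ _) ?_
        simp only [hc]
        rw [if_pos hBy]
        exact De_ne_iff.2 ⟨x, hxys, hfull⟩
      · intro b hb hby
        simp only [hc]
        rw [if_neg]
        intro hh
        exact hys ((Finset.mem_insert.1 (hh hyB)).resolve_left hby.symm)
  · intro p j
    have key : ∀ J ∈ Finset.powersetCard j (A ∪ B), h 𝕜 p (rs (bs A B) J) =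
        (if J = ∅ then (if p = 0 then 1 else 0) else 0) + (if J = A ∪ B then (if p = n₁ + n₂ then 1 else 0) else 0)
        + (if J = A then (if p = n₁ then 1 else 0) else 0)
        + (if J = B then (if p = n₂ then 1 else 0) else 0) := by
      intro J hJ
      have hJU := (Finset.mem_powersetCard.1 hJ).1
      have nAB : ¬ A ⊆ B := fun hh => hAn.ne_empty
        (Finset.disjoint_self_iff_empty A |>.1 (Finset.disjoint_of_subset_right hh hd))
      have nBA : ¬ B ⊆ A := fun hh => hBn.ne_empty
        (Finset.disjoint_self_iff_empty B |>.1 (Finset.disjoint_of_subset_left hh hd))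
      by_cases hAJ : A ⊆ J <;> by_cases hBJ : B ⊆ J
      · have hJe : J = A ∪ B := Finset.Subset.antisymm hJU (Finset.union_subset hAJ hBJ)
        have : rs (bs A B) J = bs A B := by
          ext s; rw [mem_rs, hJe]; exact ⟨fun hh => hh.1, fun hh => ⟨hh, (mem_bs.1 hh).1⟩⟩
        rw [this, h_bs_all hAn hBn hd, hU]
        have q1 : J ≠ ∅ := by rintro rfl; exact hAn.ne_empty (Finset.subset_empty.1 hAJ)
        have q2 : J ≠ A := by rintro rfl; exact nBA hBJ
        have q3 : J ≠ B := by rintro rfl; exact nAB hAJ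
        rw [if_neg q1, if_pos hJe, if_neg q2, if_neg q3]
        simp
      · rw [h_bs_one hAn hJU hAJ hBJ, hA]
        have q1 : J ≠ ∅ := by rintro rfl; exact hAn.ne_empty (Finset.subset_empty.1 hAJ)
        have q2 : J ≠ A ∪ B := by rintro rfl; exact hBJ Finset.subset_union_right
        have q3 : J ≠ B := by rintro rfl; exact nAB hAJ
        rw [if_neg q1, if_neg q2, if_neg q3]
        by_cases hJA : J = A <;> simp [hJA]
      · rw [bs_comm, h_bs_one hBn (by rwa [Finset.union_comm]) hBJ hAJ, hB]
        have q1 : J ≠ ∅ := by rintro rfl; exact hBn.ne_empty (Finset.subset_empty.1 hBJ)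
        have q2 : J ≠ A ∪ B := by rintro rfl; exact hAJ Finset.subset_union_left
        have q3 : J ≠ A := by rintro rfl; exact nBA hBJ
        rw [if_neg q1, if_neg q2, if_neg q3]
        by_cases hJA : J = B <;> simp [hJA]
      · rw [h_bs_none hJU hAJ hBJ]
        have q1 : J ≠ A := by rintro rfl; exact hAJ (Finset.Subset.refl _)
        have q2 : J ≠ A ∪ B := by rintro rfl; exact hAJ Finset.subset_union_left
        have q3 : J ≠ B := by rintro rfl; exact hBJ (Finset.Subset.refl _)
        rw [if_neg q1, if_neg q2, if_neg q3]
        by_cases hJA : J = ∅ <;> simp [hJA]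
    rw [Finset.sum_congr rfl key, Finset.sum_add_distrib, Finset.sum_add_distrib,
      Finset.sum_add_distrib, Finset.sum_ite_eq', Finset.sum_ite_eq', Finset.sum_ite_eq',
      Finset.sum_ite_eq']
    have ch : ∀ n : ℕ, (if p = n then chZ 0 ((j : ℤ) - p - 1) else 0) =
        if n + 1 = j then (if p = n then 1 else 0) else 0 := by
      intro n
      by_cases hp : p = n
      · subst hp
        rw [if_pos rfl, if_pos rfl]
        rcases lt_trichotomy j (p + 1) with hj | hj | hj
        · rw [chZ_neg (by omega), if_neg (by omega)]
        · rw [if_pos hj.symm, hj]; simp [chZ]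
        · rw [chZ_big (by push_cast; omega), if_neg (by omega)]
      · simp [hp]
    unfold Fm
    rw [ch, ch]
    simp only [Finset.mem_powersetCard, Finset.empty_subset, Finset.subset_union_left,
      Finset.subset_union_right, Finset.Subset.refl, true_and, hA, hB, hU, Finset.card_empty, cc]
    have e1 : (if 0 = j then if p = 0 then (1 : ℤ) else 0 else 0) = if p = 0 ∧ j = 0 then 1 else 0 := by
      by_cases hj : j = 0 <;> by_cases hp : p = 0 <;> simp [hj, hp, eq_comm]
    have e2 : (if n₁ + n₂ + 2 = j then if p = n₁ + n₂ then (1 : ℤ) else 0 else 0) =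
        if p = n₁ + n₂ ∧ j = n₁ + n₂ + 0 + 2 then 1 else 0 := by
      split_ifs <;> first | rfl | omega
    rw [e1, e2]
    simp

end main

section transport

variable {V : Type} [Fintype V] [LinearOrder V]

lemma inv_transport (𝕜 : Type) [Field 𝕜] [CharZero 𝕜] (n : Fin 2 → ℕ) (h1 : 2 ≤ n 0) (h2 : 2 ≤ n 1) :
    ∀ (k : ℕ) (W : Type) (L : SimComplex W), IsGenTruncCx 2 n k W L →
    ∀ (f : W ↪ V) (M : Finset V) (X : Finset (Finset V)), (∀ x, x ∈ M ↔ x ∈ Set.range f) →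
    (∀ s, s ∈ X ↔ s = ∅ ∨ ∃ t ∈ L.faces, t.map f = s) → Inv 𝕜 (n 0) (n 1) k M X := by
  intro k
  induction k with
  | zero =>
    rintro W L ⟨e, he⟩ f M X hM hX
    set A : Finset V := (Finset.univ : Finset (Fin (n 0 + 1))).image (fun q => f (e ⟨0, q⟩)) with hA
    set B : Finset V := (Finset.univ : Finset (Fin (n 1 + 1))).image (fun q => f (e ⟨1, q⟩)) with hB
    have cA : A.card = n 0 + 1 := by
      rw [hA, Finset.card_image_of_injective]
      · simp
      · intro a b hab
        have := e.injective (f.injective hab)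
        simpa using this
    have cB : B.card = n 1 + 1 := by
      rw [hB, Finset.card_image_of_injective]
      · simp
      · intro a b hab
        have := e.injective (f.injective hab)
        simpa using this
    have hd : Disjoint A B := by
      rw [Finset.disjoint_left]
      intro x hxA hxB
      simp only [hA, hB, Finset.mem_image, Finset.mem_univ, true_and] at hxA hxB
      obtain ⟨a, rfl⟩ := hxA
      obtain ⟨b, hb⟩ := hxB
      have := congrArg Sigma.fst (e.injective (f.injective hb))
      simp at this
    have hMe : M = A ∪ B := by
      ext x
      rw [hM, Finset.mem_union]
      simp only [hA, hB, Finset.mem_image, Finset.mem_univ, true_and, Set.mem_range]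
      constructor
      · rintro ⟨w, rfl⟩
        obtain ⟨⟨p, q⟩, rfl⟩ := e.surjective w
        match p, q with
        | 0, q => exact Or.inl ⟨q, rfl⟩
        | 1, q => exact Or.inr ⟨q, rfl⟩
      · rintro (⟨a, rfl⟩ | ⟨a, rfl⟩) <;> exact ⟨_, rfl⟩
    have hXe : X = bs A B := by
      ext s
      rw [hX, mem_bs, ← hMe]
      constructor
      · rintro (rfl | ⟨t, ht, rfl⟩)
        · refine ⟨Finset.empty_subset _, fun hh => ?_, fun hh => ?_⟩
          · have := Finset.card_le_card hh; rw [Finset.card_empty] at this; omega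
          · have := Finset.card_le_card hh; rw [Finset.card_empty] at this; omega
        · have hts : t = (t.map e.symm.toEmbedding).map e.toEmbedding := by
            ext x; simp
          rw [hts] at ht
          have ht2 := ((he _).2 ht).2
          refine ⟨?_, ?_, ?_⟩
          · intro x hx
            obtain ⟨w, _, rfl⟩ := Finset.mem_map.1 hx
            exact (hM _).2 ⟨w, rfl⟩
          · obtain ⟨q, hq⟩ := ht2 0
            intro hh
            apply hq
            have : f (e ⟨0, q⟩) ∈ t.map f := hh (Finset.mem_image.2 ⟨q, Finset.mem_univ _, rfl⟩)
            rw [Finset.mem_map' f] at this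
            exact Finset.mem_map.2 ⟨_, this, by simp⟩
          · obtain ⟨q, hq⟩ := ht2 1
            intro hh
            apply hq
            have : f (e ⟨1, q⟩) ∈ t.map f := hh (Finset.mem_image.2 ⟨q, Finset.mem_univ _, rfl⟩)
            rw [Finset.mem_map' f] at this
            exact Finset.mem_map.2 ⟨_, this, by simp⟩
      · rintro ⟨hsM, hsA, hsB⟩
        by_cases hs : s = ∅
        · exact Or.inl hs
        right
        classical
        set u := (Finset.univ : Finset (Σ p : Fin 2, Fin (n p + 1))).filter (fun x => f (e x) ∈ s) with hu
        have hus : (u.map e.toEmbedding).map f = s := by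
          ext x
          simp only [hu, Finset.mem_map, Finset.mem_filter, Finset.mem_univ, true_and]
          constructor
          · rintro ⟨w, ⟨y, hy, rfl⟩, rfl⟩; exact hy
          · intro hx
            obtain ⟨w, rfl⟩ := (hM x).1 (hsM hx)
            exact ⟨w, ⟨e.symm w, by simpa using hx, by simp⟩, rfl⟩
        refine ⟨u.map e.toEmbedding, (he u).1 ⟨?_, ?_⟩, hus⟩
        · rw [Finset.nonempty_iff_ne_empty]
          rintro h0
          apply hs
          rw [← hus, h0]; simp
        · intro p
          match p with
          | 0 =>
            obtain ⟨x, hx, hxs⟩ := Finset.not_subset.1 hsA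
            obtain ⟨q, _, rfl⟩ := Finset.mem_image.1 hx
            exact ⟨q, by simpa [hu] using hxs⟩
          | 1 =>
            obtain ⟨x, hx, hxs⟩ := Finset.not_subset.1 hsB
            obtain ⟨q, _, rfl⟩ := Finset.mem_image.1 hx
            exact ⟨q, by simpa [hu] using hxs⟩
    rw [hMe, hXe]
    exact inv_base h1 h2 cA cB hd
  | succ k ih =>
    rintro W' K ⟨W, L, F, hL, hF, e, he⟩ f M X hM hX
    classical
    set g : W ↪ V := (Function.Embedding.some.trans e.toEmbedding).trans f with hg
    have hgw : ∀ w, g w = f (e (some w)) := fun w => rfl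
    set v : V := f (e none) with hv
    set M' : Finset V := Finset.univ.filter (· ∈ Set.range g) with hM'
    set X' : Finset (Finset V) := Finset.univ.filter
      (fun s => s = ∅ ∨ ∃ t ∈ L.faces, t.map g = s) with hX'
    have mM' : ∀ x, x ∈ M' ↔ x ∈ Set.range g := by intro x; simp only [hM', Finset.mem_filter, Finset.mem_univ, true_and]
    have mX' : ∀ s, s ∈ X' ↔ s = ∅ ∨ ∃ t ∈ L.faces, t.map g = s := by
      intro s; simp only [hX', Finset.mem_filter, Finset.mem_univ, true_and]
    have I := ih W L hL g M' X' mM' mX'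
    have hvg : ∀ w, g w ≠ v := by
      intro w hw
      have := e.injective (f.injective hw)
      simp at this
    have hvM : v ∉ M' := by
      rw [mM']; rintro ⟨w, hw⟩; exact hvg w hw
    have hFX : F.map g ∈ X' := (mX' _).2 (Or.inr ⟨F, hF.1, rfl⟩)
    have hFne : F.Nonempty := by
      rw [Finset.nonempty_iff_ne_empty]; intro h0; exact L.not_empty_mem (h0 ▸ hF.1)
    have hmax : ∀ s ∈ X', F.map g ⊆ s → s = F.map g := by
      intro s hs hFs
      rcases (mX' s).1 hs with rfl | ⟨t, ht, rfl⟩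
      · exact (Finset.subset_empty.1 hFs).symm
      · rw [hF.2 t ht (Finset.map_subset_map.1 hFs)]
    have J := inv_step h1 h2 I hvM hFX hmax
    have hMe : M = insert v M' := by
      ext x
      rw [hM, Finset.mem_insert, mM']
      constructor
      · rintro ⟨w, rfl⟩
        obtain ⟨o, rfl⟩ := e.surjective w
        match o with
        | none => exact Or.inl rfl
        | some w => exact Or.inr ⟨w, rfl⟩
      · rintro (rfl | ⟨w, rfl⟩) <;> exact ⟨_, rfl⟩
    -- description of the faces through `Option W`
    have hface : ∀ s, (∃ t ∈ K.faces, t.map f = s) ↔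
        ∃ o ∈ (SimComplex.stellar L F).faces, (o.map e.toEmbedding).map f = s := by
      intro s
      constructor
      · rintro ⟨t, ht, rfl⟩
        have hts : t = (t.map e.symm.toEmbedding).map e.toEmbedding := by
          ext x; simp
        refine ⟨t.map e.symm.toEmbedding, (he _).2 (hts ▸ ht), by rw [← hts]⟩
      · rintro ⟨o, ho, rfl⟩
        exact ⟨_, (he _).1 ho, rfl⟩
    have mapn : ∀ o : Finset (Option W), none ∉ o →
        (o.map e.toEmbedding).map f = (Finset.eraseNone o).map g := by
      intro o ho
      ext x
      simp only [Finset.mem_map, Finset.mem_eraseNone, hgw]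
      constructor
      · rintro ⟨w, ⟨y, hy, rfl⟩, rfl⟩
        match y with
        | none => exact absurd hy ho
        | some y => exact ⟨y, hy, rfl⟩
      · rintro ⟨y, hy, rfl⟩
        exact ⟨_, ⟨_, hy, rfl⟩, rfl⟩
    have maps : ∀ o : Finset (Option W), none ∈ o →
        (o.map e.toEmbedding).map f = insert v ((Finset.eraseNone o).map g) := by
      intro o ho
      ext x
      simp only [Finset.mem_map, Finset.mem_eraseNone, hgw, Finset.mem_insert]
      constructor
      · rintro ⟨w, ⟨y, hy, rfl⟩, rfl⟩
        match y with
        | none => exact Or.inl rfl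
        | some y => exact Or.inr ⟨y, hy, rfl⟩
      · rintro (rfl | ⟨y, hy, rfl⟩)
        · exact ⟨_, ⟨_, ho, rfl⟩, rfl⟩
        · exact ⟨_, ⟨_, hy, rfl⟩, rfl⟩
    have hXe : X = st X' (F.map g) v := by
      ext s
      rw [hX, mem_st, hface]
      constructor
      · rintro (rfl | ⟨o, ⟨hone, ho⟩, rfl⟩)
        · left
          refine ⟨?_, (mX' _).2 (Or.inl rfl)⟩
          intro h0
          exact hFne.ne_empty (Finset.map_eq_empty.1 h0.symm)
        · rcases ho with ⟨hn, hf, hF'⟩ | ⟨hn, hF', hf⟩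
          · left
            rw [mapn o hn]
            refine ⟨fun hh => hF' ?_, (mX' _).2 (Or.inr ⟨_, hf, rfl⟩)⟩
            rw [Finset.map_inj.1 hh]
          · right
            rw [maps o hn]
            exact ⟨_, Finset.map_ssubset_map.2 hF', rfl⟩
      · rintro (⟨hne, hs⟩ | ⟨u, hu, rfl⟩)
        · rcases (mX' s).1 hs with rfl | ⟨t, ht, rfl⟩
          · exact Or.inl rfl
          · right
            have hn : none ∉ t.map Function.Embedding.some := by simp
            have hE : Finset.eraseNone (t.map Function.Embedding.some) = t := by
              ext x; simp
            refine ⟨t.map Function.Embedding.some, ⟨?_, Or.inl ⟨hn, ?_, ?_⟩⟩, ?_⟩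
            · rw [Finset.map_nonempty, Finset.nonempty_iff_ne_empty]
              rintro rfl; exact L.not_empty_mem ht
            · rw [hE]; exact ht
            · rw [hE]; intro hh; exact hne (by rw [hF.2 t ht hh])
            · rw [mapn _ hn, hE]
        · right
          obtain ⟨t, htF, rfl⟩ := Finset.subset_map_iff.1 hu.subset
          have hn : none ∈ Finset.insertNone t := by simp
          have hE : Finset.eraseNone (Finset.insertNone t) = t := by
            ext x; simp
          refine ⟨Finset.insertNone t, ⟨⟨_, hn⟩, Or.inr ⟨hn, ?_, ?_⟩⟩, ?_⟩
          · rw [hE]; exact Finset.map_ssubset_map.1 hu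
          · rw [hE]
            rcases Finset.eq_empty_or_nonempty t with h0 | h0
            · exact Or.inr h0
            · exact Or.inl (L.down_closed hF.1 htF h0)
          · rw [maps _ hn, hE]
    rw [hMe, hXe]
    exact J

lemma bbetti_eq {𝕜 : Type} [Field 𝕜] [CharZero 𝕜] {n₁ n₂ k : ℕ} (h1 : 2 ≤ n₁) (h2 : 2 ≤ n₂)
    (K : SimComplex V) (hK : IsGenTruncCx 2 ![n₁, n₂] k V K) (i p : ℕ) :
    ((K.bbetti 𝕜 i (i + p) : ℕ) : ℤ) = Fm n₁ n₂ k p (i + p) := by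
  classical
  set X : Finset (Finset V) := Finset.univ.filter (fun s => s = ∅ ∨ s ∈ K.faces) with hX
  have mX : ∀ s, s ∈ X ↔ s = ∅ ∨ s ∈ K.faces := by
    intro s; simp only [hX, Finset.mem_filter, Finset.mem_univ, true_and]
  have I : Inv 𝕜 n₁ n₂ k (Finset.univ : Finset V) X :=
    inv_transport 𝕜 ![n₁, n₂] h1 h2 k V K hK (Function.Embedding.refl V) Finset.univ X
      (by intro x; simp) (by intro s; rw [mX]; simp)
  rw [← I.bet p (i + p), SimComplex.bbetti, Nat.cast_sum]
  refine Finset.sum_congr rfl fun J _ => ?_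
  have : (((i + p : ℕ) : ℤ) - i - 1) = (p : ℤ) - 1 := by push_cast; ring
  rw [this]
  apply hdim_eq
  intro s
  rw [mem_rs, mX]
  constructor
  · rintro ⟨rfl | hs, hJ⟩
    · exact Or.inl rfl
    · exact Or.inr ⟨hs, hJ⟩
  · rintro (rfl | hs)
    · exact ⟨Or.inl rfl, Finset.empty_subset _⟩
    · exact ⟨Or.inr hs.1, hs.2⟩

lemma bbetti_lt {𝕜 : Type} [Field 𝕜] (K : SimComplex V) {i j : ℕ} (hij : j < i) :
    K.bbetti 𝕜 i j = 0 := by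
  rw [SimComplex.bbetti]
  refine Finset.sum_eq_zero fun J _ => ?_
  unfold SimComplex.hdim
  rw [if_neg (by omega), if_neg (by omega)]

end transport

end GTB

/-- **Bigraded Betti numbers of generalized truncation polytopes of type `(k; n₁, n₂)`**
(Limonchenko, Theorem 2.1).  Let `P = vc^k(Δ^{n₁} × Δ^{n₂})` with `n₁ ≥ n₂ > 1`, `k ≥ 0`,
a simple polytope of dimension `d = n₁ + n₂` with `m = n₁ + n₂ + 2 + k` facets, and let
`K = K_P` be the boundary complex of the dual simplicial polytope.  Over a field `𝕜` of
characteristic zero, for `1 ≤ i ≤ k + 1`: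
(a) if `n₁ = n₂ = n` then `β^{-i,2(i+n)}(P) = 2·C(k, i-1)`;
(b) if `n₁ > n₂` then `β^{-i,2(i+n₁)}(P) = β^{-i,2(i+n₂)}(P) = C(k, i-1)`;
(c) `β^{-i,2(i+1)}(P) = β^{-(k+2-i),2(k+1-i+n₁+n₂)}(P) = i·C(k+2, i+1) - C(k, i-1)`;
(d) `β^{0,0}(P) = β^{-(m-d),2m}(P) = 1`;
and all other bigraded Betti numbers vanish. -/
theorem genTrunc_two_factors_bigraded_betti
    (k n₁ n₂ : ℕ) (hn : n₂ ≤ n₁) (hn₂ : 2 ≤ n₂)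
    {V : Type} [Fintype V] [LinearOrder V] (K : SimComplex V)
    (hK : IsGenTruncCx 2 ![n₁, n₂] k V K)
    (𝕜 : Type) [Field 𝕜] [CharZero 𝕜] :
    (∀ i : ℕ, 1 ≤ i → i ≤ k + 1 →
      -- (a)
      (n₁ = n₂ → K.bbetti 𝕜 i (i + n₁) = 2 * k.choose (i - 1)) ∧
      -- (b)
      (n₂ < n₁ → K.bbetti 𝕜 i (i + n₁) = k.choose (i - 1) ∧
        K.bbetti 𝕜 i (i + n₂) = k.choose (i - 1)) ∧
      -- (c)
      ((K.bbetti 𝕜 i (i + 1) : ℤ) =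
          i * (k + 2).choose (i + 1) - k.choose (i - 1)) ∧
      ((K.bbetti 𝕜 (k + 2 - i) (k + 1 - i + n₁ + n₂) : ℤ) =
          i * (k + 2).choose (i + 1) - k.choose (i - 1))) ∧
    -- (d)
    K.bbetti 𝕜 0 0 = 1 ∧
    K.bbetti 𝕜 (k + 2) (n₁ + n₂ + 2 + k) = 1 ∧
    -- all other bigraded Betti numbers are zero
    (∀ i j : ℕ, K.bbetti 𝕜 i j ≠ 0 →
      (i = 0 ∧ j = 0) ∨ (i = k + 2 ∧ j = n₁ + n₂ + 2 + k) ∨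
      (1 ≤ i ∧ i ≤ k + 1 ∧
        (j = i + 1 ∨ j = i + n₁ ∨ j = i + n₂ ∨ j = i + n₁ + n₂ - 1))) := by
  have h1 : 2 ≤ n₁ := le_trans hn₂ hn
  have key := fun i p => GTB.bbetti_eq (𝕜 := 𝕜) h1 hn₂ K hK i p
  refine ⟨?_, ?_, ?_, ?_⟩
  · intro i hi hik
    obtain ⟨i, rfl⟩ : ∃ a, i = a + 1 := ⟨i - 1, by omega⟩
    have hch : ∀ n : ℕ, GTB.chZ k (((i + 1 + n : ℕ) : ℤ) - n - 1) = k.choose i := by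
      intro n
      rw [← GTB.chZ_nat]; congr 1; push_cast; ring
    refine ⟨?_, ?_, ?_, ?_⟩
    · intro hnn
      subst hnn
      have := key (i + 1) n₁
      unfold GTB.Fm at this
      rw [if_neg (by omega), if_neg (by omega), if_pos rfl, if_neg (by omega), if_neg (by omega),
        hch] at this
      simp only [Nat.add_sub_cancel]
      omega
    · intro hnn
      have q1 := key (i + 1) n₁
      have q2 := key (i + 1) n₂
      unfold GTB.Fm at q1 q2
      rw [if_neg (by omega), if_neg (by omega), if_pos rfl, if_neg (by omega), if_neg (by omega),
        if_neg (by omega), hch] at q1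
      rw [if_neg (by omega), if_neg (by omega), if_neg (by omega), if_pos rfl, if_neg (by omega),
        if_neg (by omega), hch] at q2
      simp only [Nat.add_sub_cancel]
      omega
    · rw [key (i + 1) 1]
      unfold GTB.Fm
      rw [if_neg (by omega), if_neg (by omega), if_neg (by omega), if_neg (by omega), if_pos rfl,
        if_neg (by omega)]
      have : (((i + 1 + 1 : ℕ) : ℤ) - 1) = (i : ℤ) + 1 := by push_cast; ring
      rw [this, GTB.cc_closed]
      simp only [Nat.add_sub_cancel]
      push_cast
      ring
    · have hj : k + 1 - (i + 1) + n₁ + n₂ = (k + 2 - (i + 1)) + (n₁ + n₂ - 1) := by omega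
      rw [hj, key]
      unfold GTB.Fm
      rw [if_neg (by omega), if_neg (by omega), if_neg (by omega), if_neg (by omega), if_neg (by omega),
        if_pos (by omega)]
      have : ((n₁ : ℤ) + n₂ + k + 2 - 1 - ((k + 2 - (i + 1) + (n₁ + n₂ - 1) : ℕ) : ℤ)) = (i : ℤ) + 1 := by
        omega
      rw [this, GTB.cc_closed]
      simp only [Nat.add_sub_cancel]
      push_cast
      ring
  · have := key 0 0
    unfold GTB.Fm at this
    rw [if_pos (by omega), if_neg (by omega), if_neg (by omega), if_neg (by omega), if_neg (by omega),
      if_neg (by omega)] at this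
    simp only [Nat.add_zero] at this
    omega
  · have := key (k + 2) (n₁ + n₂)
    unfold GTB.Fm at this
    rw [if_neg (by omega), if_pos (by omega), if_neg (by omega), if_neg (by omega), if_neg (by omega),
      if_neg (by omega)] at this
    have hj : n₁ + n₂ + 2 + k = k + 2 + (n₁ + n₂) := by omega
    rw [hj]
    omega
  · intro i j hne
    by_cases hij : j < i
    · exact absurd (GTB.bbetti_lt K hij) hne
    obtain ⟨p, rfl⟩ : ∃ p, j = i + p := ⟨j - i, by omega⟩
    by_contra hcon
    apply hne
    have q := key i p
    have hch : (p = n₁ ∨ p = n₂) → GTB.chZ k (((i + p : ℕ) : ℤ) - p - 1) = 0 := by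
      intro hp
      by_cases hi : i = 0
      · exact GTB.chZ_neg (by push_cast; omega)
      · exact GTB.chZ_big (by push_cast; omega)
    have hc1 : p = 1 → GTB.cc k (((i + p : ℕ) : ℤ) - 1) = 0 := by
      intro hp
      by_cases hi : i = 0
      · exact GTB.cc_neg _ _ (by push_cast; omega)
      · exact GTB.cc_big _ _ (by push_cast; omega)
    have hc2 : p + 1 = n₁ + n₂ → GTB.cc k ((n₁ + n₂ + k + 2 : ℤ) - 1 - (i + p : ℕ)) = 0 := by
      intro hp
      by_cases hi : i = 0
      · exact GTB.cc_big _ _ (by push_cast; omega)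
      · exact GTB.cc_neg _ _ (by push_cast; omega)
    unfold GTB.Fm at q
    rw [if_neg (by omega), if_neg (by omega)] at q
    have z1 : (if p = n₁ then GTB.chZ k (((i + p : ℕ) : ℤ) - p - 1) else 0) = 0 := by
      split_ifs with hp
      · exact hch (Or.inl hp)
      · rfl
    have z2 : (if p = n₂ then GTB.chZ k (((i + p : ℕ) : ℤ) - p - 1) else 0) = 0 := by
      split_ifs with hp
      · exact hch (Or.inr hp)
      · rfl
    have z3 : (if p = 1 then GTB.cc k (((i + p : ℕ) : ℤ) - 1) else 0) = 0 := by
      split_ifs with hp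
      · exact hc1 hp
      · rfl
    have z4 : (if p + 1 = n₁ + n₂ then GTB.cc k ((n₁ + n₂ + k + 2 : ℤ) - 1 - (i + p : ℕ)) else 0) = 0 := by
      split_ifs with hp
      · exact hc2 hp
      · rfl
    rw [z1, z2, z3, z4] at q
    omega
end

section
/- Let P be a generalized truncation polytope of type (k; n_1, n_2) with n_1 ≥ n_2 > 1, let d = n_1 + n_2, let K = K_P be the boundary complex of the dual simplicial polytope with vertex set V, and let W be a nonempty proper subset of V. Then the reduced simplicial homology (with coefficients in a field of characteristic zero) of the full subcomplex K_W vanishes in every degree i with i ∉ {0, n_1 − 1, n_2 − 1, d − 2}. -/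
open Finset Module

namespace GT

section ops
variable {𝕜 : Type} [Field 𝕜] {U : Type} [LinearOrder U]

def sgn (𝕜 : Type) [Field 𝕜] (a : U) (t : Finset U) : 𝕜 := (-1) ^ (t.filter (fun b => b < a)).card

lemma sgn_mul_self (a : U) (t : Finset U) : sgn 𝕜 a t * sgn 𝕜 a t = 1 := by
  unfold sgn
  rw [← mul_pow]; simp

lemma sgn_ne_zero (a : U) (t : Finset U) : sgn 𝕜 a t ≠ 0 := by
  unfold sgn
  exact pow_ne_zero _ (by simp)

lemma sgn_insert (a b : U) (t : Finset U) (hb : b ∉ t) :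
    sgn 𝕜 a (insert b t) = if b < a then - sgn 𝕜 a t else sgn 𝕜 a t := by
  unfold sgn
  rw [Finset.filter_insert]
  split_ifs with h
  · rw [Finset.card_insert_of_notMem (by simp [hb]), pow_succ]; ring
  · rfl

lemma sgn_insert_self (a : U) (t : Finset U) :
    sgn 𝕜 a (insert a t) = sgn 𝕜 a t := by
  unfold sgn
  rw [Finset.filter_insert]; simp

lemma sgn_anti (a b : U) (t : Finset U) (hab : a ≠ b) (ha : a ∉ t) (hb : b ∉ t) :
    sgn 𝕜 a t * sgn 𝕜 b (insert a t) = - (sgn 𝕜 b t * sgn 𝕜 a (insert b t)) := by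
  rw [sgn_insert _ _ _ ha, sgn_insert _ _ _ hb]
  rcases lt_or_gt_of_ne hab with h | h
  · simp [h, h.not_gt]; ring
  · simp [h, h.not_gt]; ring

variable [Fintype U]

def bd : (Finset U → 𝕜) →ₗ[𝕜] (Finset U → 𝕜) where
  toFun c := fun t => ∑ a ∈ tᶜ, sgn 𝕜 a t * c (insert a t)
  map_add' x y := by
    funext t
    simp [mul_add, Finset.sum_add_distrib]
  map_smul' r x := by
    funext t
    simp [Finset.mul_sum, mul_left_comm]

lemma bd_apply (c : Finset U → 𝕜) (t : Finset U) :
    bd c t = ∑ a ∈ tᶜ, sgn 𝕜 a t * c (insert a t) := rfl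

def cone (v : U) : (Finset U → 𝕜) →ₗ[𝕜] (Finset U → 𝕜) where
  toFun c := fun s => if v ∈ s then sgn 𝕜 v s * c (s.erase v) else 0
  map_add' x y := by
    funext t
    simp only [Pi.add_apply]
    split_ifs <;> ring
  map_smul' r x := by
    funext t
    simp only [Pi.smul_apply, RingHom.id_apply, smul_eq_mul]
    split_ifs <;> ring

lemma cone_apply (v : U) (c : Finset U → 𝕜) (s : Finset U) :
    cone v c s = if v ∈ s then sgn 𝕜 v s * c (s.erase v) else 0 := rfl

lemma bd_cone (v : U) (c : Finset U → 𝕜) : bd (cone v c) = c - cone v (bd c) := by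
  funext t
  rw [Pi.sub_apply, cone_apply, bd_apply]
  by_cases hv : v ∈ t
  · obtain ⟨r, hr, rfl⟩ : ∃ r, v ∉ r ∧ t = insert v r :=
      ⟨t.erase v, by simp, by simp [hv]⟩
    rw [if_pos hv, Finset.erase_insert hr, bd_apply]
    have hc : rᶜ = insert v (insert v r)ᶜ := by
      ext x; simp; by_cases hx : x = v <;> simp [hx, hr]
    rw [hc, Finset.sum_insert (by simp), mul_add, ← mul_assoc, sgn_insert_self, sgn_mul_self,
      one_mul, Finset.mul_sum]
    rw [sub_add_eq_sub_sub, sub_self, zero_sub, ← Finset.sum_neg_distrib]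
    refine Finset.sum_congr rfl fun a ha => ?_
    simp only [Finset.mem_compl, Finset.mem_insert, not_or] at ha
    rw [cone_apply, if_pos (by simp), Finset.insert_comm, Finset.erase_insert (by
      simp [hr, Ne.symm ha.1]), sgn_insert_self]
    have h := sgn_anti (𝕜 := 𝕜) v a r (Ne.symm ha.1) hr ha.2
    have h1 := sgn_mul_self (𝕜 := 𝕜) v r
    have h2 := sgn_mul_self (𝕜 := 𝕜) a r
    have key : sgn 𝕜 a (insert v r) * sgn 𝕜 v (insert a r) = -(sgn 𝕜 v r * sgn 𝕜 a r) := by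
      linear_combination (sgn 𝕜 v r * sgn 𝕜 v (insert a r)) * h - (sgn 𝕜 a (insert v r) * sgn 𝕜 v (insert a r)) * h1
        - sgn 𝕜 v r * sgn 𝕜 a r * sgn_mul_self (𝕜 := 𝕜) v (insert a r)
    rw [← mul_assoc, key]; ring
  · rw [if_neg hv, sub_zero]
    rw [Finset.sum_eq_single v]
    · rw [cone_apply, if_pos (by simp), Finset.erase_insert hv, sgn_insert_self, ← mul_assoc,
        sgn_mul_self, one_mul]
    · intro b hb hbv
      rw [cone_apply, if_neg, mul_zero]
      simp [hv, Ne.symm hbv]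
    · intro h; simp [hv] at h

lemma bd_bd [CharZero 𝕜] (c : Finset U → 𝕜) : bd (bd c) = 0 := by
  funext t
  have e : bd (bd c) t = ∑ a, ∑ b, (if a ∉ t ∧ b ∉ t ∧ a ≠ b then
      sgn 𝕜 a t * sgn 𝕜 b (insert a t) * c (insert b (insert a t)) else 0) := by
    rw [bd_apply]
    rw [← Finset.sum_subset (Finset.subset_univ tᶜ)]
    · refine Finset.sum_congr rfl fun a ha => ?_
      rw [bd_apply, Finset.mul_sum, ← Finset.sum_subset (Finset.subset_univ (insert a t)ᶜ)]
      · refine Finset.sum_congr rfl fun b hb => ?_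
        simp only [Finset.mem_compl, Finset.mem_insert, not_or] at ha hb
        rw [if_pos ⟨ha, hb.2, Ne.symm hb.1⟩, mul_assoc]
      · intro b _ hb
        rw [if_neg]
        rintro ⟨_, h2, h3⟩
        apply hb
        simp [h2, Ne.symm h3]
    · intro a _ ha
      apply Finset.sum_eq_zero
      intro b _
      rw [if_neg]
      rintro ⟨h, _⟩
      exact ha (by simpa using h)
  have e2 : bd (bd c) t = - bd (bd c) t := by
    nth_rewrite 1 [e]
    rw [Finset.sum_comm, e, ← Finset.sum_neg_distrib]
    refine Finset.sum_congr rfl fun a _ => ?_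
    rw [← Finset.sum_neg_distrib]
    refine Finset.sum_congr rfl fun b _ => ?_
    by_cases h : a ∉ t ∧ b ∉ t ∧ a ≠ b
    · rw [if_pos ⟨h.2.1, h.1, Ne.symm h.2.2⟩, if_pos h, sgn_anti b a t (Ne.symm h.2.2) h.2.1 h.1,
        Finset.insert_comm]
      ring
    · rw [if_neg, if_neg h, neg_zero]
      rintro ⟨h1, h2, h3⟩
      exact h ⟨h2, h1, Ne.symm h3⟩
  simpa using self_eq_neg.mp e2

lemma supp_bd {c : Finset U → 𝕜} {t : Finset U} (h : bd c t ≠ 0) :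
    ∃ a, a ∉ t ∧ c (insert a t) ≠ 0 := by
  rw [bd_apply] at h
  obtain ⟨a, ha, h2⟩ := Finset.exists_ne_zero_of_sum_ne_zero h
  exact ⟨a, by simpa using ha, right_ne_zero_of_mul h2⟩

lemma supp_cone {v : U} {c : Finset U → 𝕜} {s : Finset U} (h : cone v c s ≠ 0) :
    v ∈ s ∧ c (s.erase v) ≠ 0 := by
  rw [cone_apply] at h
  split_ifs at h with hv
  · exact ⟨hv, right_ne_zero_of_mul h⟩
  · exact absurd rfl h

lemma supp_add {x y : Finset U → 𝕜} {s : Finset U} (h : (x + y) s ≠ 0) : x s ≠ 0 ∨ y s ≠ 0 := by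
  by_contra hc
  push Not at hc
  simp [hc.1, hc.2] at h

lemma supp_sub {x y : Finset U → 𝕜} {s : Finset U} (h : (x - y) s ≠ 0) : x s ≠ 0 ∨ y s ≠ 0 := by
  by_contra hc
  push Not at hc
  simp [hc.1, hc.2] at h

lemma decomp (v : U) (z : Finset U → 𝕜) (hz : bd z = 0) :
    ∃ z0 w : Finset U → 𝕜, (∀ s, z0 s ≠ 0 → v ∉ s ∧ z s ≠ 0) ∧
      (∀ s, w s ≠ 0 → v ∉ s ∧ z (insert v s) ≠ 0) ∧ z = z0 + cone v w ∧ bd w = 0 ∧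
      bd z0 + w = 0 := by
  set z0 : Finset U → 𝕜 := fun s => if v ∈ s then 0 else z s with hz0
  set w : Finset U → 𝕜 := fun s => if v ∈ s then 0 else sgn 𝕜 v s * z (insert v s) with hw
  have h0 : ∀ s, z0 s ≠ 0 → v ∉ s ∧ z s ≠ 0 := by
    intro s hs
    simp only [hz0] at hs
    split_ifs at hs with h
    · exact absurd rfl hs
    · exact ⟨h, hs⟩
  have hw' : ∀ s, w s ≠ 0 → v ∉ s ∧ z (insert v s) ≠ 0 := by
    intro s hs
    simp only [hw] at hs
    split_ifs at hs with h
    · exact absurd rfl hs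
    · exact ⟨h, right_ne_zero_of_mul hs⟩
  have hdec : z = z0 + cone v w := by
    funext s
    rw [Pi.add_apply, cone_apply]
    simp only [hz0, hw]
    by_cases hv : v ∈ s
    · obtain ⟨r, hr, rfl⟩ : ∃ r, v ∉ r ∧ s = insert v r :=
        ⟨s.erase v, by simp, by simp [hv]⟩
      simp only [if_pos hv, Finset.erase_insert hr, if_neg hr, sgn_insert_self]
      rw [← mul_assoc, sgn_mul_self]; ring
    · simp [hv]
  have hbd : bd z0 + w - cone v (bd w) = 0 := by
    rw [← hz, hdec, map_add, bd_cone]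
    abel
  have hw0 : bd w = 0 := by
    funext t
    by_contra hne
    obtain ⟨a, ha, h1⟩ := supp_bd hne
    have hvt : v ∉ t := fun h => (hw' _ h1).1 (by simp [h])
    have h2 := congrFun hbd (insert v t)
    rw [Pi.sub_apply, Pi.add_apply, cone_apply, if_pos (by simp), Finset.erase_insert hvt] at h2
    have h3 : bd z0 (insert v t) = 0 := by
      by_contra h
      obtain ⟨b, _, hb⟩ := supp_bd h
      exact (h0 _ hb).1 (by simp)
    have h4 : w (insert v t) = 0 := by simp [hw]
    rw [h3, h4] at h2
    have h5 := sgn_ne_zero (𝕜 := 𝕜) v (insert v t)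
    simp only [zero_add, zero_sub, Pi.zero_apply, neg_eq_zero, mul_eq_zero] at h2
    rcases h2 with h2 | h2
    · exact h5 h2
    · exact hne h2
  refine ⟨z0, w, h0, hw', hdec, hw0, ?_⟩
  rw [hw0, map_zero, sub_zero] at hbd
  exact hbd

def Ch (𝓕 : Set (Finset U)) (m : ℕ) (c : Finset U → 𝕜) : Prop :=
  ∀ s, c s ≠ 0 → s ∈ 𝓕 ∧ s.card = m

lemma Ch.add {𝓕 : Set (Finset U)} {m : ℕ} {x y : Finset U → 𝕜} (hx : Ch 𝓕 m x) (hy : Ch 𝓕 m y) :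
    Ch 𝓕 m (x + y) := fun s h => (supp_add h).elim (hx s) (hy s)

lemma Ch.sub {𝓕 : Set (Finset U)} {m : ℕ} {x y : Finset U → 𝕜} (hx : Ch 𝓕 m x) (hy : Ch 𝓕 m y) :
    Ch 𝓕 m (x - y) := fun s h => (supp_sub h).elim (hx s) (hy s)

lemma Ch.cone {𝓕 : Set (Finset U)} {m : ℕ} {v : U} {x : Finset U → 𝕜} (hx : Ch 𝓕 m x)
    (h : ∀ t, x t ≠ 0 → v ∉ t → insert v t ∈ 𝓕) : Ch 𝓕 (m + 1) (cone v x) := by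
  intro s hs
  obtain ⟨h1, h2⟩ := supp_cone hs
  have h3 := h _ h2 (by simp)
  rw [Finset.insert_erase h1] at h3
  refine ⟨h3, ?_⟩
  rw [← (hx _ h2).2, Finset.card_erase_add_one h1]

lemma Ch.bd {𝓕 : Set (Finset U)} {m : ℕ} {x : Finset U → 𝕜} (hx : Ch 𝓕 (m+1) x)
    (hd : ∀ s t, s ∈ 𝓕 → t ⊆ s → t ∈ 𝓕) : Ch 𝓕 m (bd x) := by
  intro s hs
  obtain ⟨a, h1, h2⟩ := supp_bd hs
  have := hx _ h2
  rw [Finset.card_insert_of_notMem h1] at this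
  exact ⟨hd _ _ this.1 (Finset.subset_insert _ _), by omega⟩

def Hv (𝕜 : Type) [Field 𝕜] (𝓕 : Set (Finset U)) (m : ℕ) : Prop :=
  ∀ c : Finset U → 𝕜, Ch 𝓕 m c → bd c = 0 → ∃ e, Ch 𝓕 (m + 1) e ∧ bd e = c

def res (𝓕 : Set (Finset U)) (W : Finset U) : Set (Finset U) := {s | s ∈ 𝓕 ∧ s ⊆ W}

structure Inv (𝕜 : Type) [Field 𝕜] (n₁ n₂ : ℕ) (𝓕 : Set (Finset U)) (X : Set U) : Prop where
  down : ∀ s t, s ∈ 𝓕 → t ⊆ s → t ∈ 𝓕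
  sub : ∀ s ∈ 𝓕, ∀ x ∈ s, x ∈ X
  vert : ∀ x ∈ X, {x} ∈ 𝓕
  pure : ∀ s ∈ 𝓕, ∃ F ∈ 𝓕, s ⊆ F ∧ F.card = n₁ + n₂
  bound : ∀ s ∈ 𝓕, s.card ≤ n₁ + n₂
  top : ∀ z : Finset U → 𝕜, Ch 𝓕 (n₁ + n₂) z → bd z = 0 → ∀ F ∈ 𝓕, F.card = n₁ + n₂ → z F = 0 →
    z = 0
  van : ∀ W m, 2 ≤ m → m + 2 ≤ n₁ + n₂ → m ≠ n₁ → m ≠ n₂ → Hv 𝕜 (res 𝓕 W) m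

def step (𝓕 : Set (Finset U)) (F : Finset U) (v : U) : Set (Finset U) :=
  {s | (s ∈ 𝓕 ∧ s ≠ F) ∨ ∃ t, t ⊂ F ∧ s = insert v t}

lemma Inv.step {n₁ n₂ : ℕ} {𝓕 : Set (Finset U)} {X : Set U} (h : Inv 𝕜 n₁ n₂ 𝓕 X)
    (hd : 2 ≤ n₁ + n₂)
    {F : Finset U} (hF : F ∈ 𝓕) (hFc : F.card = n₁ + n₂) {v : U} (hv : v ∉ X) :
    Inv 𝕜 n₁ n₂ (step 𝓕 F v) (insert v X) := by
  have hvs : ∀ s ∈ 𝓕, v ∉ s := fun s hs hvs => hv (h.sub s hs v hvs)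
  have hsubF : ∀ t, t ⊂ F → t ∈ 𝓕 := fun t ht => h.down F t hF ht.1
  have hbig : ∀ s ∈ 𝓕, F ⊆ s → s = F := fun s hs hsF =>
    (Finset.eq_of_subset_of_card_le hsF (by rw [hFc]; exact h.bound s hs)).symm
  -- facts for support on step family
  have hA : ∀ s ∈ GT.step 𝓕 F v, v ∉ s → s ∈ 𝓕 ∧ s ≠ F := by
    rintro s (hs | ⟨t, ht, rfl⟩) hvs'
    · exact hs
    · simp at hvs'
  have hB : ∀ t, v ∉ t → insert v t ∈ GT.step 𝓕 F v → t ⊂ F := by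
    rintro t hvt (hs | ⟨t', ht, he⟩)
    · exact absurd (by simp) (hvs _ hs.1)
    · have : t = t' := by
        rw [← Finset.erase_insert hvt, he, Finset.erase_insert (hvs _ (hsubF _ ht))]
      rwa [this]
  constructor
  · rintro s t (⟨hs, hne⟩ | ⟨r, hr, rfl⟩) hts
    · refine Or.inl ⟨h.down _ _ hs hts, ?_⟩
      rintro rfl
      exact hne (hbig _ hs hts)
    · by_cases hvt : v ∈ t
      · refine Or.inr ⟨t.erase v, lt_of_le_of_lt ?_ hr, by simp [hvt]⟩
        intro x hx
        have := hts (Finset.mem_of_mem_erase hx)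
        simp only [Finset.mem_insert, Finset.ne_of_mem_erase hx, false_or] at this
        exact this
      · have : t ⊂ F := by
          refine lt_of_le_of_lt ?_ hr
          intro x hx
          have h1 := hts hx
          simp only [Finset.mem_insert] at h1
          rcases h1 with rfl | h1
          · exact absurd hx hvt
          · exact h1
        exact Or.inl ⟨hsubF _ this, this.ne⟩
  · rintro s (⟨hs, hne⟩ | ⟨r, hr, rfl⟩) x hx
    · exact Or.inr (h.sub s hs x hx)
    · simp only [Finset.mem_insert] at hx
      rcases hx with rfl | hx
      · exact Or.inl rfl
      · exact Or.inr (h.sub _ (hsubF _ hr) x hx)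
  · rintro x (rfl | hx)
    · refine Or.inr ⟨∅, ?_, by simp⟩
      rw [Finset.empty_ssubset, ← Finset.card_pos]; omega
    · refine Or.inl ⟨h.vert x hx, ?_⟩
      rintro rfl
      simp at hFc; omega
  · have key : ∀ t, t ⊂ F → ∃ G ∈ GT.step 𝓕 F v, insert v t ⊆ G ∧ G.card = n₁ + n₂ := by
      intro t ht
      obtain ⟨y, hy, hyt⟩ := Finset.exists_of_ssubset ht
      refine ⟨insert v (F.erase y), Or.inr ⟨_, Finset.erase_ssubset hy, rfl⟩, ?_, ?_⟩
      · apply Finset.insert_subset_insert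
        intro x hx
        refine Finset.mem_erase.mpr ⟨?_, ht.1 hx⟩
        rintro rfl; exact hyt hx
      · rw [Finset.card_insert_of_notMem, Finset.card_erase_of_mem hy, hFc]
        · omega
        · exact fun h => hvs F hF (Finset.mem_of_mem_erase h)
    rintro s (⟨hs, hne⟩ | ⟨r, hr, rfl⟩)
    · obtain ⟨G, hG, hsG, hGc⟩ := h.pure s hs
      by_cases hGF : G = F
      · subst hGF
        obtain ⟨G', h1, h2, h3⟩ := key s (lt_of_le_of_ne hsG hne)
        exact ⟨G', h1, (Finset.subset_insert _ _).trans h2, h3⟩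
      · exact ⟨G, Or.inl ⟨hG, hGF⟩, hsG, hGc⟩
    · exact key r hr
  · rintro s (⟨hs, hne⟩ | ⟨r, hr, rfl⟩)
    · exact h.bound s hs
    · have := Finset.card_lt_card hr
      have := Finset.card_insert_le v r
      omega
  · intro z hz hbz G hG hGc hzG
    obtain ⟨z0, w, h0, hw, hdec, hbw, hz0w⟩ := decomp v z hbz
    obtain ⟨y, hy⟩ : F.Nonempty := by rw [← Finset.card_pos]; omega
    have hw' : ∀ s, w s ≠ 0 → s ⊂ F ∧ s.card + 1 = n₁ + n₂ := by
      intro s hs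
      obtain ⟨h1, h2⟩ := hw s hs
      have h3 := hz _ h2
      rw [Finset.card_insert_of_notMem h1] at h3
      exact ⟨hB _ h1 h3.1, h3.2⟩
    have hu : ∀ s, cone y w s ≠ 0 → s = F := by
      intro s hs
      obtain ⟨h1, h2⟩ := supp_cone hs
      obtain ⟨h3, h4⟩ := hw' _ h2
      rw [Finset.card_erase_add_one h1] at h4
      apply Finset.eq_of_subset_of_card_le _ (by omega)
      rw [← Finset.insert_erase h1]
      exact Finset.insert_subset hy h3.1
    have hbu : bd (cone y w) = w := by rw [bd_cone, hbw, map_zero, sub_zero]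
    have hz0' : ∀ s, z0 s ≠ 0 → (s ∈ 𝓕 ∧ s ≠ F) ∧ s.card = n₁ + n₂ := by
      intro s hs
      obtain ⟨h1, h2⟩ := h0 s hs
      exact ⟨hA _ (hz s h2).1 h1, (hz s h2).2⟩
    have hz0F : z0 F = 0 := by
      by_contra hne
      exact (hz0' F hne).1.2 rfl
    have hch : Ch 𝓕 (n₁ + n₂) (z0 + cone y w) := by
      refine Ch.add (fun s hs => ⟨(hz0' s hs).1.1, (hz0' s hs).2⟩) (fun s hs => ?_)
      rw [hu s hs]; exact ⟨hF, hFc⟩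
    have hcy : bd (z0 + cone y w) = 0 := by rw [map_add, hbu, hz0w]
    -- it suffices that `z0 + cone y w = 0`
    have hfin : z0 + cone y w = 0 → z = 0 := by
      intro he
      have h1 : cone y w = 0 := by
        funext s
        by_contra hne
        have := hu s hne
        subst this
        have := congrFun he s
        rw [Pi.add_apply, hz0F, zero_add] at this
        exact hne this
      have h2 : w = 0 := by rw [← hbu, h1, map_zero]
      rw [h1, add_zero] at he
      rw [hdec, he, h2, map_zero, add_zero]
    apply hfin
    rcases hG with ⟨hG, hGF⟩ | ⟨r, hr, rfl⟩
    · apply h.top _ hch hcy G hG hGc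
      have h1 : cone y w G = 0 := by
        by_contra hne
        exact hGF (hu _ hne)
      have h2 : z0 G = 0 := by
        by_contra hne
        exact (h0 _ hne).2 hzG
      rw [Pi.add_apply, h1, h2, add_zero]
    · have hwr : w r = 0 := by
        by_contra hne
        exact (hw r hne).2 hzG
      have huF : cone y w F = 0 := by
        have h1 : bd (cone y w) r = 0 := by rw [hbu, hwr]
        obtain ⟨q, hq, hqr⟩ := Finset.exists_of_ssubset hr
        have hrF : insert q r = F := by
          apply Finset.eq_of_subset_of_card_le
          · exact Finset.insert_subset hq hr.1
          · rw [Finset.card_insert_of_notMem hqr, hFc, ← hGc,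
              Finset.card_insert_of_notMem (hvs _ (hsubF _ hr))]
        rw [bd_apply, Finset.sum_eq_single q, hrF] at h1
        · exact (mul_eq_zero.mp h1).resolve_left (sgn_ne_zero _ _)
        · intro b hb hbq
          rw [mul_eq_zero]; right
          by_contra hne
          have h3 := hu _ hne
          rw [← hrF] at h3
          have : b ∈ insert q r := by rw [← h3]; simp
          simp only [Finset.mem_insert, hbq, false_or] at this
          simp [this] at hb
        · intro hq'; simp [hqr] at hq'
      apply h.top _ hch hcy F hF hFc
      rw [Pi.add_apply, hz0F, huF, add_zero]
  · intro W m hm2 hmd hm1 hm3 z hz hbz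
    have hlift : ∀ e : Finset U → 𝕜, Ch (res 𝓕 W) (m + 1) e → Ch (res (GT.step 𝓕 F v) W) (m + 1) e := by
      intro e he s hs
      obtain ⟨⟨h1, h2⟩, h3⟩ := he s hs
      refine ⟨⟨Or.inl ⟨h1, ?_⟩, h2⟩, h3⟩
      rintro rfl; omega
    obtain ⟨z0, w, h0, hw, hdec, hbw, hz0w⟩ := decomp v z hbz
    have hz0' : Ch (res 𝓕 W) m z0 := by
      intro s hs
      obtain ⟨h1, h2⟩ := h0 s hs
      exact ⟨⟨(hA _ (hz s h2).1.1 h1).1, (hz s h2).1.2⟩, (hz s h2).2⟩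
    have hw' : ∀ s, w s ≠ 0 → s ⊂ F ∧ s.card + 1 = m ∧ insert v s ⊆ W := by
      intro s hs
      obtain ⟨h1, h2⟩ := hw s hs
      have h3 := hz _ h2
      rw [Finset.card_insert_of_notMem h1] at h3
      exact ⟨hB _ h1 h3.1.1, h3.2, h3.1.2⟩
    by_cases hw0 : w = 0
    · subst hw0
      rw [map_zero, add_zero] at hdec
      subst hdec
      obtain ⟨e, he, hbe⟩ := h.van W m hm2 hmd hm1 hm3 z hz0' hbz
      exact ⟨e, hlift e he, hbe⟩
    · obtain ⟨r, hr⟩ := Function.ne_iff.mp hw0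
      obtain ⟨hr1, hr2, hr3⟩ := hw' r hr
      obtain ⟨y, hy⟩ : r.Nonempty := by rw [← Finset.card_pos]; omega
      have hu : ∀ s, cone y w s ≠ 0 → s ⊂ F ∧ s ⊆ W ∧ s.card = m ∧ v ∈ W := by
        intro s hs
        obtain ⟨h1, h2⟩ := supp_cone hs
        obtain ⟨h3, h4, h5⟩ := hw' _ h2
        rw [Finset.card_erase_add_one h1] at h4
        refine ⟨lt_of_le_of_ne ?_ ?_, ?_, h4, h5 (by simp)⟩
        · rw [← Finset.insert_erase h1]
          exact Finset.insert_subset (hr1.1 hy) h3.1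
        · rintro rfl; omega
        · rw [← Finset.insert_erase h1]
          exact Finset.insert_subset (hr3 (by simp [hy])) ((Finset.subset_insert _ _).trans h5)
      have hbu : bd (cone y w) = w := by rw [bd_cone, hbw, map_zero, sub_zero]
      have hch : Ch (res 𝓕 W) m (z0 + cone y w) :=
        hz0'.add fun s hs => ⟨⟨hsubF _ (hu s hs).1, (hu s hs).2.1⟩, (hu s hs).2.2.1⟩
      have hcy : bd (z0 + cone y w) = 0 := by rw [map_add, hbu, hz0w]
      obtain ⟨e, he, hbe⟩ := h.van W m hm2 hmd hm1 hm3 _ hch hcy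
      refine ⟨e - cone v (cone y w), (hlift e he).sub ?_, ?_⟩
      · intro s hs
        obtain ⟨h1, h2⟩ := supp_cone hs
        obtain ⟨h3, h4, h5, h6⟩ := hu _ h2
        rw [← Finset.insert_erase h1]
        refine ⟨⟨Or.inr ⟨_, h3, rfl⟩, Finset.insert_subset h6 h4⟩, ?_⟩
        rw [Finset.card_insert_of_notMem (by simp), h5]
      · rw [map_sub, hbe, bd_cone, hbu]
        conv_rhs => rw [hdec]
        abel

def base (A B : Finset U) : Set (Finset U) := {s | s ⊆ A ∪ B ∧ ¬ A ⊆ s ∧ ¬ B ⊆ s}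

lemma base_comm (A B : Finset U) : base A B = base B A := by
  ext s; simp only [base, Set.mem_setOf_eq, Finset.union_comm A B]; tauto

lemma base_move {A B : Finset U} (hAB : Disjoint A B) {m : ℕ} {z : Finset U → 𝕜}
    (hz : Ch (base A B) m z) (hbz : bd z = 0) {a a' b : U} (ha : a ∈ A) (ha' : a' ∈ A)
    (hb : b ∈ B) (h : z ((A.erase a) ∪ (B.erase b)) = 0) :
    z ((A.erase a') ∪ (B.erase b)) = 0 := by
  by_cases haa : a = a'
  · rwa [← haa]
  have hdis : ∀ x, x ∈ A → x ∉ B := fun x hx hx' => Finset.disjoint_left.mp hAB hx hx'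
  set t := (A.erase a).erase a' ∪ B.erase b with ht
  have h1 : insert a' t = (A.erase a) ∪ (B.erase b) := by
    ext x; simp only [ht, Finset.mem_insert, Finset.mem_union, Finset.mem_erase]
    by_cases hx : x = a'
    · subst hx; simp [Ne.symm haa, ha']
    · simp [hx]
  have h2 : insert a t = (A.erase a') ∪ (B.erase b) := by
    ext x; simp only [ht, Finset.mem_insert, Finset.mem_union, Finset.mem_erase]
    by_cases hx : x = a
    · subst hx; simp [haa, ha]
    · simp [hx]
  have h3 := congrFun hbz t
  rw [bd_apply, Finset.sum_eq_single a, h2] at h3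
  · exact (mul_eq_zero.mp h3).resolve_left (sgn_ne_zero _ _)
  · intro x hx hxa
    rw [mul_eq_zero]; right
    by_cases hxa' : x = a'
    · rw [hxa', h1, h]
    by_contra hne
    obtain ⟨⟨h4, h5, h6⟩, _⟩ := hz _ hne
    have h7 := h4 (Finset.mem_insert_self x t)
    simp only [Finset.mem_compl, ht, Finset.mem_union, Finset.mem_erase] at hx h7
    have hxb : x = b := by tauto
    subst hxb
    apply h6
    intro q hq
    simp only [ht, Finset.mem_insert, Finset.mem_union, Finset.mem_erase]
    tauto
  · intro h
    exfalso
    apply h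
    have := hdis a ha
    simp [ht, this]

lemma base_full [CharZero 𝕜] {A B : Finset U} (hAB : Disjoint A B) {W : Finset U} (hA : A ⊆ W) (hB : B ⊆ W)
    (hAn : A.Nonempty) (hBn : B.Nonempty) (m : ℕ) (hm : m + 3 ≤ A.card + B.card) :
    Hv 𝕜 (res (base A B) W) m := by
  intro z hz hbz
  obtain ⟨a, ha⟩ := hAn
  obtain ⟨b, hb⟩ := hBn
  have hdis : ∀ x, x ∈ A → x ∉ B := fun x hx hx' => Finset.disjoint_left.mp hAB hx hx'
  set y : Finset U → 𝕜 := fun s => if A.erase a ⊆ s then z s else 0 with hy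
  have hyz : ∀ s, y s ≠ 0 → A.erase a ⊆ s ∧ z s ≠ 0 := by
    intro s hs
    simp only [hy] at hs
    split_ifs at hs with h
    · exact ⟨h, hs⟩
    · exact absurd rfl hs
  have hbdy : ∀ t, A.erase a ⊆ t → bd y t = 0 := by
    intro t ht
    rw [← show bd z t = 0 from congrFun hbz t, bd_apply, bd_apply]
    refine Finset.sum_congr rfl fun x _ => ?_
    simp only [hy]
    rw [if_pos (ht.trans (Finset.subset_insert _ _))]
  have hdown : ∀ s t, s ∈ res (base A B) W → t ⊆ s → t ∈ res (base A B) W := by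
    rintro s t ⟨⟨h1, h2, h3⟩, h4⟩ hts
    exact ⟨⟨hts.trans h1, fun h => h2 (h.trans hts), fun h => h3 (h.trans hts)⟩, hts.trans h4⟩
  have hych : Ch (res (base A B) W) m y := fun s hs => hz s (hyz s hs).2
  have hcy : Ch (res (base A B) W) (m + 1) (cone b y) := by
    apply hych.cone
    intro t ht hbt
    obtain ⟨h1, h2⟩ := hyz t ht
    obtain ⟨⟨⟨h3, h4, h5⟩, h6⟩, h7⟩ := hz t h2
    refine ⟨⟨Finset.insert_subset (by simp [hb]) h3, ?_, ?_⟩, Finset.insert_subset (hB hb) h6⟩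
    · intro h
      apply h4
      intro x hx
      have := h hx
      simp only [Finset.mem_insert] at this
      rcases this with rfl | h8
      · exact absurd hb (hdis _ hx)
      · exact h8
    · intro h
      have h8 : A.erase a ∪ B ⊆ insert b t :=
        Finset.union_subset (h1.trans (Finset.subset_insert _ _)) h
      have h9 := Finset.card_le_card h8
      rw [Finset.card_insert_of_notMem hbt, h7, Finset.card_union_of_disjoint
        (hAB.mono_left (Finset.erase_subset _ _)), Finset.card_erase_of_mem ha] at h9
      have : 0 < A.card := Finset.card_pos.mpr ⟨a, ha⟩
      omega
  set z' := z - bd (cone b y) with hz'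
  have hz'ch : Ch (res (base A B) W) m z' := hz.sub (hcy.bd hdown)
  have hz'0 : ∀ s, A.erase a ⊆ s → z' s = 0 := by
    intro s hs
    rw [hz', bd_cone, Pi.sub_apply, Pi.sub_apply, cone_apply]
    have h1 : y s = z s := by simp only [hy]; rw [if_pos hs]
    rw [h1, hbdy, mul_zero, ite_self]
    · ring
    · intro x hx
      refine Finset.mem_erase.mpr ⟨?_, hs hx⟩
      rintro rfl
      exact hdis _ (Finset.mem_of_mem_erase hx) hb
  have hbz' : bd z' = 0 := by rw [hz', map_sub, bd_bd, hbz, sub_zero]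
  refine ⟨cone a z' + cone b y, Ch.add ?_ hcy, ?_⟩
  · apply hz'ch.cone
    intro t ht hat
    obtain ⟨⟨⟨h3, h4, h5⟩, h6⟩, h7⟩ := hz'ch t ht
    refine ⟨⟨Finset.insert_subset (by simp [ha]) h3, ?_, ?_⟩, Finset.insert_subset (hA ha) h6⟩
    · intro h
      apply ht
      apply hz'0
      rw [← Finset.erase_insert hat]
      exact Finset.erase_subset_erase _ h
    · intro h
      apply h5
      intro x hx
      have := h hx
      simp only [Finset.mem_insert] at this
      rcases this with rfl | h8
      · exact absurd hx (hdis _ ha)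
      · exact h8
  · rw [map_add, bd_cone, hbz', map_zero, sub_zero, hz']
    abel

/-- case `A` not contained in `W` -/
lemma base_part {A B : Finset U} (hAB : Disjoint A B) {W : Finset U} (hA : ¬ A ⊆ W)
    (m : ℕ) (hm : 1 ≤ m) (hmB : m + 1 ≠ B.card) :
    Hv 𝕜 (res (base A B) W) m := by
  intro z hz hbz
  by_cases hz0 : z = 0
  · subst hz0
    exact ⟨0, fun s hs => absurd rfl hs, map_zero _⟩
  obtain ⟨r, hr⟩ := Function.ne_iff.mp hz0
  obtain ⟨⟨⟨hr1, hr2, hr3⟩, hr4⟩, hr5⟩ := hz r hr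
  have hmain : ∀ x ∈ W, x ∈ A ∪ B → (∀ t, z t ≠ 0 → ¬ B ⊆ insert x t) →
      ∃ e, Ch (res (base A B) W) (m + 1) e ∧ bd e = z := by
    intro x hxW hx hB
    refine ⟨cone x z, hz.cone ?_, by rw [bd_cone, hbz, map_zero, sub_zero]⟩
    intro t ht _
    obtain ⟨⟨⟨h3, h4, h5⟩, h6⟩, h7⟩ := hz t ht
    have : insert x t ⊆ W := Finset.insert_subset hxW h6
    exact ⟨⟨Finset.insert_subset hx h3, fun h => hA (h.trans this), hB t ht⟩, this⟩
  by_cases hAW : ∃ x ∈ W, x ∈ A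
  · obtain ⟨x, hxW, hxA⟩ := hAW
    apply hmain x hxW (by simp [hxA])
    intro t ht hB
    obtain ⟨⟨⟨h3, h4, h5⟩, h6⟩, h7⟩ := hz t ht
    apply h5
    intro q hq
    have := hB hq
    simp only [Finset.mem_insert] at this
    rcases this with rfl | h8
    · exact absurd hq (Finset.disjoint_left.mp hAB hxA)
    · exact h8
  · push Not at hAW
    have hsB : ∀ t, z t ≠ 0 → t ⊂ B := by
      intro t ht
      obtain ⟨⟨⟨h3, h4, h5⟩, h6⟩, h7⟩ := hz t ht
      refine ⟨?_, h5⟩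
      intro q hq
      have := h3 hq
      simp only [Finset.mem_union] at this
      exact this.resolve_left (hAW q (h6 hq))
    obtain ⟨x, hx⟩ : r.Nonempty := by rw [← Finset.card_pos]; omega
    apply hmain x (hr4 hx) (hr1 hx)
    intro t ht hB
    have h1 := Finset.card_lt_card (hsB t ht)
    have h2 := Finset.card_le_card hB
    have h3 := Finset.card_insert_le x t
    have h4 := (hz t ht).2
    omega

lemma base_inv [CharZero 𝕜] {n₁ n₂ : ℕ} {A B : Finset U} (hAB : Disjoint A B) (hA : A.card = n₁ + 1)
    (hB : B.card = n₂ + 1) (h1 : 1 ≤ n₁) (h2 : 1 ≤ n₂) :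
    Inv 𝕜 n₁ n₂ (base A B) ((A ∪ B : Finset U) : Set U) := by
  have hdis : ∀ x, x ∈ A → x ∉ B := fun x hx hx' => Finset.disjoint_left.mp hAB hx hx'
  have hcard : ∀ a ∈ A, ∀ b ∈ B, (A.erase a ∪ B.erase b).card = n₁ + n₂ := by
    intro a ha b hb
    rw [Finset.card_union_of_disjoint (hAB.mono (Finset.erase_subset _ _) (Finset.erase_subset _ _)),
      Finset.card_erase_of_mem ha, Finset.card_erase_of_mem hb, hA, hB]
    simp
  have hface : ∀ a ∈ A, ∀ b ∈ B, (A.erase a ∪ B.erase b) ∈ base A B := by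
    intro a ha b hb
    refine ⟨Finset.union_subset_union (Finset.erase_subset _ _) (Finset.erase_subset _ _), ?_, ?_⟩
    · intro h
      have := h ha
      simp [hdis a ha] at this
    · intro h
      have := h hb
      simp at this
      exact hdis b this.2 hb
  have hin : ∀ s ∈ base A B, ∃ a ∈ A, ∃ b ∈ B, s ⊆ A.erase a ∪ B.erase b := by
    rintro s ⟨h3, h4, h5⟩
    obtain ⟨a, ha, has⟩ := Finset.not_subset.mp h4
    obtain ⟨b, hb, hbs⟩ := Finset.not_subset.mp h5
    refine ⟨a, ha, b, hb, fun x hx => ?_⟩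
    have := h3 hx
    simp only [Finset.mem_union, Finset.mem_erase] at this ⊢
    have e1 : x ≠ a := by rintro rfl; exact has hx
    have e2 : x ≠ b := by rintro rfl; exact hbs hx
    tauto
  constructor
  · rintro s t ⟨h1, h2, h3⟩ hts
    exact ⟨hts.trans h1, fun h => h2 (h.trans hts), fun h => h3 (h.trans hts)⟩
  · intro s hs x hx
    exact hs.1 hx
  · intro x hx
    refine ⟨by simpa using hx, ?_, ?_⟩
    · intro h; have := Finset.card_le_card h; simp at this; omega
    · intro h; have := Finset.card_le_card h; simp at this; omega
  · intro s hs
    obtain ⟨a, ha, b, hb, h⟩ := hin s hs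
    exact ⟨_, hface a ha b hb, h, hcard a ha b hb⟩
  · intro s hs
    obtain ⟨a, ha, b, hb, h⟩ := hin s hs
    rw [← hcard a ha b hb]
    exact Finset.card_le_card h
  · intro z hz hbz F hF hFc hzF
    have heq : ∀ s ∈ base A B, s.card = n₁ + n₂ → ∃ a ∈ A, ∃ b ∈ B, s = A.erase a ∪ B.erase b := by
      intro s hs hsc
      obtain ⟨a, ha, b, hb, h⟩ := hin s hs
      exact ⟨a, ha, b, hb, Finset.eq_of_subset_of_card_le h (by rw [hcard a ha b hb, hsc])⟩
    obtain ⟨a, ha, b, hb, rfl⟩ := heq F hF hFc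
    funext s
    by_contra hne
    obtain ⟨hs1, hs2⟩ := hz s hne
    obtain ⟨a', ha', b', hb', rfl⟩ := heq s hs1 hs2
    apply hne
    have e1 := base_move hAB hz hbz ha ha' hb hzF
    rw [Finset.union_comm] at e1 ⊢
    rw [base_comm] at hz
    exact base_move hAB.symm hz hbz hb hb' ha' e1
  · intro W m hm2 hmd hm1 hm3
    by_cases hAW : A ⊆ W
    · by_cases hBW : B ⊆ W
      · exact base_full hAB hAW hBW (Finset.card_pos.mp (by omega)) (Finset.card_pos.mp (by omega)) m
          (by omega)
      · rw [base_comm]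
        exact base_part hAB.symm hBW m (by omega) (by omega)
    · exact base_part hAB hAW m (by omega) (by omega)

end ops

open SimComplex

def fam {V U : Type} (K : SimComplex V) (f : V ↪ U) : Set (Finset U) :=
  {s | s = ∅ ∨ ∃ t ∈ K.faces, s = t.map f}

lemma map_mem_fam {V U : Type} (K : SimComplex V) (f : V ↪ U) (t : Finset V) :
    t.map f ∈ fam K f ↔ t = ∅ ∨ t ∈ K.faces := by
  constructor
  · rintro (h | ⟨t', h', h⟩)
    · left; simpa using h
    · right
      rw [Finset.map_injective f h]; exact h'
  · rintro (rfl | h)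
    · left; simp
    · exact Or.inr ⟨t, h, rfl⟩

lemma fam_iso {V V' U : Type} (K : SimComplex V) (L : SimComplex V') (e : V' ≃ V)
    (he : ∀ s : Finset V', s ∈ L.faces ↔ s.map e.toEmbedding ∈ K.faces) (f : V ↪ U) :
    fam K f = fam L (e.toEmbedding.trans f) := by
  ext s
  constructor
  · rintro (h | ⟨t, h', h⟩)
    · exact Or.inl h
    · refine Or.inr ⟨t.map e.symm.toEmbedding, ?_, ?_⟩
      · rw [he]
        convert h'
        ext x; simp
      · rw [h]
        ext x; simp
        exact ⟨fun ⟨a, ha, hx⟩ => ⟨e.symm a, by simpa using ha, by simpa using hx⟩,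
          fun ⟨a, ha, hx⟩ => ⟨_, ha, hx⟩⟩
  · rintro (h | ⟨t, h', h⟩)
    · exact Or.inl h
    · exact Or.inr ⟨t.map e.toEmbedding, (he t).1 h', by rw [h, Finset.map_map]⟩

lemma fam_stellar {V U : Type} [DecidableEq U] (K : SimComplex V) (F : Finset V) (hF : K.IsFacet F)
    (f : Option V ↪ U) :
    fam (stellar K F) f = {s | (s ∈ fam K (Function.Embedding.some.trans f) ∧
      s ≠ F.map (Function.Embedding.some.trans f)) ∨
      ∃ t, t ⊂ F.map (Function.Embedding.some.trans f) ∧ s = insert (f none) t} := by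
  classical
  set g := Function.Embedding.some.trans f with hg
  have hFne : F ≠ ∅ := by rintro rfl; exact K.not_empty_mem hF.1
  have hmapN : ∀ s : Finset (Option V), none ∉ s → s.map f = s.eraseNone.map g := by
    intro s hs
    rw [hg, ← Finset.map_map]
    congr 1
    ext x
    cases x <;> simp [hs]
  have hmapI : ∀ s : Finset (Option V), none ∈ s → s.map f = insert (f none) (s.eraseNone.map g) := by
    intro s hs
    rw [hg, ← Finset.map_map, ← Finset.map_insert]
    congr 1
    ext x
    cases x <;> simp [hs]
  ext s
  constructor
  · rintro (rfl | ⟨t, ⟨hne, ht⟩, rfl⟩)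
    · left
      refine ⟨Or.inl rfl, ?_⟩
      intro h
      exact hFne (by simpa using h.symm)
    · rcases ht with ⟨h1, h2, h3⟩ | ⟨h1, h2, h3⟩
      · left
        rw [hmapN t h1]
        refine ⟨Or.inr ⟨_, h2, rfl⟩, ?_⟩
        intro h
        exact h3 (Finset.map_injective g h).ge
      · right
        exact ⟨t.eraseNone.map g, by simpa using h2, hmapI t h1⟩
  · rintro (⟨h | ⟨t, h, rfl⟩, hne⟩ | ⟨t, ht, rfl⟩)
    · exact Or.inl h
    · right
      have htne : t.Nonempty := by
        rw [Finset.nonempty_iff_ne_empty]; rintro rfl; exact K.not_empty_mem h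
      refine ⟨t.map Function.Embedding.some, ⟨by simpa using htne, Or.inl ⟨by simp, ?_, ?_⟩⟩, ?_⟩
      · simpa using h
      · intro hsub
        have h2 : F ⊆ t := by simpa using hsub
        exact hne (by rw [hF.2 t h h2])
      · rw [hg, Finset.map_map]
    · right
      obtain ⟨r, hr, rfl⟩ := Finset.subset_map_iff.mp ht.1
      have hrF : r ⊂ F := by simpa using ht
      refine ⟨insert none (r.map Function.Embedding.some), ⟨by simp, Or.inr ⟨by simp, ?_, ?_⟩⟩, ?_⟩
      · convert hrF
        ext x; simp
      · have e : (insert none (r.map Function.Embedding.some)).eraseNone = r := by ext x; simp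
        rw [e]
        rcases r.eq_empty_or_nonempty with h | h
        · exact Or.inr h
        · exact Or.inl (K.down_closed hF.1 hrF.1 h)
      · rw [Finset.map_insert, hg, Finset.map_map]

lemma inv_main (𝕜 : Type) [Field 𝕜] [CharZero 𝕜] {U : Type} [LinearOrder U] [Fintype U]
    (n₁ n₂ : ℕ) (h1 : 1 ≤ n₁) (h2 : 1 ≤ n₂) (k : ℕ) :
    ∀ (V : Type) (K : SimComplex V), IsGenTruncCx 2 ![n₁, n₂] k V K → ∀ f : V ↪ U,
      Inv 𝕜 n₁ n₂ (fam K f) (Set.range f) := by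
  induction k with
  | zero =>
    rintro V K ⟨e, he⟩ f
    rw [fam_iso K _ e he f]
    set g := e.toEmbedding.trans f with hg
    obtain ⟨α, hα⟩ : ∃ α : Fin (n₁ + 1) ↪ U, ∀ q : Fin (n₁ + 1), α q = g ⟨0, q⟩ :=
      ⟨⟨fun q => g ⟨0, q⟩, fun x y h => by
        have := g.injective h
        exact eq_of_heq (Sigma.mk.inj_iff.mp this).2⟩, fun _ => rfl⟩
    set A : Finset U := Finset.univ.map α with hA
    obtain ⟨β, hβ⟩ : ∃ β : Fin (n₂ + 1) ↪ U, ∀ q : Fin (n₂ + 1), β q = g ⟨1, q⟩ :=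
      ⟨⟨fun q => g ⟨1, q⟩, fun x y h => by
        have := g.injective h
        exact eq_of_heq (Sigma.mk.inj_iff.mp this).2⟩, fun _ => rfl⟩
    set B : Finset U := Finset.univ.map β with hB
    have hAB : Disjoint A B := by
      rw [Finset.disjoint_left]
      intro x hx hx'
      simp only [hA, hB, Finset.mem_map, Finset.mem_univ, true_and] at hx hx'
      obtain ⟨p, rfl⟩ := hx
      obtain ⟨q, hq⟩ := hx'
      rw [hα, hβ] at hq
      have h01 := (Sigma.mk.inj_iff.mp (g.injective hq)).1
      exact absurd h01 (by decide)
    have hAm : ∀ q : Fin (n₁ + 1), g ⟨0, q⟩ ∈ A := by intro q; rw [← hα]; simp [hA]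
    have hBm : ∀ q : Fin (n₂ + 1), g ⟨1, q⟩ ∈ B := by intro q; rw [← hβ]; simp [hB]
    have hall : ∀ x, g x ∈ A ∪ B := by
      rintro ⟨p, q⟩
      rw [Finset.mem_union]
      fin_cases p
      · exact Or.inl (hAm q)
      · exact Or.inr (hBm q)
    have hr : Set.range f = ((A ∪ B : Finset U) : Set U) := by
      ext x
      constructor
      · rintro ⟨y, rfl⟩
        have := hall (e.symm y)
        simpa [hg] using this
      · intro hx
        simp only [hA, hB, Finset.coe_union, Set.mem_union, Finset.mem_coe, Finset.mem_map,
          Finset.mem_univ, true_and] at hx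
        rcases hx with ⟨p, rfl⟩ | ⟨p, rfl⟩
        · exact ⟨e ⟨0, p⟩, (hα p).symm⟩
        · exact ⟨e ⟨1, p⟩, (hβ p).symm⟩
    have hAs : ∀ t : Finset (Σ p : Fin 2, Fin (![n₁, n₂] p + 1)),
        A ⊆ t.map g ↔ ∀ q : Fin (n₁ + 1), (⟨0, q⟩ : Σ p : Fin 2, Fin (![n₁, n₂] p + 1)) ∈ t := by
      intro t
      constructor
      · intro h q
        exact (Finset.mem_map' g).mp (h (hAm q))
      · intro h x hx
        simp only [hA, Finset.mem_map, Finset.mem_univ, true_and] at hx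
        obtain ⟨q, rfl⟩ := hx
        rw [hα]
        exact (Finset.mem_map' g).mpr (h q)
    have hBs : ∀ t : Finset (Σ p : Fin 2, Fin (![n₁, n₂] p + 1)),
        B ⊆ t.map g ↔ ∀ q : Fin (n₂ + 1), (⟨1, q⟩ : Σ p : Fin 2, Fin (![n₁, n₂] p + 1)) ∈ t := by
      intro t
      constructor
      · intro h q
        exact (Finset.mem_map' g).mp (h (hBm q))
      · intro h x hx
        simp only [hB, Finset.mem_map, Finset.mem_univ, true_and] at hx
        obtain ⟨q, rfl⟩ := hx
        rw [hβ]
        exact (Finset.mem_map' g).mpr (h q)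
    have hAc : A.card = n₁ + 1 := by rw [hA, Finset.card_map]; simp
    have hBc : B.card = n₂ + 1 := by rw [hB, Finset.card_map]; simp
    have hfam : fam (prodSimplicesDual 2 ![n₁, n₂]) g = base A B := by
      ext s
      constructor
      · rintro (rfl | ⟨t, ht, rfl⟩)
        · refine ⟨by simp, ?_, ?_⟩
          · intro h; have := Finset.card_le_card h; simp at this; simp [this] at hAc
          · intro h; have := Finset.card_le_card h; simp at this; simp [this] at hBc
        · refine ⟨?_, ?_, ?_⟩
          · intro x hx
            obtain ⟨y, _, rfl⟩ := Finset.mem_map.mp hx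
            exact hall y
          · rw [hAs]
            intro h
            obtain ⟨q, hq⟩ := ht.2 0
            exact hq (h q)
          · rw [hBs]
            intro h
            obtain ⟨q, hq⟩ := ht.2 1
            exact hq (h q)
      · rintro ⟨h3, h4, h5⟩
        obtain ⟨t, rfl⟩ : ∃ t : Finset (Σ p : Fin 2, Fin (![n₁, n₂] p + 1)), s = t.map g := by
          have : s ⊆ Finset.univ.map g := by
            intro x hx
            have hx' : x ∈ Set.range f := by rw [hr]; exact h3 hx
            obtain ⟨y, rfl⟩ := hx'
            rw [Finset.mem_map]
            exact ⟨e.symm y, Finset.mem_univ _, by simp [hg]⟩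
          obtain ⟨t, _, ht⟩ := Finset.subset_map_iff.mp this
          exact ⟨t, ht⟩
        rw [map_mem_fam]
        rcases t.eq_empty_or_nonempty with h | h
        · exact Or.inl h
        · refine Or.inr ⟨h, ?_⟩
          rw [hAs] at h4
          rw [hBs] at h5
          push Not at h4 h5
          intro p
          fin_cases p
          · exact h4
          · exact h5
    rw [hfam, hr]
    exact base_inv hAB hAc hBc h1 h2
  | succ k ih =>
    rintro V K ⟨V', L, F, hL, hF, e, he⟩ f
    rw [fam_iso K _ e he f]
    set g := e.toEmbedding.trans f with hg
    rw [fam_stellar L F hF g]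
    set g' := Function.Embedding.some.trans g with hg'
    have hI := ih V' L hL g'
    have hFm : F.map g' ∈ fam L g' := Or.inr ⟨F, hF.1, rfl⟩
    have hr : Set.range f = insert (g none) (Set.range g') := by
      ext x
      constructor
      · rintro ⟨y, rfl⟩
        obtain ⟨o, rfl⟩ := e.surjective y
        cases o with
        | none => exact Or.inl rfl
        | some o => exact Or.inr ⟨o, rfl⟩
      · rintro (rfl | ⟨o, rfl⟩)
        · exact ⟨_, rfl⟩
        · exact ⟨_, rfl⟩
    rw [hr]
    apply hI.step (by omega) hFm
    · obtain ⟨G, hG, hsub, hc⟩ := hI.pure _ hFm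
      rcases hG with rfl | ⟨t, ht, rfl⟩
      · simp at hc; omega
      · rw [Finset.map_subset_map] at hsub
        rw [← hF.2 t ht hsub]; exact hc
    · rintro ⟨o, ho⟩
      have := g.injective ho
      cases this

section transfer
variable {V : Type} [Fintype V] [LinearOrder V] (𝕜 : Type) [Field 𝕜]

open Classical in
noncomputable def phi (K : SimComplex V) (n : ℕ) : K.chains 𝕜 n →ₗ[𝕜] (Finset V → 𝕜) where
  toFun c := fun s => if h : s ∈ K.faces ∧ s.card = n + 1 then c ⟨s, h⟩ else 0
  map_add' x y := by
    funext s
    simp only [Pi.add_apply]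
    split_ifs
    · rfl
    · simp
  map_smul' r x := by
    funext s
    simp only [Pi.smul_apply, RingHom.id_apply]
    split_ifs
    · rfl
    · simp

open Classical in
lemma phi_apply (K : SimComplex V) (n : ℕ) (c : K.chains 𝕜 n) (s : Finset V) :
    phi 𝕜 K n c s = if h : s ∈ K.faces ∧ s.card = n + 1 then c ⟨s, h⟩ else 0 := rfl

lemma phi_inj (K : SimComplex V) (n : ℕ) : Function.Injective (phi 𝕜 K n) := by
  intro c d h
  ext s
  have := congrFun h s.1
  rw [phi_apply, phi_apply, dif_pos s.2, dif_pos s.2] at this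
  exact this

open Classical in
lemma phi_single (K : SimComplex V) (n : ℕ) (s : K.Face n) (t : Finset V) :
    phi 𝕜 K n (Finsupp.single s 1) t = if t = s.1 then 1 else 0 := by
  rw [phi_apply]
  split_ifs with h1 h2 h2
  · subst h2; exact Finsupp.single_eq_same
  · apply Finsupp.single_eq_of_ne
    intro h; exact h2 (by rw [← h])
  · subst h2; exact absurd s.2 h1
  · rfl

lemma phi_surj (K : SimComplex V) (n : ℕ) (c : Finset V → 𝕜)
    (hc : ∀ s, c s ≠ 0 → s ∈ K.faces ∧ s.card = n + 1) : ∃ x, phi 𝕜 K n x = c := by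
  classical
  have : Finite (K.Face n) := Subtype.finite
  refine ⟨Finsupp.equivFunOnFinite.symm (fun s => c s.1), ?_⟩
  funext s
  rw [phi_apply]
  split_ifs with h
  · rfl
  · by_contra hne
    exact h (hc s (Ne.symm hne))

lemma phi_bd (K : SimComplex V) (n : ℕ) (c : K.chains 𝕜 (n + 1)) :
    phi 𝕜 K n (K.boundary 𝕜 n c) = bd (phi 𝕜 K (n + 1) c) := by
  classical
  suffices h : (phi 𝕜 K n) ∘ₗ (K.boundary 𝕜 n) = bd ∘ₗ (phi 𝕜 K (n + 1)) from
    LinearMap.congr_fun h c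
  apply Finsupp.lhom_ext'
  intro s
  apply LinearMap.ext_ring
  simp only [LinearMap.comp_apply, Finsupp.lsingle_apply]
  have hb : K.boundary 𝕜 n (Finsupp.single s 1) = K.faceBoundary 𝕜 n s := by
    simp [SimComplex.boundary]
  rw [hb, SimComplex.faceBoundary, map_sum]
  funext t
  rw [Finset.sum_apply, bd_apply]
  simp only [map_smul, Pi.smul_apply, phi_single, smul_eq_mul]
  trans ∑ a ∈ s.1.attach, (-1 : 𝕜) ^ (s.1.filter (fun b => b < a.1)).card *
    (if t = s.1.erase a.1 then 1 else 0)
  · refine Finset.sum_congr rfl fun a _ => ?_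
    congr 1
    exact phi_single 𝕜 K n _ t
  rw [Finset.sum_attach s.1 (fun a => (-1 : 𝕜) ^ (s.1.filter (fun b => b < a)).card *
    (if t = s.1.erase a then 1 else 0))]
  rw [← Finset.sum_filter_add_sum_filter_not s.1 (fun a => t = s.1.erase a),
    ← Finset.sum_filter_add_sum_filter_not tᶜ (fun a => insert a t = s.1)]
  rw [Finset.sum_eq_zero (s := s.1.filter (fun a => ¬ t = s.1.erase a)),
    Finset.sum_eq_zero (s := tᶜ.filter (fun a => ¬ insert a t = s.1)), add_zero, add_zero]
  · have : s.1.filter (fun a => t = s.1.erase a) = tᶜ.filter (fun a => insert a t = s.1) := by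
      ext a
      simp only [Finset.mem_filter, Finset.mem_compl]
      constructor
      · rintro ⟨h1, h2⟩
        rw [h2]
        exact ⟨by simp, Finset.insert_erase h1⟩
      · rintro ⟨h1, h2⟩
        rw [← h2]
        exact ⟨by simp, (Finset.erase_insert h1).symm⟩
    rw [this]
    refine Finset.sum_congr rfl fun a ha => ?_
    simp only [Finset.mem_filter, Finset.mem_compl] at ha
    rw [if_pos ha.2, if_pos (by rw [← ha.2, Finset.erase_insert ha.1]), ← ha.2]
    have := sgn_insert_self (𝕜 := 𝕜) a t
    unfold sgn at this
    rw [this]; rfl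
  · intro a ha
    rw [if_neg (Finset.mem_filter.mp ha).2, mul_zero]
  · intro a ha
    rw [if_neg (Finset.mem_filter.mp ha).2, mul_zero]

lemma hdim_zero (K : SimComplex V) (n : ℕ)
    (h : ∀ c : Finset V → 𝕜, (∀ s, c s ≠ 0 → s ∈ K.faces ∧ s.card = n + 2) → bd c = 0 →
      ∃ e : Finset V → 𝕜, (∀ s, e s ≠ 0 → s ∈ K.faces ∧ s.card = n + 3) ∧ bd e = c) :
    K.hdimNat 𝕜 (n + 1) = 0 := by
  have hle : K.cycles 𝕜 (n + 1) ≤ LinearMap.range (K.boundary 𝕜 (n + 1)) := by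
    intro c hc
    have hc' : K.boundary 𝕜 n c = 0 := hc
    obtain ⟨e, he, hbe⟩ := h (phi 𝕜 K (n + 1) c) (by
      intro s hs
      rw [phi_apply] at hs
      split_ifs at hs with h
      · exact h
      · exact absurd rfl hs) (by rw [← phi_bd, hc', map_zero])
    obtain ⟨x, hx⟩ := phi_surj 𝕜 K (n + 2) e he
    refine ⟨x, phi_inj 𝕜 K _ ?_⟩
    rw [phi_bd, hx, hbe]
  unfold SimComplex.hdimNat
  rw [inf_eq_right.mpr hle, Nat.sub_self]

end transfer

end GT

/-- **Vanishing of homology of full subcomplexes** (Limonchenko, Lemma 2.3(i)).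
Let `P` be a generalized truncation polytope of type `(k; n₁, n₂)` with `n₁ ≥ n₂ > 1`,
`d = n₁ + n₂`, let `K = K_P` be the boundary complex of the dual simplicial polytope on
the vertex set `V`, and let `W` be a nonempty proper subset of `V`.  Then the reduced
simplicial homology of the full subcomplex `K_W` with coefficients in a field `𝕜` of
characteristic zero vanishes in every degree `i ∉ {0, n₁ - 1, n₂ - 1, d - 2}`. -/
theorem genTrunc_two_factors_full_subcomplex_homology_vanishing
    (k n₁ n₂ : ℕ) (hn : n₂ ≤ n₁) (hn₂ : 2 ≤ n₂)
    {V : Type} [Fintype V] [LinearOrder V] (K : SimComplex V)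
    (hK : IsGenTruncCx 2 ![n₁, n₂] k V K)
    (𝕜 : Type) [Field 𝕜] [CharZero 𝕜]
    (W : Finset V) (hWne : W.Nonempty) (hWproper : W ≠ Finset.univ) :
    ∀ i : ℕ, i ≠ 0 → i ≠ n₁ - 1 → i ≠ n₂ - 1 → i ≠ n₁ + n₂ - 2 →
      (K.restrict W).hdimNat 𝕜 i = 0 := by
  intro i hi0 hi1 hi2 hi3
  obtain ⟨n, rfl⟩ : ∃ n, i = n + 1 := ⟨i - 1, by omega⟩
  have hI := GT.inv_main 𝕜 (U := V) n₁ n₂ (by omega) (by omega) k V K hK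
    (Function.Embedding.refl V)
  apply GT.hdim_zero
  intro c hc hbc
  have hfam : ∀ s ∈ K.faces, s ∈ GT.fam K (Function.Embedding.refl V) := fun s hs =>
    Or.inr ⟨s, hs, by simp⟩
  have hfam' : ∀ s ∈ GT.fam K (Function.Embedding.refl V), s.Nonempty → s ∈ K.faces := by
    rintro s (rfl | ⟨t, ht, rfl⟩) hne
    · simp at hne
    · simpa using ht
  by_cases hlt : n + 4 ≤ n₁ + n₂
  · obtain ⟨e, he, hbe⟩ := hI.van W (n + 2) (by omega) (by omega) (by omega) (by omega) c
      (fun s hs => ⟨⟨hfam s (hc s hs).1.1, (hc s hs).1.2⟩, (hc s hs).2⟩) hbc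
    refine ⟨e, fun s hs => ?_, hbe⟩
    obtain ⟨⟨h1, h2⟩, h3⟩ := he s hs
    exact ⟨⟨hfam' s h1 (Finset.card_pos.mp (by omega)), h2⟩, h3⟩
  · have hc0 : c = 0 := by
      by_cases hd : n + 2 = n₁ + n₂
      · obtain ⟨x, hx⟩ : ∃ x, x ∉ W := by
          by_contra hcon
          push Not at hcon
          exact hWproper (Finset.eq_univ_iff_forall.mpr hcon)
        obtain ⟨F, hF, hxF, hFc⟩ := hI.pure _ (hI.vert x ⟨x, rfl⟩)
        refine hI.top c (fun s hs => ⟨hfam s (hc s hs).1.1, by rw [(hc s hs).2, hd]⟩) hbc F hF hFc ?_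
        by_contra hne
        exact hx ((hc F hne).1.2 (hxF (by simp)))
      · funext s
        by_contra hne
        have h1 := hI.bound s (hfam s (hc s hne).1.1)
        have h2 := (hc s hne).2
        omega
    subst hc0
    exact ⟨0, fun s hs => absurd rfl hs, map_zero _⟩
end
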